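/- Let D be a two-dimensional singular holomorphic distribution on complex projective space ℙ^n, n ≥ 3, with locally free tangent sheaf, and assume D is tangent to a one-dimensional foliation G on ℙ^n whose linear rank is at least 2. Then the following are equivalent: (1) every irreducible component of sing(G) intersects sing(D); (2) every irreducible component of sing(G) of dimension n−2 intersects sing(D); (3) sing(G) ⊆ sing(D); (4) there is a one-dimensional foliation H on ℙ^n such that T_D = T_G ⊕ T_H. In particular, if n ≥ 4, D is a two-dimensional distribution on ℙ^n with locally free tangent sheaf such that dim(sing(D)) ≥ 2, and D is tangent to a one-dimensional foliation G with linear rank at least 2, then T_D splits as a direct sum of two line bundles. -/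

import Mathlib

open Topology Filter Set
open scoped ENNReal Manifold

noncomputable section

/-- `ℂⁿ`. -/
abbrev Cn (n : ℕ) : Type := Fin n → ℂ

/-- Holomorphic `m`-forms on (open subsets of) `ℂⁿ`, as alternating-map valued functions. -/
abbrev Form (n m : ℕ) : Type := Cn n → AlternatingMap ℂ (Cn n) ℂ (Fin m)

/-- Vector fields on (open subsets of) `ℂⁿ`. -/
abbrev VF (n : ℕ) : Type := Cn n → Cn n

/-- A form is holomorphic on `U` if all its coefficient functions are. -/
def HolFormOn {n m : ℕ} (U : Set (Cn n)) (ω : Form n m) : Prop :=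
  ∀ v : Fin m → Cn n, AnalyticOnNhd ℂ (fun z => ω z v) U

/-- A form is holomorphic at (a neighborhood of) a point `c`. -/
def HolFormAt {n m : ℕ} (c : Cn n) (ω : Form n m) : Prop :=
  ∀ v : Fin m → Cn n, AnalyticAt ℂ (fun z => ω z v) c

/-- The zero locus (singular set) of a form. -/
def zeroLocus {n m : ℕ} (ω : Form n m) : Set (Cn n) := {z | ω z = 0}

/-- `V ⊆ ℂⁿ` has (complex) codimension at least `c`; via Hausdorff dimension
(a complex-analytic set of complex dimension `d` has Hausdorff dimension `2d`).
The empty set has codimension `≥ c` for every `c`. -/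
def CodimGE (n : ℕ) (V : Set (Cn n)) (c : ℕ) : Prop :=
  V = ∅ ∨ dimH V + 2 * (c : ℝ≥0∞) ≤ 2 * (n : ℝ≥0∞)

/-- The germ of `V` at `c` has codimension at least `k`. -/
def GermCodimGE (n : ℕ) (c : Cn n) (V : Set (Cn n)) (k : ℕ) : Prop :=
  ∃ U ∈ 𝓝 c, CodimGE n (V ∩ U) k

/-- `i_X (ω) = 0` at the point `z` : the form `ω` annihilates the vector `X z` at `z`. -/
def TangentAt {n m : ℕ} (ω : Form n m) (X : VF n) (z : Cn n) : Prop :=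
  ∀ (v : Fin m → Cn n) (i : Fin m), v i = X z → ω z v = 0

/-- `ω` is locally decomposable (as a wedge of holomorphic `1`-forms) at the points
of `U` where it does not vanish. -/
def LocallyDecomp {n m : ℕ} (U : Set (Cn n)) (ω : Form n m) : Prop :=
  ∀ z ∈ U, ω z ≠ 0 → ∃ W ∈ 𝓝 z, W ⊆ U ∧ ∃ η : Fin m → Cn n → (Cn n →ₗ[ℂ] ℂ),
    (∀ i (v : Cn n), AnalyticOnNhd ℂ (fun w => η i w v) W) ∧
    ∀ w ∈ W, ∀ v : Fin m → Cn n, ω w v = Matrix.det (Matrix.of fun i j => η i w (v j))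

/-- The rank of the derivative (linear part) of a vector field at a point. -/
def rkAt {n : ℕ} (X : VF n) (z : Cn n) : ℕ :=
  Module.finrank ℂ (LinearMap.range (fderiv ℂ X z).toLinearMap)

/-- The germ at `c` of the vector field `X` divides the germ of the `m`-form `ω`:
`ω = i_X Θ` for some germ of holomorphic `(m+1)`-form `Θ`. -/
def DividesAt {n m : ℕ} (X : VF n) (ω : Form n m) (c : Cn n) : Prop :=
  ∃ Θ : Form n (m + 1), HolFormAt c Θ ∧
    ∀ᶠ z in 𝓝 c, ∀ v : Fin m → Cn n, ω z v = Θ z (Fin.cons (X z) v)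

/-- The germ at `0` of an `m`-form defines a singular holomorphic distribution:
it is holomorphic, locally decomposable outside its zero set, and its zero set has
codimension at least two. -/
structure IsGermDist (n m : ℕ) (ω : Form n m) : Prop where
  hol : ∃ U ∈ 𝓝 (0 : Cn n), HolFormOn U ω ∧ LocallyDecomp U ω
  codim : GermCodimGE n 0 (zeroLocus ω) 2

/-- The tangent sheaf of the germ of two-dimensional distribution defined by the
`m`-form `ω` (`m = n - 2`) is locally free: `ω = i_Y i_Z Θ` for germs of vector fields
`Y, Z` and a germ of `n`-form `Θ`. -/
def GermLocFree2 (n m : ℕ) (ω : Form n m) : Prop :=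
  ∃ (Y Z : VF n) (Θ : Form n (m + 2)), AnalyticAt ℂ Y 0 ∧ AnalyticAt ℂ Z 0 ∧ HolFormAt 0 Θ ∧
    ∀ᶠ z in 𝓝 (0 : Cn n), ∀ v : Fin m → Cn n,
      ω z v = Θ z (Fin.cons (Y z) (Fin.cons (Z z) v))

/-- `ω = i_X i_Y Θ` near `0`, for some germ of vector field `Y` and germ of `n`-form `Θ`. -/
def DivPairAt {n m : ℕ} (X : VF n) (ω : Form n m) : Prop :=
  ∃ (Y : VF n) (Θ : Form n (m + 2)), AnalyticAt ℂ Y 0 ∧ HolFormAt 0 Θ ∧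
    ∀ᶠ z in 𝓝 (0 : Cn n), ∀ v : Fin m → Cn n,
      ω z v = Θ z (Fin.cons (X z) (Fin.cons (Y z) v))

/-- The tangent sheaf of the germ of `k`-dimensional distribution defined by the `m`-form
`ω` (`n = k + m`) is locally free: `ω = i_{X_1} ⋯ i_{X_k} Θ`. -/
def GermLocFreeK (n k m : ℕ) (h : n = k + m) (ω : Form n m) : Prop :=
  ∃ (Xs : Fin k → VF n) (Θ : Form n n), (∀ i, AnalyticAt ℂ (Xs i) 0) ∧ HolFormAt 0 Θ ∧
    ∀ᶠ z in 𝓝 (0 : Cn n), ∀ v : Fin m → Cn n,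
      ω z v = Θ z (fun i => Fin.append (fun a => Xs a z) v (Fin.cast h i))

/-- The germs at `c` of the vector fields `Xs` freely generate the germs of vector
fields tangent to the distribution defined by `ω` : every germ of tangent vector field
is a combination of the `Xs` with holomorphic coefficients, and the coefficients in such
combinations are unique (i.e. the `Xs` are independent over the local ring at `c`). -/
def FreeGensAt {n m : ℕ} (ω : Form n m) {k : ℕ} (Xs : Fin k → VF n) (c : Cn n) : Prop :=
  (∀ Z : VF n, AnalyticAt ℂ Z c → (∀ᶠ z in 𝓝 c, TangentAt ω Z z) →
      ∃ f : Fin k → Cn n → ℂ, (∀ i, AnalyticAt ℂ (f i) c) ∧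
        ∀ᶠ z in 𝓝 c, Z z = ∑ i, f i z • Xs i z) ∧
  (∀ f : Fin k → Cn n → ℂ, (∀ i, AnalyticAt ℂ (f i) c) →
      (∀ᶠ z in 𝓝 c, (∑ i, f i z • Xs i z) = 0) → ∀ i, ∀ᶠ z in 𝓝 c, f i z = 0)

/-- Polydiscs in `ℂⁿ`. -/
def IsPolydisc {n : ℕ} (U : Set (Cn n)) : Prop :=
  ∃ (c : Cn n) (r : Fin n → ℝ), (∀ i, 0 < r i) ∧ U = {z | ∀ i, dist (z i) (c i) < r i}

/-- The wedge product of a `1`-form with a `k`-form, as a function of `k+1` vectors. -/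
def wedge1 {n k : ℕ} (ω : Form n 1) (α : Form n k) (z : Cn n) (v : Fin (k + 1) → Cn n) : ℂ :=
  ∑ i : Fin (k + 1), (-1 : ℂ) ^ (i : ℕ) * ω z (fun _ => v i) * α z (fun j => v (i.succAbove j))

/-! ### Analytic subsets of open sets of `ℂᴺ`, irreducibility, components -/

/-- `V` is an analytic subset of `U`: locally (on `U`) it is the common zero set of
finitely many holomorphic functions. -/
def IsAnalyticIn {N : ℕ} (U V : Set (Cn N)) : Prop :=
  V ⊆ U ∧ ∀ p ∈ U, ∃ W ∈ 𝓝 p, ∃ (r : ℕ) (f : Fin r → Cn N → ℂ),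
    (∀ i, AnalyticOnNhd ℂ (f i) W) ∧ ∀ z ∈ W ∩ U, (z ∈ V ↔ ∀ i, f i z = 0)

/-- An irreducible analytic subset of `U`. -/
def IsIrredAnalyticIn {N : ℕ} (U V : Set (Cn N)) : Prop :=
  IsAnalyticIn U V ∧ V.Nonempty ∧
    ∀ V1 V2, IsAnalyticIn U V1 → IsAnalyticIn U V2 → V = V1 ∪ V2 → V = V1 ∨ V = V2

/-- `C` is an irreducible component of the analytic set `V ⊆ U` : a maximal irreducible
analytic subset of `U` contained in `V`. -/
def IsIrredComponentIn {N : ℕ} (U V C : Set (Cn N)) : Prop :=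
  IsIrredAnalyticIn U C ∧ C ⊆ V ∧ ∀ C', IsIrredAnalyticIn U C' → C ⊆ C' → C' ⊆ V → C' = C

/-! ### Distributions and foliations on `ℙⁿ`, in homogeneous coordinates -/

/-- A `k`-dimensional singular holomorphic distribution of degree `d` on `ℙⁿ`, given in
homogeneous coordinates by a homogeneous `(n-k)`-form `ω` on `ℂⁿ⁺¹` (with polynomial
coefficients of degree `d+1`) satisfying `i_R ω = 0`, locally decomposable outside its
singular set, whose singular set has codimension at least `2`. -/
structure ProjDist (n k : ℕ) where
  d : ℕ
  ω : Form (n + 1) (n - k)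
  hol : HolFormOn Set.univ ω
  homog : ∀ (t : ℂ) (z : Cn (n + 1)) (v : Fin (n - k) → Cn (n + 1)),
    ω (t • z) v = t ^ (d + 1) * ω z v
  radial : ∀ (z : Cn (n + 1)) (v : Fin (n - k) → Cn (n + 1)) (i : Fin (n - k)),
    v i = z → ω z v = 0
  decomp : LocallyDecomp Set.univ ω
  codim : CodimGE (n + 1) {z | z ≠ 0 ∧ ω z = 0} 2

/-- The singular set of a distribution on `ℙⁿ`, as a cone in `ℂⁿ⁺¹ \ {0}`. -/
def ProjDist.coneSing {n k : ℕ} (D : ProjDist n k) : Set (Cn (n + 1)) :=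
  {z | z ≠ 0 ∧ D.ω z = 0}

/-- A one-dimensional singular holomorphic foliation of degree `d` on `ℙⁿ`, given in
homogeneous coordinates by a homogeneous polynomial vector field on `ℂⁿ⁺¹`, whose
singular set (points where `V ∧ R = 0`) has codimension at least `2`. -/
structure ProjFol1 (n : ℕ) where
  d : ℕ
  V : VF (n + 1)
  hol : AnalyticOnNhd ℂ V Set.univ
  homog : ∀ (t : ℂ) (z : Cn (n + 1)), V (t • z) = t ^ d • V z
  codim : CodimGE (n + 1) {z | z ≠ 0 ∧ V z ∈ Submodule.span ℂ {z}} 2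

/-- The singular set of a one-dimensional foliation on `ℙⁿ`, as a cone in `ℂⁿ⁺¹ \ {0}`. -/
def ProjFol1.coneSing {n : ℕ} (G : ProjFol1 n) : Set (Cn (n + 1)) :=
  {z | z ≠ 0 ∧ G.V z ∈ Submodule.span ℂ {z}}

/-- The foliation `G` is tangent to the distribution `D` : `i_V ω = 0`. -/
def PTangent {n k : ℕ} (G : ProjFol1 n) (D : ProjDist n k) : Prop :=
  ∀ (z : Cn (n + 1)) (v : Fin (n - k) → Cn (n + 1)) (i : Fin (n - k)),
    v i = G.V z → D.ω z v = 0

/-- `G` locally divides the two-dimensional distribution `D` at the point of `ℙⁿ`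
corresponding to `q ∈ ℂⁿ⁺¹ \ {0}` : in homogeneous coordinates, `ω = i_V i_R Θ` near `q`
for some germ of holomorphic `(n-1)`-form `Θ` (equivalently, in an affine chart at `[q]`,
the defining vector field of `G` divides the defining form of `D`). -/
def PLocDividesAt {n : ℕ} (G : ProjFol1 n) (D : ProjDist n 2) (q : Cn (n + 1)) : Prop :=
  ∃ Θ : Form (n + 1) (n - 2 + 2), HolFormAt q Θ ∧
    ∀ᶠ z in 𝓝 q, ∀ v : Fin (n - 2) → Cn (n + 1),
      D.ω z v = Θ z (Fin.cons (G.V z) (Fin.cons z v))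

/-- The tangent sheaf of the two-dimensional distribution `D` on `ℙⁿ` is locally free:
near every point of `ℂⁿ⁺¹ \ {0}` one can write `ω = i_X i_Y i_R Θ`. -/
def PLocFreeAt {n : ℕ} (D : ProjDist n 2) (q : Cn (n + 1)) : Prop :=
  ∃ (X Y : VF (n + 1)) (Θ : Form (n + 1) (n - 2 + 3)),
    AnalyticAt ℂ X q ∧ AnalyticAt ℂ Y q ∧ HolFormAt q Θ ∧
    ∀ᶠ z in 𝓝 q, ∀ v : Fin (n - 2) → Cn (n + 1),
      D.ω z v = Θ z (Fin.cons (X z) (Fin.cons (Y z) (Fin.cons z v)))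

def PLocFree {n : ℕ} (D : ProjDist n 2) : Prop :=
  ∀ q : Cn (n + 1), q ≠ 0 → PLocFreeAt D q

/-- The linearization, at a singular point `q` (with `ℓ q = 1`), of the vector field
induced on the affine chart `{ℓ = 1}` of `ℙⁿ` by the homogeneous vector field `V`. -/
def projLin {n : ℕ} (V : VF n) (q : Cn n) (ℓ : Cn n →ₗ[ℂ] ℂ) : Cn n →ₗ[ℂ] Cn n :=
  (fderiv ℂ V q).toLinearMap - LinearMap.smulRight (ℓ ∘ₗ (fderiv ℂ V q).toLinearMap) q
    - ℓ (V q) • LinearMap.id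

/-- The linear rank of the one-dimensional foliation `G` on `ℙⁿ` is at least `r` :
at every singular point, the linearization of the vector field induced on an affine
chart has rank at least `r`. -/
def PLinRankGE {n : ℕ} (G : ProjFol1 n) (r : ℕ) : Prop :=
  ∀ q ∈ G.coneSing, ∃ ℓ : Cn (n + 1) →ₗ[ℂ] ℂ, ℓ q = 1 ∧
    r ≤ Module.finrank ℂ (Submodule.map (projLin G.V q ℓ) (LinearMap.ker ℓ))

/-- `T_D = T_G ⊕ T_H` : in homogeneous coordinates,
`ω = c ⋅ i_{V_G} i_{V_H} i_R (dx_0 ∧ ⋯ ∧ dx_n)` for a nonzero constant `c`. -/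
def SplitPair {n : ℕ} (hn : n + 1 = 3 + (n - 2)) (G H : ProjFol1 n) (D : ProjDist n 2) :
    Prop :=
  ∃ c : ℂ, c ≠ 0 ∧ ∀ (z : Cn (n + 1)) (v : Fin (n - 2) → Cn (n + 1)),
    D.ω z v = c * Matrix.det (Matrix.of fun i j =>
      Fin.append ![G.V z, H.V z, z] v (Fin.cast hn i) j)

/-- The tangent sheaf of the two-dimensional distribution `D` on `ℙⁿ` splits as a direct
sum of two line bundles: `ω = c ⋅ i_{X_1} i_{X_2} i_R (dx_0 ∧ ⋯ ∧ dx_n)` for homogeneous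
polynomial vector fields `X_1, X_2` on `ℂⁿ⁺¹`. -/
def PSplits {n : ℕ} (hn : n + 1 = 3 + (n - 2)) (D : ProjDist n 2) : Prop :=
  ∃ (X1 X2 : VF (n + 1)) (d1 d2 : ℕ) (c : ℂ), c ≠ 0 ∧
    AnalyticOnNhd ℂ X1 Set.univ ∧ AnalyticOnNhd ℂ X2 Set.univ ∧
    (∀ (t : ℂ) (z : Cn (n + 1)), X1 (t • z) = t ^ d1 • X1 z) ∧
    (∀ (t : ℂ) (z : Cn (n + 1)), X2 (t • z) = t ^ d2 • X2 z) ∧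
    ∀ (z : Cn (n + 1)) (v : Fin (n - 2) → Cn (n + 1)),
      D.ω z v = c * Matrix.det (Matrix.of fun i j =>
        Fin.append ![X1 z, X2 z, z] v (Fin.cast hn i) j)

/-- The coefficient of the exterior differential of a `1`-form: `dω(a,b)` at `z`. -/
def extd1 {N : ℕ} (ω : Form N 1) (z a b : Cn N) : ℂ :=
  fderiv ℂ (fun y => ω y ![b]) z a - fderiv ℂ (fun y => ω y ![a]) z b

/-- The Frobenius integrability condition `ω ∧ dω = 0` for a `1`-form. -/
def Integrable1 {N : ℕ} (ω : Form N 1) : Prop :=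
  ∀ z a b c : Cn N,
    ω z ![a] * extd1 ω z b c + ω z ![b] * extd1 ω z c a + ω z ![c] * extd1 ω z a b = 0

/-! ### Distributions and foliations on complex manifolds -/

section Manifold

variable {n k : ℕ} {M : Type*} [TopologicalSpace M] [ChartedSpace (Cn n) M]

/-- A `k`-dimensional singular holomorphic distribution on a complex `n`-manifold `M`:
around each point it is given, in the chart at that point, by a holomorphic `(n-k)`-form,
locally decomposable outside its zero set, with zero set of codimension at least 2;
on overlaps the local forms agree up to a nonvanishing holomorphic factor. -/
structure MDist (n k : ℕ) (M : Type*) [TopologicalSpace M] [ChartedSpace (Cn n) M] where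
  ω : M → Form n (n - k)
  dom : M → Set (Cn n)
  dom_open : ∀ p, IsOpen (dom p)
  dom_sub : ∀ p, dom p ⊆ (chartAt (Cn n) p).target
  dom_mem : ∀ p, chartAt (Cn n) p p ∈ dom p
  hol : ∀ p, HolFormOn (dom p) (ω p)
  decomp : ∀ p, LocallyDecomp (dom p) (ω p)
  codim : ∀ p, CodimGE n (zeroLocus (ω p) ∩ dom p) 2
  compat : ∀ p q : M, ∀ x : M, x ∈ (chartAt (Cn n) p).source → x ∈ (chartAt (Cn n) q).source →
    chartAt (Cn n) p x ∈ dom p → chartAt (Cn n) q x ∈ dom q →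
    ∃ W ∈ 𝓝 (chartAt (Cn n) p x), W ⊆ dom p ∧
      ∃ h : Cn n → ℂ, AnalyticOnNhd ℂ h W ∧ (∀ z ∈ W, h z ≠ 0) ∧
      ∀ z ∈ W, ∀ v : Fin (n - k) → Cn n,
        ω p z v = h z * ω q ((chartAt (Cn n) q) ((chartAt (Cn n) p).symm z))
          (fun i => fderiv ℂ (fun y => (chartAt (Cn n) q) ((chartAt (Cn n) p).symm y)) z (v i))

/-- The singular set of a distribution on a manifold. -/
def MDist.sing (D : MDist n k M) : Set M :=
  {x | D.ω x (chartAt (Cn n) x x) = 0}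

/-- A one-dimensional singular holomorphic foliation on a complex `n`-manifold `M`:
around each point it is given, in the chart at that point, by a holomorphic vector field
with singular set of codimension at least 2; on overlaps the local vector fields agree,
up to a nonvanishing holomorphic factor, under the differentials of the transition maps. -/
structure MFol1 (n : ℕ) (M : Type*) [TopologicalSpace M] [ChartedSpace (Cn n) M] where
  V : M → VF n
  dom : M → Set (Cn n)
  dom_open : ∀ p, IsOpen (dom p)
  dom_sub : ∀ p, dom p ⊆ (chartAt (Cn n) p).target
  dom_mem : ∀ p, chartAt (Cn n) p p ∈ dom p
  hol : ∀ p, AnalyticOnNhd ℂ (V p) (dom p)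
  codim : ∀ p, CodimGE n ({z ∈ dom p | V p z = 0}) 2
  compat : ∀ p q : M, ∀ x : M, x ∈ (chartAt (Cn n) p).source → x ∈ (chartAt (Cn n) q).source →
    chartAt (Cn n) p x ∈ dom p → chartAt (Cn n) q x ∈ dom q →
    ∃ W ∈ 𝓝 (chartAt (Cn n) p x), W ⊆ dom p ∧
      ∃ h : Cn n → ℂ, AnalyticOnNhd ℂ h W ∧ (∀ z ∈ W, h z ≠ 0) ∧
      ∀ z ∈ W,
        fderiv ℂ (fun y => (chartAt (Cn n) q) ((chartAt (Cn n) p).symm y)) z (V p z)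
          = h z • V q ((chartAt (Cn n) q) ((chartAt (Cn n) p).symm z))

/-- The singular set of a one-dimensional foliation on a manifold. -/
def MFol1.sing (G : MFol1 n M) : Set M :=
  {x | G.V x (chartAt (Cn n) x x) = 0}

/-- The foliation `G` is tangent to the distribution `D`. -/
def MTangent (G : MFol1 n M) (D : MDist n k M) : Prop :=
  ∀ p : M, ∀ z ∈ G.dom p ∩ D.dom p, TangentAt (D.ω p) (G.V p) z

/-- `G` locally divides `D` at `p` : in the chart at `p`, the germ of the defining vector
field of `G` divides the germ of the defining form of `D`. -/
def MLocDividesAt (G : MFol1 n M) (D : MDist n k M) (p : M) : Prop :=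
  DividesAt (G.V p) (D.ω p) (chartAt (Cn n) p p)

/-- The linear rank of `G` is at least `r`: at every singular point `p`, the rank of the
derivative at (the chart image of) `p` of the defining vector field is at least `r`. -/
def MLinRankGE (G : MFol1 n M) (r : ℕ) : Prop :=
  ∀ p ∈ MFol1.sing G, r ≤ rkAt (G.V p) (chartAt (Cn n) p p)

/-- The stalk of the tangent sheaf of `D` at `p` is a free module with `r` generators. -/
def MStalkFreeWith (D : MDist n k M) (p : M) (r : ℕ) : Prop :=
  ∃ Xs : Fin r → VF n, (∀ i, AnalyticAt ℂ (Xs i) (chartAt (Cn n) p p)) ∧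
    (∀ i, ∀ᶠ z in 𝓝 (chartAt (Cn n) p p), TangentAt (D.ω p) (Xs i) z) ∧
    FreeGensAt (D.ω p) Xs (chartAt (Cn n) p p)

/-- (a) The tangent sheaf of `D` is locally free of rank `k`: near every point there are
`k` holomorphic tangent vector fields which freely generate every stalk. -/
def MPropA (D : MDist n k M) : Prop :=
  ∀ p : M, ∃ U : Set (Cn n), IsOpen U ∧ chartAt (Cn n) p p ∈ U ∧ U ⊆ D.dom p ∧
    ∃ Xs : Fin k → VF n, (∀ i, AnalyticOnNhd ℂ (Xs i) U) ∧
      (∀ i, ∀ z ∈ U, TangentAt (D.ω p) (Xs i) z) ∧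
      ∀ z ∈ U, FreeGensAt (D.ω p) Xs z

/-- (b) Near every point, `T_D` is the direct sum of the tangent sheaves of `k`
one-dimensional foliations (defined by vector fields with singular set of codim `≥ 2`). -/
def MPropB (D : MDist n k M) : Prop :=
  ∀ p : M, ∃ U : Set (Cn n), IsOpen U ∧ chartAt (Cn n) p p ∈ U ∧ U ⊆ D.dom p ∧
    ∃ Xs : Fin k → VF n, (∀ i, AnalyticOnNhd ℂ (Xs i) U) ∧
      (∀ i, CodimGE n {z ∈ U | Xs i z = 0} 2) ∧
      (∀ i, ∀ z ∈ U, TangentAt (D.ω p) (Xs i) z) ∧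
      ∀ z ∈ U, FreeGensAt (D.ω p) Xs z

/-- (c) Near every point, a form `i_{X_1} ⋯ i_{X_k} Θ` defines `D`. -/
def MPropC (h : n = k + (n - k)) (D : MDist n k M) : Prop :=
  ∀ p : M, ∃ U : Set (Cn n), IsOpen U ∧ chartAt (Cn n) p p ∈ U ∧ U ⊆ D.dom p ∧
    ∃ (Xs : Fin k → VF n) (Θ : Form n n) (u : Cn n → ℂ),
      (∀ i, AnalyticOnNhd ℂ (Xs i) U) ∧ HolFormOn U Θ ∧
      AnalyticOnNhd ℂ u U ∧ (∀ z ∈ U, u z ≠ 0) ∧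
      ∀ z ∈ U, ∀ v : Fin (n - k) → Cn n,
        D.ω p z v = u z * Θ z (fun i => Fin.append (fun a => Xs a z) v (Fin.cast h i))

/-- (d) At every point, a form `i_{X_1} ⋯ i_{X_k} Θ` defines the germ of `D`. -/
def MPropD (h : n = k + (n - k)) (D : MDist n k M) : Prop :=
  ∀ p : M, ∃ (Xs : Fin k → VF n) (Θ : Form n n) (u : Cn n → ℂ),
    (∀ i, AnalyticAt ℂ (Xs i) (chartAt (Cn n) p p)) ∧ HolFormAt (chartAt (Cn n) p p) Θ ∧
    AnalyticAt ℂ u (chartAt (Cn n) p p) ∧ u (chartAt (Cn n) p p) ≠ 0 ∧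
    ∀ᶠ z in 𝓝 (chartAt (Cn n) p p), ∀ v : Fin (n - k) → Cn n,
      D.ω p z v = u z * Θ z (fun i => Fin.append (fun a => Xs a z) v (Fin.cast h i))

/-- (e) Every stalk of `T_D` is a free module with `k` generators. -/
def MPropE (D : MDist n k M) : Prop :=
  ∀ p : M, MStalkFreeWith D p k

/-- A subset `S` of the complex manifold `M` is analytic: it is closed and locally,
in charts, the common zero set of finitely many holomorphic functions. -/
def MIsAnalytic (n : ℕ) {M : Type*} [TopologicalSpace M] [ChartedSpace (Cn n) M] (S : Set M) : Prop :=
  IsClosed S ∧ ∀ p : M, ∃ W ∈ 𝓝 (chartAt (Cn n) p p), ∃ (r : ℕ) (f : Fin r → Cn n → ℂ),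
    (∀ i, AnalyticOnNhd ℂ (f i) W) ∧
    ∀ z ∈ W ∩ (chartAt (Cn n) p).target, ((chartAt (Cn n) p).symm z ∈ S ↔ ∀ i, f i z = 0)

/-- Irreducible analytic subsets of `M`. -/
def MIrredAnalytic (n : ℕ) {M : Type*} [TopologicalSpace M] [ChartedSpace (Cn n) M] (S : Set M) : Prop :=
  MIsAnalytic n S ∧ S.Nonempty ∧
    ∀ S1 S2 : Set M, MIsAnalytic n S1 → MIsAnalytic n S2 → S = S1 ∪ S2 → S = S1 ∨ S = S2

/-- `C` is an irreducible component of `V ⊆ M`. -/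
def MIrredComponentOf (n : ℕ) {M : Type*} [TopologicalSpace M] [ChartedSpace (Cn n) M] (V C : Set M) : Prop :=
  MIrredAnalytic n C ∧ C ⊆ V ∧ ∀ C', MIrredAnalytic n C' → C ⊆ C' → C' ⊆ V → C' = C

/-- The local dimension of `S ⊆ M` at `p` equals `d` (via Hausdorff dimension of chart
images on small neighborhoods). -/
def MLocDimEq (n : ℕ) {M : Type*} [TopologicalSpace M] [ChartedSpace (Cn n) M] (S : Set M) (p : M) (d : ℕ) : Prop :=
  ∀ᶠ U in (𝓝 p).smallSets,
    dimH (chartAt (Cn n) p '' (S ∩ U ∩ (chartAt (Cn n) p).source)) = ((2 * d : ℕ) : ℝ≥0∞)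

/-- The dimension of `S ⊆ M` equals `d`. -/
def MDimEq (n : ℕ) {M : Type*} [TopologicalSpace M] [ChartedSpace (Cn n) M] (S : Set M) (d : ℕ) : Prop :=
  (∀ p : M, ∀ᶠ U in (𝓝 p).smallSets,
    dimH (chartAt (Cn n) p '' (S ∩ U ∩ (chartAt (Cn n) p).source)) ≤ ((2 * d : ℕ) : ℝ≥0∞)) ∧
  ∃ p : M, MLocDimEq n S p d

end Manifold

end

open Topology Filter Set

/-! ### Part 1: algebra -/

theorem ufd_prop {S ι : Type*} [CommRing S] [IsDomain S] [UniqueFactorizationMonoid S]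
    (u w : ι → S) (h : ∀ i j, u i * w j = u j * w i)
    (hu : ∀ p : S, Irreducible p → ∃ i, ¬ p ∣ u i) (i0 : ι) (hi0 : u i0 ≠ 0) :
    ∃ f, ∀ i, w i = f * u i := by
  have key : ∀ c : S, c ≠ 0 → ∀ e : S, (∀ j, c * w j = e * u j) → ∃ f, ∀ i, w i = f * u i := by
    intro c
    induction c using WfDvdMonoid.induction_on_irreducible with
    | zero => intro h; exact absurd rfl h
    | unit c hc =>
      intro _ e he
      obtain ⟨d, rfl⟩ := hc
      refine ⟨↑d⁻¹ * e, fun i => ?_⟩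
      rw [mul_assoc, ← he i, ← mul_assoc]; simp
    | mul a p ha hp ih =>
      intro _ e he
      obtain ⟨j, hj⟩ := hu p hp
      have hpe : p ∣ e := by
        have : p ∣ e * u j := by rw [← he j, mul_assoc]; exact dvd_mul_right _ _
        exact (hp.prime.dvd_or_dvd this).resolve_right hj
      obtain ⟨e', rfl⟩ := hpe
      apply ih ha e'
      intro j
      apply mul_left_cancel₀ hp.ne_zero
      rw [← mul_assoc, he j]; ring
  exact key (u i0) hi0 (w i0) (fun j => by rw [h i0 j, mul_comm])

theorem koszul_pow {σ : Type*} {i j k : σ} (hik : i ≠ k) (hjk : j ≠ k) (M : ℕ)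
    (s α β : MvPolynomial σ ℂ)
    (h : MvPolynomial.X k ^ M * s = MvPolynomial.X i ^ M * α + MvPolynomial.X j ^ M * β) :
    ∃ α' β', s = MvPolynomial.X i ^ M * α' + MvPolynomial.X j ^ M * β' := by
  classical
  have hspan : ∀ t : MvPolynomial σ ℂ,
      (∃ α' β', t = MvPolynomial.X i ^ M * α' + MvPolynomial.X j ^ M * β') ↔
      t ∈ Ideal.span ((fun s => MvPolynomial.monomial s (1:ℂ)) ''
        {Finsupp.single i M, Finsupp.single j M}) := by
    intro t
    rw [Set.image_pair, Ideal.mem_span_pair]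
    simp only [← MvPolynomial.X_pow_eq_monomial]
    constructor
    · rintro ⟨a, b, rfl⟩; exact ⟨a, b, by ring⟩
    · rintro ⟨a, b, rfl⟩; exact ⟨a, b, by ring⟩
  rw [hspan]
  have h1 := (hspan _).1 ⟨α, β, h⟩
  rw [MvPolynomial.mem_ideal_span_monomial_image] at h1 ⊢
  intro x hx
  obtain ⟨y, hy, hle⟩ := h1 (Finsupp.single k M + x) (by
    rw [MvPolynomial.mem_support_iff] at hx ⊢
    rwa [MvPolynomial.X_pow_eq_monomial, MvPolynomial.coeff_monomial_mul, one_mul])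
  refine ⟨y, hy, ?_⟩
  simp only [Set.mem_insert_iff, Set.mem_singleton_iff] at hy
  rcases hy with rfl | rfl
  · have := hle i
    rw [Finsupp.single_le_iff]
    simpa [Finsupp.single_apply, hik.symm] using this
  · have := hle j
    rw [Finsupp.single_le_iff]
    simpa [Finsupp.single_apply, hjk.symm] using this

theorem X_pow_dvd_of_mul {σ : Type*} {i j : σ} (hij : i ≠ j) (M : ℕ) (s t : MvPolynomial σ ℂ)
    (h : MvPolynomial.X j ^ M * s = MvPolynomial.X i ^ M * t) :
    ∃ r, s = MvPolynomial.X i ^ M * r := by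
  have hp : Prime (MvPolynomial.X i : MvPolynomial σ ℂ) := MvPolynomial.X_prime
  have : (MvPolynomial.X i : MvPolynomial σ ℂ) ^ M ∣ s := by
    apply hp.pow_dvd_of_dvd_mul_left M (a := MvPolynomial.X j ^ M) (b := s)
    · intro hd
      have := hp.dvd_of_dvd_pow hd
      rw [MvPolynomial.X_dvd_X] at this
      exact hij this
    · exact ⟨t, h⟩
  exact this

theorem null_pow {σ : Type*} [Finite σ] (I : Ideal (MvPolynomial σ ℂ))
    (h : ∀ q : σ → ℂ, q ≠ 0 → ∃ g ∈ I, MvPolynomial.eval q g ≠ 0) (i : σ) :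
    ∃ M : ℕ, MvPolynomial.X i ^ M ∈ I := by
  have : MvPolynomial.X i ∈ I.radical := by
    rw [← MvPolynomial.vanishingIdeal_zeroLocus_eq_radical (K := ℂ),
      MvPolynomial.mem_vanishingIdeal_iff]
    intro x hx
    by_cases hx0 : x = 0
    · simp [hx0]
    · obtain ⟨g, hg, hgx⟩ := h x hx0
      rw [MvPolynomial.mem_zeroLocus_iff] at hx
      exact absurd (by simpa [MvPolynomial.aeval_eq_eval] using hx g hg) hgx
  exact this

/-! ### brackets -/

section br
variable {S : Type*} [CommRing S] {m : ℕ}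

def brM (A B C : Fin (m + 3) → S) (v : Fin m → Fin (m + 3) → S) :
    Matrix (Fin (m + 3)) (Fin (m + 3)) S :=
  Matrix.of (Fin.cons A (Fin.cons B (Fin.cons C v)))

def br (A B C : Fin (m + 3) → S) (v : Fin m → Fin (m + 3) → S) : S := (brM A B C v).det

def eI (S : Type*) [CommRing S] {m : ℕ} (I : Fin m → Fin (m + 3)) : Fin m → Fin (m + 3) → S :=
  fun k => Pi.single (I k) 1

theorem fin_one_eq (m : ℕ) : (1 : Fin (m + 3)) = Fin.succ 0 := rfl
theorem fin_two_eq (m : ℕ) : (2 : Fin (m + 3)) = Fin.succ (Fin.succ 0) := rfl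

theorem brM_up0 (A B C Z : Fin (m + 3) → S) (v) :
    (brM A B C v).updateRow 0 Z = brM Z B C v := by
  ext i j
  rw [Matrix.updateRow_apply]
  refine Fin.cases ?_ (fun i => ?_) i
  · simp [brM]
  · simp [brM]

theorem brM_up1 (A B C Z : Fin (m + 3) → S) (v) :
    (brM A B C v).updateRow 1 Z = brM A Z C v := by
  ext i j
  rw [Matrix.updateRow_apply, fin_one_eq]
  refine Fin.cases ?_ (fun i => Fin.cases ?_ (fun i => ?_) i) i
  · rw [if_neg (Fin.succ_ne_zero _).symm]; rfl
  · rw [if_pos rfl]; rfl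
  · rw [if_neg (by rw [Fin.succ_inj]; exact Fin.succ_ne_zero _)]; rfl

theorem brM_up2 (A B C Z : Fin (m + 3) → S) (v) :
    (brM A B C v).updateRow 2 Z = brM A B Z v := by
  ext i j
  rw [Matrix.updateRow_apply, fin_two_eq]
  refine Fin.cases ?_ (fun i => Fin.cases ?_ (fun i => Fin.cases ?_ (fun i => ?_) i) i) i
  · rw [if_neg (Fin.succ_ne_zero _).symm]; rfl
  · rw [if_neg (by rw [Fin.succ_inj]; exact (Fin.succ_ne_zero _).symm)]; rfl
  · rw [if_pos rfl]; rfl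
  · rw [if_neg (by rw [Fin.succ_inj, Fin.succ_inj]; exact Fin.succ_ne_zero _)]; rfl

theorem brM_up3 (A B C Z : Fin (m + 3) → S) (v) (k : Fin m) :
    (brM A B C v).updateRow k.succ.succ.succ Z = brM A B C (Function.update v k Z) := by
  unfold brM Matrix.updateRow
  simp only [Fin.cons_update]; rfl

theorem br_add0 (A A' B C : Fin (m + 3) → S) (v) : br (A + A') B C v = br A B C v + br A' B C v := by
  have := Matrix.det_updateRow_add (brM A B C v) 0 A A'
  simpa only [brM_up0, ← br.eq_1] using this
theorem br_add1 (A B B' C : Fin (m + 3) → S) (v) : br A (B + B') C v = br A B C v + br A B' C v := by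
  have := Matrix.det_updateRow_add (brM A B C v) 1 B B'
  simpa only [brM_up1, ← br.eq_1] using this
theorem br_add2 (A B C C' : Fin (m + 3) → S) (v) : br A B (C + C') v = br A B C v + br A B C' v := by
  have := Matrix.det_updateRow_add (brM A B C v) 2 C C'
  simpa only [brM_up2, ← br.eq_1] using this
theorem br_smul0 (t : S) (A B C : Fin (m + 3) → S) (v) : br (t • A) B C v = t * br A B C v := by
  have := Matrix.det_updateRow_smul (brM A B C v) 0 t A
  simpa only [brM_up0, ← br.eq_1] using this
theorem br_smul1 (t : S) (A B C : Fin (m + 3) → S) (v) : br A (t • B) C v = t * br A B C v := by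
  have := Matrix.det_updateRow_smul (brM A B C v) 1 t B
  simpa only [brM_up1, ← br.eq_1] using this
theorem br_smul2 (t : S) (A B C : Fin (m + 3) → S) (v) : br A B (t • C) v = t * br A B C v := by
  have := Matrix.det_updateRow_smul (brM A B C v) 2 t C
  simpa only [brM_up2, ← br.eq_1] using this

theorem brM_0 (A B C : Fin (m + 3) → S) (v) : brM A B C v 0 = A := rfl
theorem brM_1 (A B C : Fin (m + 3) → S) (v) : brM A B C v 1 = B := rfl
theorem brM_2 (A B C : Fin (m + 3) → S) (v) : brM A B C v 2 = C := rfl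
theorem brM_3 (A B C : Fin (m + 3) → S) (v) (k : Fin m) : brM A B C v k.succ.succ.succ = v k := rfl

theorem br_01 (A C : Fin (m + 3) → S) (v) : br A A C v = 0 :=
  Matrix.det_zero_of_row_eq (i := 0) (j := 1) (by intro h; simpa using congrArg Fin.val h) rfl
theorem br_02 (A B : Fin (m + 3) → S) (v) : br A B A v = 0 :=
  Matrix.det_zero_of_row_eq (i := 0) (j := 2) (by rw [fin_two_eq]; exact (Fin.succ_ne_zero _).symm) rfl
theorem br_12 (A B : Fin (m + 3) → S) (v) : br A B B v = 0 :=
  Matrix.det_zero_of_row_eq (i := 1) (j := 2) (by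
    rw [fin_two_eq, fin_one_eq, Ne, Fin.succ_inj]; exact (Fin.succ_ne_zero _).symm) rfl

theorem br_sw01 (A B C : Fin (m + 3) → S) (v) : br B A C v = - br A B C v := by
  have := br_01 (A + B) C v
  rw [br_add0, br_add1, br_add1, br_01, br_01] at this
  linear_combination this
theorem br_sw12 (A B C : Fin (m + 3) → S) (v) : br A C B v = - br A B C v := by
  have := br_12 A (B + C) v
  rw [br_add1, br_add2, br_add2, br_12, br_12] at this
  linear_combination this
theorem br_sw02 (A B C : Fin (m + 3) → S) (v) : br C B A v = - br A B C v := by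
  have := br_02 (A + C) B v
  rw [br_add0, br_add2, br_add2, br_02, br_02] at this
  linear_combination this

theorem br_sub1 (A B B' C : Fin (m + 3) → S) (v) : br A (B - B') C v = br A B C v - br A B' C v := by
  have := br_add1 A (B - B') B' C v
  rw [sub_add_cancel] at this
  linear_combination -this

/-- Cramer's rule. -/
theorem br_cramer (A B C Z : Fin (m + 3) → S) (v) :
    br A B C v • Z = br Z B C v • A + br A Z C v • B + br A B Z v • C
      + ∑ k, br A B C (Function.update v k Z) • v k := by
  have h := Matrix.mulVec_cramer (Matrix.transpose (brM A B C v)) Z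
  rw [Matrix.det_transpose] at h
  unfold br
  rw [← h]
  ext j
  simp only [Matrix.mulVec, dotProduct, Matrix.cramer_transpose_apply, Matrix.transpose_apply,
    Fin.sum_univ_succ (n := m + 2), Fin.sum_univ_succ (n := m + 1), Fin.sum_univ_succ (n := m)]
  have h1 : (Fin.succ 0 : Fin (m+3)) = 1 := rfl
  have h2 : (Fin.succ (Fin.succ 0) : Fin (m+3)) = 2 := rfl
  rw [h1, h2]
  simp only [brM_up0, brM_up1, brM_up2, brM_up3, brM_0, brM_1, brM_2, brM_3, Pi.add_apply,
    Pi.smul_apply, smul_eq_mul, Finset.sum_apply]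
  simp only [mul_comm]
  ring

theorem br_update_expand (A B C Z : Fin (m + 3) → S) (I : Fin m → Fin (m + 3)) (k : Fin m) :
    br A B C (Function.update (eI S I) k Z) =
      ∑ l, Z l * br A B C (eI S (Function.update I k l)) := by
  have hZ : Z = ∑ l, Z l • (Pi.single l 1 : Fin (m+3) → S) := by
    ext j; simp [Finset.sum_apply, Pi.single_apply]
  have e1 : ∀ l, eI S (Function.update I k l) = Function.update (eI S I) k (Pi.single l 1) := by
    intro l
    ext a b
    unfold eI
    by_cases h : a = k
    · subst h; simp
    · simp [Function.update_of_ne h]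
  conv_lhs => rw [hZ]
  simp only [e1]
  unfold br
  simp only [← brM_up3]
  have hdet : ∀ Y : Fin (m + 3) → S, ((brM A B C (eI S I)).updateRow k.succ.succ.succ Y).det =
      (Matrix.detRowAlternating (n := Fin (m+3)) (R := S)).toMultilinearMap.toLinearMap
        (brM A B C (eI S I)) k.succ.succ.succ Y := fun Y => rfl
  simp only [hdet, map_sum, map_smul, smul_eq_mul]

theorem br_map {S' : Type*} [CommRing S'] (f : S →+* S') (A B C : Fin (m + 3) → S) (v) :
    f (br A B C v) = br (fun i => f (A i)) (fun i => f (B i)) (fun i => f (C i))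
      (fun k i => f (v k i)) := by
  unfold br
  rw [RingHom.map_det]
  congr 1
  ext i j
  refine Fin.cases ?_ (fun i => Fin.cases ?_ (fun i => Fin.cases ?_ (fun i => ?_) i) i) i <;> rfl

theorem br_map_eI {S' : Type*} [CommRing S'] (f : S →+* S') (A B C : Fin (m + 3) → S)
    (I : Fin m → Fin (m + 3)) :
    f (br A B C (eI S I)) = br (fun i => f (A i)) (fun i => f (B i)) (fun i => f (C i)) (eI S' I) := by
  rw [br_map]
  congr 1
  ext k i
  unfold eI
  by_cases h : i = I k
  · subst h; simp
  · simp [h]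

theorem br_span (T1 T2 T3 A B C : Fin (m + 3) → S) (v)
    (c : Fin 3 → Fin 3 → S)
    (hA : A = c 0 0 • T1 + c 0 1 • T2 + c 0 2 • T3)
    (hB : B = c 1 0 • T1 + c 1 1 • T2 + c 1 2 • T3)
    (hC : C = c 2 0 • T1 + c 2 1 • T2 + c 2 2 • T3) :
    br A B C v = (Matrix.of c).det * br T1 T2 T3 v := by
  subst hA hB hC
  simp only [br_add0, br_add1, br_add2, br_smul0, br_smul1, br_smul2, br_01, br_02, br_12]
  have h3 : br T3 T1 T2 v = br T1 T2 T3 v := by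
    rw [br_sw01 T1 T3 T2, br_sw12 T1 T2 T3]; ring
  have h2 : br T2 T3 T1 v = br T1 T2 T3 v := by
    rw [br_sw12 T2 T1 T3, br_sw01 T1 T2 T3]; ring
  simp only [h2, h3, br_sw12 T1 T2 T3, br_sw01 T1 T2 T3, br_sw02 T1 T2 T3, Matrix.det_fin_three, Matrix.of_apply]
  ring

end br

open Topology Filter Set

theorem bo1 (K : ℕ) : ∀ Q : Polynomial ℂ,
    (fun t : ℂ => Q.eval t) =O[𝓝[≠] 0] (fun t : ℂ => t ^ K) → ∀ j < K, Q.coeff j = 0 := by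
  induction K with
  | zero => intro Q _ j hj; omega
  | succ K ih =>
    intro Q hQ
    have h0 : Q.coeff 0 = 0 := by
      rw [Polynomial.coeff_zero_eq_eval_zero]
      have h1 : Tendsto (fun t : ℂ => Q.eval t) (𝓝[≠] 0) (𝓝 (Q.eval 0)) :=
        (Q.continuous.tendsto 0).mono_left nhdsWithin_le_nhds
      have h2 : Tendsto (fun t : ℂ => Q.eval t) (𝓝[≠] 0) (𝓝 0) := by
        apply hQ.trans_tendsto
        have : Tendsto (fun t : ℂ => t ^ (K+1)) (𝓝 0) (𝓝 (0 ^ (K+1))) := 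
          (continuous_pow (K+1)).tendsto 0
        simpa using this.mono_left nhdsWithin_le_nhds
      exact tendsto_nhds_unique h1 h2
    have hd : Q = Polynomial.X * Q.divX := by
      have := Polynomial.X_mul_divX_add Q
      rw [h0] at this; simpa using this.symm
    have h3 : (fun t : ℂ => Q.divX.eval t) =O[𝓝[≠] 0] (fun t : ℂ => t ^ K) := by
      have h4 : (fun t : ℂ => t⁻¹ * Q.eval t) =O[𝓝[≠] 0] (fun t : ℂ => t⁻¹ * t ^ (K+1)) :=
        (Asymptotics.isBigO_refl _ _).mul hQ
      refine (h4.congr' ?_ ?_)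
      · filter_upwards [self_mem_nhdsWithin] with t ht
        conv_lhs => rw [hd]
        simp only [Polynomial.eval_mul, Polynomial.eval_X]
        have : t ≠ 0 := ht
        field_simp
      · filter_upwards [self_mem_nhdsWithin] with t ht
        have : t ≠ 0 := ht
        field_simp
        ring
    intro j hj
    cases j with
    | zero => exact h0
    | succ j =>
      have := ih _ h3 j (by omega)
      rwa [Polynomial.coeff_divX] at this

section
variable {ι : Type*} [Fintype ι]

theorem eval_smul_hom (P : MvPolynomial ι ℂ) (j : ℕ) (hP : P.IsHomogeneous j) (t : ℂ) (z : ι → ℂ) :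
    MvPolynomial.eval (t • z) P = t ^ j * MvPolynomial.eval z P := by
  rw [MvPolynomial.eval_eq', MvPolynomial.eval_eq', Finset.mul_sum]
  apply Finset.sum_congr rfl
  intro d hd
  have h := hP (MvPolynomial.mem_support_iff.mp hd)
  have : ∏ i, (t • z) i ^ d i = t ^ j * ∏ i, z i ^ d i := by
    simp only [Pi.smul_apply, smul_eq_mul, mul_pow, Finset.prod_mul_distrib]
    rw [Finset.prod_pow_eq_pow_sum]
    congr 2
    rw [← h]
    rw [Finsupp.weight_apply, Finsupp.sum_fintype]
    · simp
    · simp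
  rw [this]; ring

noncomputable def radPoly (P : MvPolynomial ι ℂ) (z : ι → ℂ) : Polynomial ℂ :=
  ∑ j ∈ Finset.range (P.totalDegree + 1),
    Polynomial.C (MvPolynomial.eval z (MvPolynomial.homogeneousComponent j P)) * Polynomial.X ^ j

theorem radPoly_eval (P : MvPolynomial ι ℂ) (z : ι → ℂ) (t : ℂ) :
    (radPoly P z).eval t = MvPolynomial.eval (t • z) P := by
  unfold radPoly
  conv_rhs => rw [← MvPolynomial.sum_homogeneousComponent P]
  rw [map_sum, Polynomial.eval_finset_sum]
  apply Finset.sum_congr rfl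
  intro j _
  rw [eval_smul_hom _ j (MvPolynomial.homogeneousComponent_isHomogeneous j P)]
  rw [Polynomial.eval_mul, Polynomial.eval_C, Polynomial.eval_pow, Polynomial.eval_X, mul_comm]

theorem radPoly_coeff (P : MvPolynomial ι ℂ) (z : ι → ℂ) (j : ℕ) :
    (radPoly P z).coeff j = MvPolynomial.eval z (MvPolynomial.homogeneousComponent j P) := by
  unfold radPoly
  rw [Polynomial.finset_sum_coeff, Finset.sum_congr rfl (fun k _ => Polynomial.coeff_C_mul_X_pow _ k j)]
  rw [Finset.sum_ite_eq]
  by_cases h : j ∈ Finset.range (P.totalDegree + 1)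
  · rw [if_pos h]
  · rw [if_neg h, MvPolynomial.homogeneousComponent_eq_zero]
    · simp
    · simpa using h

theorem tendsto_smul_line (z : ι → ℂ) : Tendsto (fun t : ℂ => t • z) (𝓝[≠] 0) (𝓝 0) := by
  have : Continuous (fun t : ℂ => t • z) := by fun_prop
  have h := this.tendsto 0
  simp only [zero_smul] at h
  exact h.mono_left nhdsWithin_le_nhds

theorem bigO_line (z : ι → ℂ) (f : (ι → ℂ) → ℂ) (K : ℕ)
    (h : f =O[𝓝 0] (fun y => ‖y‖ ^ K)) :
    (fun t : ℂ => f (t • z)) =O[𝓝[≠] 0] (fun t : ℂ => t ^ K) := by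
  have h1 := h.comp_tendsto (tendsto_smul_line z)
  refine h1.trans ?_
  apply Asymptotics.IsBigO.of_bound (‖z‖ ^ K)
  refine Eventually.of_forall (fun t => ?_)
  simp only [Function.comp, norm_smul, norm_pow, norm_mul, norm_norm, mul_pow]
  rw [mul_comm]

theorem bo_hom (P : MvPolynomial ι ℂ) (K : ℕ)
    (h : (fun y => MvPolynomial.eval y P) =O[𝓝 0] (fun y : ι → ℂ => ‖y‖ ^ K)) (j : ℕ) (hj : j < K) :
    MvPolynomial.homogeneousComponent j P = 0 := by
  apply MvPolynomial.funext
  intro z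
  rw [← radPoly_coeff, map_zero]
  refine bo1 K _ ?_ j hj
  have := bigO_line z _ K h
  refine this.congr_left (fun t => ?_)
  rw [radPoly_eval]

theorem mult_poly (n : ℕ) (L : ContinuousMultilinearMap ℂ (fun _ : Fin n => ι → ℂ) ℂ) :
    ∃ P : MvPolynomial ι ℂ, P.IsHomogeneous n ∧ ∀ z, L (fun _ => z) = MvPolynomial.eval z P := by
  classical
  refine ⟨∑ r : Fin n → ι, MvPolynomial.C (L fun k => Pi.single (r k) 1) *
    ∏ k, MvPolynomial.X (r k), ?_, ?_⟩
  · apply MvPolynomial.IsHomogeneous.sum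
    intro r _
    have h1 := MvPolynomial.isHomogeneous_C ι (L fun k => Pi.single (r k) 1)
    have h2 := MvPolynomial.IsHomogeneous.prod Finset.univ (fun k : Fin n => (MvPolynomial.X (r k) : MvPolynomial ι ℂ)) (fun _ => 1)
      (fun k _ => MvPolynomial.isHomogeneous_X ℂ (r k))
    simpa using h1.mul h2
  · intro z
    have hz : (fun _ : Fin n => z) = fun _ => ∑ i, z i • (Pi.single i 1 : ι → ℂ) := by
      ext k j; simp [Finset.sum_apply, Pi.single_apply]
    rw [hz, ContinuousMultilinearMap.map_sum, map_sum]
    apply Finset.sum_congr rfl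
    intro r _
    rw [ContinuousMultilinearMap.map_smul_univ]
    simp [mul_comm]

theorem eval_shift (q z : ι → ℂ) (P : MvPolynomial ι ℂ) :
    MvPolynomial.eval z (MvPolynomial.aeval (fun i => MvPolynomial.X i - MvPolynomial.C (q i)) P)
      = MvPolynomial.eval (z - q) P := by
  induction P using MvPolynomial.induction_on with
  | C a => simp
  | add p q hp hq => rw [map_add, map_add, map_add, hp, hq]
  | mul_X p i hp => rw [map_mul, map_mul, map_mul, hp]; simp

theorem taylor (f : (ι → ℂ) → ℂ) (q : ι → ℂ) (hf : AnalyticAt ℂ f q) (K : ℕ) :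
    ∃ P : MvPolynomial ι ℂ,
      (fun z => f z - MvPolynomial.eval z P) =O[𝓝 q] (fun z => ‖z - q‖ ^ K) := by
  obtain ⟨p, hp⟩ := hf
  have h := hp.isBigO_sub_partialSum_pow K
  choose Q hQ1 hQ2 using fun n => mult_poly n (p n)
  refine ⟨MvPolynomial.aeval (fun i => MvPolynomial.X i - MvPolynomial.C (q i))
    (∑ n ∈ Finset.range K, Q n), ?_⟩
  have ht : Tendsto (fun z : ι → ℂ => z - q) (𝓝 q) (𝓝 0) := by
    have : Continuous (fun z : ι → ℂ => z - q) := by fun_prop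
    simpa using this.tendsto q
  have h2 := h.comp_tendsto ht
  refine h2.congr_left (fun z => ?_)
  simp only [Function.comp, add_sub_cancel]
  rw [eval_shift, FormalMultilinearSeries.partialSum, map_sum]
  congr 1
  exact Finset.sum_congr rfl (fun n _ => hQ2 n _)

theorem poly_of_homog (f : (ι → ℂ) → ℂ) (hf : AnalyticAt ℂ f 0) (k : ℕ)
    (hh : ∀ (t : ℂ) z, f (t • z) = t ^ k * f z) :
    ∃ P : MvPolynomial ι ℂ, P.IsHomogeneous k ∧ ∀ z, f z = MvPolynomial.eval z P := by
  obtain ⟨P, hP⟩ := taylor f 0 hf (k+1)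
  simp only [sub_zero] at hP
  refine ⟨_, MvPolynomial.homogeneousComponent_isHomogeneous k P, fun z => ?_⟩
  have h1 := bigO_line z _ _ hP
  have h2 := bo1 (k+1) (Polynomial.C (f z) * Polynomial.X ^ k - radPoly P z) (by
    refine h1.congr_left (fun t => ?_)
    simp only [Polynomial.eval_sub, Polynomial.eval_mul, Polynomial.eval_C, Polynomial.eval_pow,
      Polynomial.eval_X, radPoly_eval, hh]
    ring) k (by omega)
  rw [Polynomial.coeff_sub, Polynomial.coeff_C_mul_X_pow, if_pos rfl, radPoly_coeff] at h2
  exact sub_eq_zero.mp h2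

noncomputable def mq (q : ι → ℂ) : Ideal (MvPolynomial ι ℂ) :=
  Ideal.span (Set.range fun i => MvPolynomial.X i - MvPolynomial.C (q i))

theorem mem_mq_pow_of_bigO (q : ι → ℂ) (P : MvPolynomial ι ℂ) (K : ℕ)
    (h : (fun z => MvPolynomial.eval z P) =O[𝓝 q] (fun z => ‖z - q‖ ^ K)) : P ∈ mq q ^ K := by
  set P' := MvPolynomial.aeval (fun i => MvPolynomial.X i + MvPolynomial.C (q i)) P with hP'
  have e1 : P = MvPolynomial.aeval (fun i => MvPolynomial.X i - MvPolynomial.C (q i)) P' := by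
    rw [hP']
    clear h hP' P'
    induction P using MvPolynomial.induction_on with
    | C a => simp
    | add p q hp hq => rw [map_add, map_add, ← hp, ← hq]
    | mul_X p i hp => 
      rw [map_mul, map_mul, ← hp]; simp
  have e2 : ∀ y, MvPolynomial.eval y P' = MvPolynomial.eval (y + q) P := by
    intro y
    rw [e1, eval_shift, add_sub_cancel_right]
  have h3 : (fun y => MvPolynomial.eval y P') =O[𝓝 0] (fun y : ι → ℂ => ‖y‖ ^ K) := by
    have ht : Tendsto (fun z : ι → ℂ => z + q) (𝓝 0) (𝓝 q) := by
      have : Continuous (fun z : ι → ℂ => z + q) := by fun_prop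
      simpa using this.tendsto 0
    have := h.comp_tendsto ht
    refine (this.congr (fun y => (e2 y).symm) (fun y => ?_))
    simp
  have h4 : P' ∈ MvPolynomial.idealOfVars ι ℂ ^ K := by
    rw [← MvPolynomial.sum_homogeneousComponent P']
    refine Ideal.sum_mem _ (fun j _ => ?_)
    by_cases hj : j < K
    · rw [bo_hom P' K h3 j hj]; exact zero_mem _
    · rw [MvPolynomial.mem_pow_idealOfVars_iff]
      intro d hd
      have := MvPolynomial.homogeneousComponent_isHomogeneous j P' (MvPolynomial.mem_support_iff.mp hd)
      rw [Finsupp.degree_eq_weight_one]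
      simp only [Pi.one_def] at this ⊢
      omega
  rw [e1]
  have h5 := Ideal.mem_map_of_mem (MvPolynomial.aeval (R := ℂ) (fun i => MvPolynomial.X i - MvPolynomial.C (q i)) : MvPolynomial ι ℂ →ₐ[ℂ] MvPolynomial ι ℂ) h4
  rw [Ideal.map_pow] at h5
  refine Ideal.pow_right_mono ?_ K h5
  rw [MvPolynomial.idealOfVars, Ideal.map_span]
  apply Ideal.span_le.mpr
  rintro _ ⟨_, ⟨i, rfl⟩, rfl⟩
  simp only [MvPolynomial.aeval_X, AlgHom.coe_toRingHom, RingHom.coe_coe]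
  exact Ideal.subset_span ⟨i, rfl⟩

theorem bigO_of_mem_mq_pow (q : ι → ℂ) (K : ℕ) : ∀ (P : MvPolynomial ι ℂ), P ∈ mq q ^ K →
    (fun z => MvPolynomial.eval z P) =O[𝓝 q] (fun z => ‖z - q‖ ^ K) := by
  have hb : ∀ P : MvPolynomial ι ℂ, (fun z => MvPolynomial.eval z P) =O[𝓝 q] (fun z => (1:ℝ)) := by
    intro P
    exact ((MvPolynomial.continuous_eval P).tendsto q).isBigO_one ℝ
  let J : ℕ → Ideal (MvPolynomial ι ℂ) := fun K =>
    { carrier := {P | (fun z => MvPolynomial.eval z P) =O[𝓝 q] (fun z => ‖z - q‖ ^ K)}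
      zero_mem' := by simp [Asymptotics.isBigO_zero]
      add_mem' := by
        intro a b ha hb
        simpa using Asymptotics.IsBigO.add ha hb
      smul_mem' := by
        intro c P hP
        have := (hb c).mul hP
        simpa using this }
  have : ∀ K, mq q ^ K ≤ J K := by
    intro K
    induction K with
    | zero => 
      intro P _
      show _ =O[𝓝 q] _
      simpa using hb P
    | succ K ih =>
      rw [pow_succ]
      apply Ideal.mul_le.mpr
      intro r hr s hs
      have h1 : mq q ≤ J 1 := by
        apply Ideal.span_le.mpr
        rintro _ ⟨i, rfl⟩
        show _ =O[𝓝 q] _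
        apply Asymptotics.IsBigO.of_bound 1
        refine Eventually.of_forall (fun z => ?_)
        simp only [map_sub, MvPolynomial.eval_X, MvPolynomial.eval_C, pow_one, norm_norm, one_mul]
        exact norm_le_pi_norm (z - q) i
      have h2 : _ =O[𝓝 q] _ := ih hr
      have h3 : _ =O[𝓝 q] _ := h1 hs
      have := h2.mul h3
      show _ =O[𝓝 q] _
      simpa [pow_succ] using this
  exact fun P hP => this K hP

theorem not_bigO_all (q : ι → ℂ) (P : MvPolynomial ι ℂ) (hP : P ≠ 0) :
    ∃ K0, ∀ K ≥ K0, ¬ (fun z => MvPolynomial.eval z P) =O[𝓝 q] (fun z => ‖z - q‖ ^ K) := by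
  set P' := MvPolynomial.aeval (fun i => MvPolynomial.X i + MvPolynomial.C (q i)) P with hP'
  have e2 : ∀ y, MvPolynomial.eval y P' = MvPolynomial.eval (y + q) P := by
    intro y
    have := eval_shift (-q) y P
    simp only [Pi.neg_apply, map_neg, sub_neg_eq_add] at this
    exact this
  refine ⟨P'.totalDegree + 1, fun K hK h => hP ?_⟩
  have h3 : (fun y => MvPolynomial.eval y P') =O[𝓝 0] (fun y : ι → ℂ => ‖y‖ ^ K) := by
    have ht : Tendsto (fun z : ι → ℂ => z + q) (𝓝 0) (𝓝 q) := by
      have : Continuous (fun z : ι → ℂ => z + q) := by fun_prop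
      simpa using this.tendsto 0
    have := h.comp_tendsto ht
    refine (this.congr (fun y => (e2 y).symm) (fun y => ?_))
    simp
  have h5 : P' = 0 := by
    rw [← MvPolynomial.sum_homogeneousComponent P']
    refine Finset.sum_eq_zero (fun j hj => bo_hom P' K h3 j ?_)
    have := Finset.mem_range.mp hj
    omega
  apply MvPolynomial.funext
  intro z
  have := e2 (z - q)
  rw [h5] at this
  simpa using this.symm
end

open Topology Filter Set

section core
variable {m : ℕ}

local notation "SP" => MvPolynomial (Fin (m + 3)) ℂ

def TanP (w : (Fin m → Fin (m + 3)) → MvPolynomial (Fin (m + 3)) ℂ) (Z : Fin (m + 3) → MvPolynomial (Fin (m + 3)) ℂ) : Prop :=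
  ∀ (I : Fin m → Fin (m + 3)) (i : Fin m), ∑ k, Z k * w (Function.update I i k) = 0

structure WD (w : (Fin m → Fin (m + 3)) → MvPolynomial (Fin (m + 3)) ℂ) : Prop where
  irr : ∀ p, Irreducible p → ∃ I, ¬ p ∣ w I
  ne : ∃ I, w I ≠ 0
  lf : ∀ q : Fin (m + 3) → ℂ, q ≠ 0 → ∃ X0 Y0 : (Fin (m + 3) → ℂ) → (Fin (m + 3) → ℂ),
    (∀ i, AnalyticAt ℂ (fun z => X0 z i) q) ∧ (∀ i, AnalyticAt ℂ (fun z => Y0 z i) q) ∧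
    ∀ᶠ z in 𝓝 q, ∀ I, MvPolynomial.eval z (w I) = br (X0 z) (Y0 z) z (eI ℂ I)

theorem poly_zero_of (P : SP) (h : ∀ q : Fin (m+3) → ℂ, q ≠ 0 → MvPolynomial.eval q P = 0) : P = 0 := by
  have : P * MvPolynomial.X 0 = 0 := by
    apply MvPolynomial.funext
    intro q
    by_cases hq : q = 0
    · simp [hq]
    · simp [h q hq]
  rcases mul_eq_zero.mp this with h | h
  · exact h
  · exact absurd h (MvPolynomial.X_ne_zero _)

variable {S : Type*} [CommRing S]

theorem br_tan0 (A B C : Fin (m + 3) → S) (v) (k) : br A B C (Function.update v k A) = 0 := by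
  unfold br
  refine Matrix.det_zero_of_row_eq (i := 0) (j := k.succ.succ.succ) (Fin.succ_ne_zero _).symm ?_
  rw [brM_3, brM_0, Function.update_self]
theorem br_tan1 (A B C : Fin (m + 3) → S) (v) (k) : br A B C (Function.update v k B) = 0 := by
  have := br_tan0 B A C v k
  rw [br_sw01] at this
  simpa using this
theorem br_tan2 (A B C : Fin (m + 3) → S) (v) (k) : br A B C (Function.update v k C) = 0 := by
  have := br_tan0 C B A v k
  rw [br_sw02] at this
  simpa using this

theorem br_row0 (A B C : Fin (m + 3) → S) (v) :
    br A B C v = ∑ j, A j * br (Pi.single j 1) B C v := by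
  have hA : A = ∑ l, A l • (Pi.single l 1 : Fin (m+3) → S) := by
    ext j; simp [Finset.sum_apply, Pi.single_apply]
  have h0 : br (0 : Fin (m+3) → S) B C v = 0 := by
    have := br_smul0 (0:S) 0 B C v
    simpa using this
  let L : (Fin (m+3) → S) →+ S :=
    { toFun := fun A => br A B C v
      map_zero' := h0
      map_add' := fun A A' => br_add0 A A' B C v }
  have : br A B C v = L A := rfl
  rw [this]
  conv_lhs => rw [hA]
  rw [map_sum]
  apply Finset.sum_congr rfl
  intro j _
  exact br_smul0 _ _ _ _ _

theorem br_neg_helper (A B C : Fin (m + 3) → S) (v) : br A (-B) C v = - br A B C v := by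
  have := br_smul1 (-1 : S) A B C v
  simpa using this

theorem mem_tan_span {K : Type*} [Field K] (T1 T2 T3 Z : Fin (m + 3) → K) (I : Fin m → Fin (m+3))
    (hI : br T1 T2 T3 (eI K I) ≠ 0)
    (hZ : ∀ i, ∑ k, Z k * br T1 T2 T3 (eI K (Function.update I i k)) = 0) :
    ∃ c : Fin 3 → K, Z = c 0 • T1 + c 1 • T2 + c 2 • T3 := by
  have h := br_cramer T1 T2 T3 Z (eI K I)
  simp only [br_update_expand, hZ, zero_smul, Finset.sum_const_zero, add_zero] at h
  refine ⟨![(br T1 T2 T3 (eI K I))⁻¹ * br Z T2 T3 (eI K I), (br T1 T2 T3 (eI K I))⁻¹ * br T1 Z T3 (eI K I),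
    (br T1 T2 T3 (eI K I))⁻¹ * br T1 T2 Z (eI K I)], ?_⟩
  have h2 := congrArg (fun x => (br T1 T2 T3 (eI K I))⁻¹ • x) h
  simp only [smul_smul, inv_mul_cancel₀ hI, one_smul, smul_add] at h2
  simpa using h2

variable {w : (Fin m → Fin (m + 3)) → MvPolynomial (Fin (m + 3)) ℂ}

theorem TanP.ev {Z} (h : TanP w Z) (q : Fin (m+3) → ℂ) (I i) :
    ∑ k, MvPolynomial.eval q (Z k) * MvPolynomial.eval q (w (Function.update I i k)) = 0 := by
  have := congrArg (MvPolynomial.eval q) (h I i)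
  simpa using this

theorem tanR (hw : WD w) : TanP w MvPolynomial.X := by
  intro I i
  apply poly_zero_of
  intro q hq
  obtain ⟨X0, Y0, _, _, h⟩ := hw.lf q hq
  have h := h.self_of_nhds
  simp only [map_sum, map_mul, MvPolynomial.eval_X, h]
  rw [← br_update_expand, br_tan2]

theorem ev_span (hw : WD w) (q : Fin (m+3) → ℂ) (hq : q ≠ 0) :
    ∃ T1 T2 : Fin (m+3) → ℂ, ∀ I, MvPolynomial.eval q (w I) = br T1 T2 q (eI ℂ I) := by
  obtain ⟨X0, Y0, _, _, h⟩ := hw.lf q hq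
  exact ⟨_, _, h.self_of_nhds⟩

theorem C1 (hw : WD w) (Z1 Z2 Z3 : Fin (m + 3) → SP) (h1 : TanP w Z1) (h2 : TanP w Z2) (h3 : TanP w Z3) :
    ∃ f, ∀ I, br Z1 Z2 Z3 (eI _ I) = f * w I := by
  obtain ⟨I0, hI0⟩ := hw.ne
  apply ufd_prop w (fun I => br Z1 Z2 Z3 (eI _ I)) _ hw.irr I0 hI0
  intro I J
  rw [← sub_eq_zero]
  apply poly_zero_of
  intro q hq
  rw [map_sub, map_mul, map_mul, br_map_eI, br_map_eI, sub_eq_zero]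
  obtain ⟨T1, T2, hT⟩ := ev_span hw q hq
  by_cases hz : ∃ K, br T1 T2 q (eI ℂ K) ≠ 0
  · obtain ⟨K, hK⟩ := hz
    have key : ∀ Z, TanP w Z → ∃ c : Fin 3 → ℂ, (fun i => MvPolynomial.eval q (Z i)) = c 0 • T1 + c 1 • T2 + c 2 • q := by
      intro Z hZ
      apply mem_tan_span T1 T2 q _ K hK
      intro i
      simp only [← hT]
      exact hZ.ev q K i
    obtain ⟨c1, hc1⟩ := key Z1 h1
    obtain ⟨c2, hc2⟩ := key Z2 h2
    obtain ⟨c3, hc3⟩ := key Z3 h3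
    rw [br_span T1 T2 q _ _ _ _ ![c1, c2, c3] hc1 hc2 hc3, br_span T1 T2 q _ _ _ _ ![c1, c2, c3] hc1 hc2 hc3, hT, hT]
    ring
  · push Not at hz
    rw [hT, hT, hz, hz]; ring

/-- Artin–Rees approximation. -/
theorem approx (q : Fin (m+3) → ℂ) (X0 : (Fin (m+3) → ℂ) → (Fin (m+3) → ℂ))
    (hX : ∀ i, AnalyticAt ℂ (fun z => X0 z i) q)
    (ht : ∀ᶠ z in 𝓝 q, ∀ I i, ∑ k, X0 z k * MvPolynomial.eval z (w (Function.update I i k)) = 0) (K : ℕ) :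
    ∃ X : Fin (m+3) → SP, TanP w X ∧
      ∀ i, (fun z => X0 z i - MvPolynomial.eval z (X i)) =O[𝓝 q] (fun z => ‖z - q‖ ^ K) := by
  let J := (Fin m → Fin (m + 3)) × Fin m
  let L : (Fin (m+3) → SP) →ₗ[SP] (J → SP) :=
    LinearMap.pi (fun j => ∑ k, (LinearMap.proj k : (Fin (m+3) → SP) →ₗ[SP] SP).smulRight (w (Function.update j.1 j.2 k)))
  have hL : ∀ Z j, L Z j = ∑ k, Z k * w (Function.update j.1 j.2 k) := by
    intro Z j; simp [L]
  obtain ⟨k0, hk0⟩ := Ideal.exists_pow_inf_eq_pow_smul (mq q) (LinearMap.range L)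
  choose P hP using fun i => taylor (fun z => X0 z i) q (hX i) (K + k0)
  have hLP : ∀ j, L P j ∈ mq q ^ (K + k0) := by
    intro j
    apply mem_mq_pow_of_bigO
    have : (fun z => - ∑ k, (X0 z k - MvPolynomial.eval z (P k)) * MvPolynomial.eval z (w (Function.update j.1 j.2 k)))
        =O[𝓝 q] (fun z => ‖z - q‖ ^ (K + k0)) := by
      apply Asymptotics.IsBigO.neg_left
      apply Asymptotics.IsBigO.fun_sum
      intro k _
      have hb : (fun z => MvPolynomial.eval z (w (Function.update j.1 j.2 k))) =O[𝓝 q] (fun z => (1:ℝ)) :=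
        ((MvPolynomial.continuous_eval _).tendsto q).isBigO_one ℝ
      have := (hP k).mul hb
      simpa using this
    refine this.congr' ?_ EventuallyEq.rfl
    filter_upwards [ht] with z hz
    have h1 := hz j.1 j.2
    rw [hL, map_sum]
    simp only [sub_mul, Finset.sum_sub_distrib, map_mul]
    rw [h1]; ring
  have hmem : L P ∈ mq q ^ (K + k0) • (⊤ : Submodule SP (J → SP)) ⊓ LinearMap.range L := by
    refine ⟨?_, ⟨P, rfl⟩⟩
    have : L P = ∑ j, L P j • (Pi.single j 1 : J → SP) := by
      ext1 j; simp [Finset.sum_apply, Pi.single_apply]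
    rw [this]
    exact Submodule.sum_mem _ (fun j _ => Submodule.smul_mem_smul (hLP j) trivial)
  rw [hk0 (K + k0) (by omega), Nat.add_sub_cancel] at hmem
  have h2 : L P ∈ mq q ^ K • Submodule.map L ⊤ := by
    rw [Submodule.map_top]
    exact Submodule.smul_mono le_rfl inf_le_right hmem
  rw [← Submodule.map_smul''] at h2
  obtain ⟨Q, hQ, hQL⟩ := h2
  have hQi : ∀ i, Q i ∈ mq q ^ K := by
    intro i
    have := Submodule.mem_map_of_mem (f := (LinearMap.proj i : (Fin (m+3) → SP) →ₗ[SP] SP)) hQ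
    rw [Submodule.map_smul''] at this
    have h3 := Submodule.smul_mono (le_refl (mq q ^ K)) (le_top : Submodule.map (LinearMap.proj i : (Fin (m+3) → SP) →ₗ[SP] SP) ⊤ ≤ ⊤) this
    simpa using h3
  refine ⟨P - Q, ?_, ?_⟩
  · intro I i
    have : L (P - Q) (I, i) = 0 := by rw [map_sub, hQL, sub_self]; rfl
    rw [hL] at this
    exact this
  · intro i
    have h3 := bigO_of_mem_mq_pow q K _ (hQi i)
    have h4 : (fun z => X0 z i - MvPolynomial.eval z (P i)) =O[𝓝 q] (fun z => ‖z - q‖ ^ K) := by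
      refine (hP i).trans ?_
      apply Asymptotics.IsBigO.of_bound 1
      have : Tendsto (fun z => ‖z - q‖) (𝓝 q) (𝓝 0) := by
        have : Continuous (fun z => ‖z - q‖) := by fun_prop
        simpa using this.tendsto q
      filter_upwards [this.eventually (gt_mem_nhds one_pos)] with z hz
      rw [norm_pow, norm_pow, norm_norm, one_mul]
      exact pow_le_pow_of_le_one (norm_nonneg _) hz.le (by omega)
    refine (h4.add h3).congr_left (fun z => ?_)
    simp; ring

theorem br_bigO (q : Fin (m+3) → ℂ) (A B : (Fin (m+3) → ℂ) → (Fin (m+3) → ℂ)) (K : ℕ) (I)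
    (hA : ∀ i, (fun z => A z i) =O[𝓝 q] (fun z => ‖z - q‖ ^ K))
    (hB : ∀ i, ContinuousAt (fun z => B z i) q) :
    (fun z => br (A z) (B z) z (eI ℂ I)) =O[𝓝 q] (fun z => ‖z - q‖ ^ K) := by
  simp only [br_row0 (A _)]
  apply Asymptotics.IsBigO.fun_sum
  intro j _
  have hb : (fun z => br (Pi.single j 1) (B z) z (eI ℂ I)) =O[𝓝 q] (fun z => (1:ℝ)) := by
    apply Tendsto.isBigO_one ℝ (c := br (Pi.single j 1) (B q) q (eI ℂ I))
    have : ContinuousAt (fun z => br (Pi.single j 1) (B z) z (eI ℂ I)) q := by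
      unfold br
      refine (continuous_id.matrix_det.continuousAt).comp (f := fun z => brM (Pi.single j 1) (B z) z (eI ℂ I)) ?_
      refine continuousAt_pi.mpr (fun r => continuousAt_pi.mpr (fun s => ?_))
      refine Fin.cases ?_ (fun r => Fin.cases ?_ (fun r => Fin.cases ?_ (fun r => ?_) r) r) r
      · exact continuousAt_const
      · exact hB s
      · exact (continuous_apply s).continuousAt
      · exact continuousAt_const
    exact this
  have := (hA j).mul hb
  simpa using this

theorem C5 (hw : WD w) (q : Fin (m+3) → ℂ) (hq : q ≠ 0) :
    ∃ (X Y : Fin (m+3) → SP) (f : SP), TanP w X ∧ TanP w Y ∧ MvPolynomial.eval q f ≠ 0 ∧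
      ∀ I, br X Y MvPolynomial.X (eI _ I) = f * w I := by
  obtain ⟨X0, Y0, hX, hY, h⟩ := hw.lf q hq
  obtain ⟨I0, hI0⟩ := hw.ne
  obtain ⟨K, hK⟩ := not_bigO_all q (w I0) hI0
  obtain ⟨X, hX1, hX2⟩ := approx (w := w) q X0 hX (by
    filter_upwards [h] with z hz I i
    simp only [hz]
    rw [← br_update_expand, br_tan0]) K
  obtain ⟨Y, hY1, hY2⟩ := approx (w := w) q Y0 hY (by
    filter_upwards [h] with z hz I i
    simp only [hz]
    rw [← br_update_expand, br_tan1]) K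
  obtain ⟨f, hf⟩ := C1 hw X Y MvPolynomial.X hX1 hY1 (tanR hw)
  refine ⟨X, Y, f, hX1, hY1, ?_, hf⟩
  intro hfq
  apply hK K le_rfl
  have e1 := br_bigO q (fun z => X0 z - fun i => MvPolynomial.eval z (X i)) (fun z => Y0 z) K I0
    (by simpa using hX2) (fun i => (hY i).continuousAt)
  have e2 := br_bigO q (fun z => Y0 z - fun i => MvPolynomial.eval z (Y i))
    (fun z i => MvPolynomial.eval z (X i)) K I0
    (by simpa using hY2) (fun i => (MvPolynomial.continuous_eval _).continuousAt)
  have e3 : (fun z => (1 - MvPolynomial.eval z f) * MvPolynomial.eval z (w I0)) =O[𝓝 q] (fun z => ‖z - q‖ ^ K) := by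
    refine (e1.sub e2).congr' ?_ EventuallyEq.rfl
    filter_upwards [h] with z hz
    have h1 := congrArg (MvPolynomial.eval z) (hf I0)
    rw [br_map_eI, map_mul] at h1
    simp only [MvPolynomial.eval_X] at h1
    rw [sub_mul, ← h1, one_mul, hz I0]
    set x := fun i => MvPolynomial.eval z (X i)
    set y := fun i => MvPolynomial.eval z (Y i)
    have a1 : br (X0 z - x) (Y0 z) z (eI ℂ I0) = br (X0 z) (Y0 z) z (eI ℂ I0) - br x (Y0 z) z (eI ℂ I0) := by
      have := br_add0 (X0 z - x) x (Y0 z) z (eI ℂ I0)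
      rw [sub_add_cancel] at this; rw [this]; ring
    rw [a1, br_sw01 x, br_sub1]
    ring
  have e4 : (fun z => (1 - MvPolynomial.eval z f)⁻¹) =O[𝓝 q] (fun z => (1:ℝ)) := by
    apply Tendsto.isBigO_one ℝ (c := (1 - MvPolynomial.eval q f)⁻¹)
    apply Tendsto.inv₀
    · exact ((continuous_const.sub (MvPolynomial.continuous_eval f))).tendsto q
    · simp [hfq]
  have e5 := e4.mul e3
  simp only [one_mul] at e5
  refine e5.congr' ?_ EventuallyEq.rfl
  have : ∀ᶠ z in 𝓝 q, (1 - MvPolynomial.eval z f) ≠ 0 := by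
    have hc : ContinuousAt (fun z => 1 - MvPolynomial.eval z f) q :=
      (continuous_const.sub (MvPolynomial.continuous_eval f)).continuousAt
    exact hc.eventually_ne (by simp [hfq])
  filter_upwards [this] with z hz
  rw [inv_mul_cancel_left₀ hz]

/-- Local data. -/
theorem loc_data (hw : WD w) (V : Fin (m+3) → SP) (hV : TanP w V) (q : Fin (m+3) → ℂ) (hq : q ≠ 0) :
    ∃ (X Y : Fin (m+3) → SP) (f a b c : SP), MvPolynomial.eval q f ≠ 0 ∧
      (∀ I, br X Y MvPolynomial.X (eI _ I) = f * w I) ∧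
      (∀ I, br V Y MvPolynomial.X (eI _ I) = a * w I) ∧
      (∀ I, br X V MvPolynomial.X (eI _ I) = b * w I) ∧
      f • V = a • X + b • Y + c • MvPolynomial.X := by
  obtain ⟨X, Y, f, hX, hY, hfq, hf⟩ := C5 hw q hq
  obtain ⟨a, ha⟩ := C1 hw V Y MvPolynomial.X hV hY (tanR hw)
  obtain ⟨b, hb⟩ := C1 hw X V MvPolynomial.X hX hV (tanR hw)
  obtain ⟨c, hc⟩ := C1 hw X Y V hX hY hV
  refine ⟨X, Y, f, a, b, c, hfq, hf, ha, hb, ?_⟩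
  obtain ⟨I0, hI0⟩ := hw.ne
  have h := br_cramer X Y MvPolynomial.X V (eI _ I0)
  have h0 : ∀ k, br X Y MvPolynomial.X (Function.update (eI _ I0) k V) = 0 := by
    intro k
    rw [br_update_expand]
    simp only [hf]
    have := hV I0 k
    calc _ = f * ∑ l, V l * w (Function.update I0 k l) := by
            rw [Finset.mul_sum]; exact Finset.sum_congr rfl (fun _ _ => by ring)
      _ = 0 := by rw [this, mul_zero]
  simp only [h0, zero_smul, Finset.sum_const_zero, add_zero, hf, ha, hb, hc] at h
  ext1 i
  have hi := congrFun h i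
  simp only [Pi.smul_apply, Pi.add_apply, smul_eq_mul] at hi ⊢
  apply mul_left_cancel₀ hI0
  linear_combination hi

end core

open Topology Filter Set

section core2
variable {m : ℕ}

local notation "SP" => MvPolynomial (Fin (m + 3)) ℂ

theorem exists_perm02 (i j : Fin (m + 3)) (hij : i ≠ j) :
    ∃ σ : Equiv.Perm (Fin (m+3)), σ 0 = i ∧ σ 2 = j := by
  have h02 : (0 : Fin (m+3)) ≠ 2 := by rw [fin_two_eq]; exact (Fin.succ_ne_zero _).symm
  have hk : Equiv.swap 0 i j ≠ 0 := by
    intro h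
    have : Equiv.swap 0 i (Equiv.swap 0 i j) = Equiv.swap 0 i 0 := by rw [h]
    rw [Equiv.swap_apply_self, Equiv.swap_apply_left] at this
    exact hij this.symm
  refine ⟨(Equiv.swap 2 (Equiv.swap 0 i j)).trans (Equiv.swap 0 i), ?_, ?_⟩
  · simp only [Equiv.trans_apply]
    rw [Equiv.swap_apply_of_ne_of_ne h02 hk.symm, Equiv.swap_apply_left]
  · simp only [Equiv.trans_apply, Equiv.swap_apply_left, Equiv.swap_apply_self]

section
variable {S : Type*} [CommRing S]

def eσ (S : Type*) [CommRing S] (σ : Equiv.Perm (Fin (m+3))) : Fin m → Fin (m+3) := fun k => σ k.succ.succ.succ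

theorem br_perm (σ : Equiv.Perm (Fin (m+3))) :
    IsUnit (br (Pi.single (σ 0) 1) (Pi.single (σ 1) 1) (Pi.single (σ 2) 1) (eI S (eσ S σ)) : S) := by
  have : brM (Pi.single (σ 0) 1) (Pi.single (σ 1) 1) (Pi.single (σ 2) 1) (eI S (eσ S σ)) =
      σ.toPEquiv.toMatrix := by
    ext r c
    rw [PEquiv.toMatrix_apply]
    refine Fin.cases ?_ (fun r => Fin.cases ?_ (fun r => Fin.cases ?_ (fun r => ?_) r) r) r
    · simp [brM_0, Pi.single_apply, eq_comm]
    · rw [← fin_one_eq, brM_1]; simp [Pi.single_apply, eq_comm]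
    · rw [← fin_two_eq, brM_2]; simp [Pi.single_apply, eq_comm]
    · rw [brM_3]; simp [eI, eσ, Pi.single_apply, eq_comm]
  unfold br
  rw [this, Matrix.det_permutation]
  exact (Units.isUnit _).map (Int.castRingHom S)

theorem eI_self_update (I : Fin m → Fin (m+3)) (k) : eI S I = Function.update (eI S I) k (Pi.single (I k) 1) := by
  rw [eq_comm]; exact Function.update_eq_self k (eI S I)

theorem br_minor (V R : Fin (m+3) → S) (σ : Equiv.Perm (Fin (m+3))) :
    br V (Pi.single (σ 1) 1) R (eI S (eσ S σ)) = (V (σ 0) * R (σ 2) - V (σ 2) * R (σ 0)) *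
      br (Pi.single (σ 0) 1) (Pi.single (σ 1) 1) (Pi.single (σ 2) 1) (eI S (eσ S σ)) := by
  have h02 : (0 : Fin (m+3)) ≠ 2 := by rw [fin_two_eq]; exact (Fin.succ_ne_zero _).symm
  have van : ∀ r : Fin (m+3), r ≠ 0 → r ≠ 2 → ∀ B : Fin (m+3) → S,
      br (Pi.single (σ r) 1) (Pi.single (σ 1) 1) B (eI S (eσ S σ)) = 0 := by
    intro r h0 h2 B
    revert h0 h2
    refine Fin.cases ?_ (fun r => Fin.cases ?_ (fun r => Fin.cases ?_ (fun r => ?_) r) r) r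
    · intro h; exact absurd rfl h
    · intro _ _; rw [← fin_one_eq]; exact br_01 _ _ _
    · intro _ h; rw [← fin_two_eq] at h; exact absurd rfl h
    · intro _ _
      rw [eI_self_update (eσ S σ) r]
      exact br_tan0 _ _ _ _ _
  have exp : ∀ (A B : Fin (m+3) → S), br A (Pi.single (σ 1) 1) B (eI S (eσ S σ)) =
      A (σ 0) * br (Pi.single (σ 0) 1) (Pi.single (σ 1) 1) B (eI S (eσ S σ)) +
      A (σ 2) * br (Pi.single (σ 2) 1) (Pi.single (σ 1) 1) B (eI S (eσ S σ)) := by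
    intro A B
    rw [br_row0 A, ← Equiv.sum_comp σ, ← Finset.sum_subset (Finset.subset_univ {0, 2})]
    · rw [Finset.sum_pair h02]
    · intro r _ hr
      simp only [Finset.mem_insert, Finset.mem_singleton, not_or] at hr
      rw [van r hr.1 hr.2, mul_zero]
  rw [exp V R, br_sw02 R, exp R, br_sw02 R, exp R, br_02, br_02,
    br_sw02 (Pi.single (σ 0) 1)]
  ring

theorem br_Z_span (V Z R : Fin (m+3) → S) (h : ∀ I, br V Z R (eI S I) = 0) (k0) (I : Fin m → Fin (m+3)) :
    ∃ s t : S, br V (Pi.single k0 1) R (eI S I) • Z = s • V + t • R := by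
  have h1 := br_cramer V (Pi.single k0 1) R Z (eI S I)
  have h2 : ∀ k, br V (Pi.single k0 1) R (Function.update (eI S I) k Z) = 0 := by
    intro k
    have hs : br V (Pi.single k0 1) R (Function.update (eI S I) k Z) =
      - br V Z R (Function.update (eI S I) k (Pi.single k0 1)) := by
      unfold br
      have : brM V Z R (Function.update (eI S I) k (Pi.single k0 1)) =
        (brM V (Pi.single k0 1) R (Function.update (eI S I) k Z)).submatrix (Equiv.swap 1 k.succ.succ.succ) id := by
        have hk1 : (1 : Fin (m+3)) ≠ k.succ.succ.succ := by
          rw [fin_one_eq, Ne, Fin.succ_inj]; exact (Fin.succ_ne_zero _).symm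
        ext r c
        rw [Matrix.submatrix_apply, id]
        by_cases hr1 : r = 1
        · subst hr1
          rw [Equiv.swap_apply_left, brM_3, brM_1, Function.update_self]
        by_cases hrk : r = k.succ.succ.succ
        · subst hrk
          rw [Equiv.swap_apply_right, brM_3, brM_1, Function.update_self]
        rw [Equiv.swap_apply_of_ne_of_ne hr1 hrk]
        revert hr1 hrk
        refine Fin.cases ?_ (fun r => Fin.cases ?_ (fun r => Fin.cases ?_ (fun r => ?_) r) r) r
        · intros; rfl
        · intro h; exact absurd rfl h
        · intros; rfl
        · intro _ hrk
          rw [brM_3, brM_3]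
          have : r ≠ k := fun h => hrk (by rw [h])
          rw [Function.update_of_ne this, Function.update_of_ne this]
      rw [this]
      have hp := Matrix.det_permute (Equiv.swap 1 k.succ.succ.succ) (brM V (Pi.single k0 1) R (Function.update (eI S I) k Z))
      rw [hp, Equiv.Perm.sign_swap (by
        rw [fin_one_eq, Ne, Fin.succ_inj]; exact (Fin.succ_ne_zero _).symm)]
      simp
    rw [hs, br_update_expand]
    simp [h]
  simp only [h2, zero_smul, Finset.sum_const_zero, add_zero, h] at h1
  exact ⟨_, _, h1⟩
end

structure VDat (V : Fin (m+3) → MvPolynomial (Fin (m + 3)) ℂ) : Prop where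
  irr : ∀ p, Irreducible p → ∃ i j, ¬ p ∣ V i * MvPolynomial.X j - V j * MvPolynomial.X i
  ne : ∃ i j, V i * MvPolynomial.X j - V j * MvPolynomial.X i ≠ 0

theorem C3 {V : Fin (m+3) → SP} (hV : VDat V) (Z : Fin (m+3) → SP)
    (h : ∀ I, br V Z MvPolynomial.X (eI _ I) = 0) :
    ∃ a b : SP, Z = a • V + b • MvPolynomial.X := by
  obtain ⟨i, j, hij⟩ := hV.ne
  have hne : i ≠ j := by rintro rfl; exact hij (sub_self _)
  obtain ⟨σ, h0, h2⟩ := exists_perm02 i j hne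
  obtain ⟨s, t, hst⟩ := br_Z_span V Z MvPolynomial.X h (σ 1) (eσ SP σ)
  set μ := br V (Pi.single (σ 1) 1) MvPolynomial.X (eI SP (eσ SP σ)) with hμ
  have hμ0 : μ ≠ 0 := by
    rw [hμ, br_minor]
    exact mul_ne_zero (by rw [h0, h2]; exact hij) (br_perm σ).ne_zero
  have hc : ∀ k, μ * Z k = s * V k + t * MvPolynomial.X k := by
    intro k
    have := congrFun hst k
    simpa using this
  obtain ⟨a, ha⟩ := ufd_prop (fun p : Fin (m+3) × Fin (m+3) => V p.1 * MvPolynomial.X p.2 - V p.2 * MvPolynomial.X p.1)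
    (fun p => Z p.1 * MvPolynomial.X p.2 - Z p.2 * MvPolynomial.X p.1) (by
      rintro ⟨i, j⟩ ⟨k, l⟩
      apply mul_left_cancel₀ hμ0
      simp only
      linear_combination (V i * MvPolynomial.X j - V j * MvPolynomial.X i) * (hc k * MvPolynomial.X l - hc l * MvPolynomial.X k)
        - (V k * MvPolynomial.X l - V l * MvPolynomial.X k) * (hc i * MvPolynomial.X j - hc j * MvPolynomial.X i)) (by
      intro p hp
      obtain ⟨i, j, h⟩ := hV.irr p hp
      exact ⟨(i, j), h⟩) (i, j) hij
  obtain ⟨b, hb⟩ := ufd_prop (fun k : Fin (m+3) => (MvPolynomial.X k : SP)) (fun k => Z k - a * V k) (by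
      intro i j
      have := ha (j, i)
      simp only at this
      linear_combination this) (by
      intro p hp
      by_contra hcon
      push Not at hcon
      obtain ⟨c, hc⟩ := hcon 0
      rcases (MvPolynomial.X_prime (R := ℂ) (i := (0 : Fin (m+3)))).irreducible.isUnit_or_isUnit hc with hu | hu
      · exact hp.not_isUnit hu
      · have : (MvPolynomial.X 0 : SP) ∣ MvPolynomial.X 1 := by
          refine dvd_trans ?_ (hcon 1)
          rw [hc]
          exact (hu.mul_right_dvd).mpr dvd_rfl
        rw [MvPolynomial.X_dvd_X] at this
        rw [fin_one_eq] at this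
        exact absurd this (by simpa using (Fin.succ_ne_zero _).symm)) 0 (MvPolynomial.X_ne_zero _)
  refine ⟨a, b, ?_⟩
  ext1 k
  have := hb k
  simp only [Pi.add_apply, Pi.smul_apply, smul_eq_mul]
  linear_combination this

theorem indepVR {V : Fin (m+3) → SP} (hV : VDat V) (a b : SP)
    (h : a • V + b • MvPolynomial.X = 0) : a = 0 ∧ b = 0 := by
  obtain ⟨i, j, hij⟩ := hV.ne
  have hk : ∀ k, a * V k + b * MvPolynomial.X k = 0 := fun k => by simpa using congrFun h k
  have ha : a = 0 := by
    have : a * (V i * MvPolynomial.X j - V j * MvPolynomial.X i) = 0 := by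
      linear_combination hk i * MvPolynomial.X j - hk j * MvPolynomial.X i
    exact (mul_eq_zero.mp this).resolve_right hij
  refine ⟨ha, ?_⟩
  have := hk 0
  rw [ha, zero_mul, zero_add] at this
  exact (mul_eq_zero.mp this).resolve_right (MvPolynomial.X_ne_zero _)

/-- The ideal of `g` with `g w ∈ i_V i_R (vector fields)`. -/
noncomputable def Idl (w : (Fin m → Fin (m + 3)) → MvPolynomial (Fin (m + 3)) ℂ) (V : Fin (m+3) → MvPolynomial (Fin (m + 3)) ℂ) :
    Ideal (MvPolynomial (Fin (m + 3)) ℂ) where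
  carrier := {g | ∃ Y, ∀ I, g * w I = br V Y MvPolynomial.X (eI _ I)}
  zero_mem' := ⟨0, fun I => by
    have := br_smul1 (0 : SP) V 0 MvPolynomial.X (eI _ I)
    simp at this
    simp [this]⟩
  add_mem' := by
    rintro a b ⟨Y, hY⟩ ⟨Y', hY'⟩
    exact ⟨Y + Y', fun I => by rw [br_add1, add_mul, hY, hY']⟩
  smul_mem' := by
    rintro a b ⟨Y, hY⟩
    exact ⟨a • Y, fun I => by rw [br_smul1, smul_eq_mul, mul_assoc, hY]⟩

theorem koszul_main {w : (Fin m → Fin (m + 3)) → SP} {V : Fin (m+3) → SP} (hV : VDat V)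
    (h : ∀ q : Fin (m+3) → ℂ, q ≠ 0 → ∃ g ∈ Idl w V, MvPolynomial.eval q g ≠ 0) :
    ∃ Y, ∀ I, w I = br V Y MvPolynomial.X (eI _ I) := by
  choose Mi hMi using null_pow (Idl w V) h
  obtain ⟨M, hM⟩ : ∃ M, ∀ i, MvPolynomial.X i ^ M ∈ Idl w V :=
    ⟨∑ i, Mi i, fun i => Ideal.pow_mem_of_pow_mem _ (hMi i)
      (Finset.single_le_sum (f := Mi) (fun _ _ => Nat.zero_le _) (Finset.mem_univ i))⟩
  obtain ⟨Y0, hY0⟩ := hM 0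
  obtain ⟨Y1, hY1⟩ := hM 1
  obtain ⟨Y2, hY2⟩ := hM 2
  have h01 : (0 : Fin (m+3)) ≠ 1 := by rw [fin_one_eq]; exact (Fin.succ_ne_zero _).symm
  have h02 : (0 : Fin (m+3)) ≠ 2 := by rw [fin_two_eq]; exact (Fin.succ_ne_zero _).symm
  have h12 : (1 : Fin (m+3)) ≠ 2 := by
    rw [fin_two_eq, fin_one_eq, Ne, Fin.succ_inj]; exact (Fin.succ_ne_zero _).symm
  set u0 : SP := MvPolynomial.X 0 ^ M with hu0
  set u1 : SP := MvPolynomial.X 1 ^ M with hu1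
  set u2 : SP := MvPolynomial.X 2 ^ M with hu2
  have hu0n : u0 ≠ 0 := pow_ne_zero _ (MvPolynomial.X_ne_zero _)
  obtain ⟨a01, b01, e01⟩ := C3 hV (u1 • Y0 - u0 • Y1) (fun I => by
    rw [br_sub1, br_smul1, br_smul1, ← hY0, ← hY1]; ring)
  obtain ⟨a02, b02, e02⟩ := C3 hV (u2 • Y0 - u0 • Y2) (fun I => by
    rw [br_sub1, br_smul1, br_smul1, ← hY0, ← hY2]; ring)
  obtain ⟨a12, b12, e12⟩ := C3 hV (u2 • Y1 - u1 • Y2) (fun I => by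
    rw [br_sub1, br_smul1, br_smul1, ← hY1, ← hY2]; ring)
  have k01 : ∀ k, u1 * Y0 k - u0 * Y1 k = a01 * V k + b01 * MvPolynomial.X k := fun k => by
    simpa using congrFun e01 k
  have k02 : ∀ k, u2 * Y0 k - u0 * Y2 k = a02 * V k + b02 * MvPolynomial.X k := fun k => by
    simpa using congrFun e02 k
  have k12 : ∀ k, u2 * Y1 k - u1 * Y2 k = a12 * V k + b12 * MvPolynomial.X k := fun k => by
    simpa using congrFun e12 k
  obtain ⟨ra, rb⟩ := indepVR hV (u2 * a01 - u1 * a02 + u0 * a12) (u2 * b01 - u1 * b02 + u0 * b12) (by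
    ext1 k
    simp only [Pi.add_apply, Pi.smul_apply, smul_eq_mul, Pi.zero_apply]
    linear_combination -u2 * k01 k + u1 * k02 k - u0 * k12 k)
  obtain ⟨s, t, hst⟩ := koszul_pow (i := 1) (j := 0) (k := 2) h12 h02 M a01 a02 (-a12) (by
    rw [← hu0, ← hu1, ← hu2]; linear_combination ra)
  obtain ⟨s', t', hst'⟩ := koszul_pow (i := 1) (j := 0) (k := 2) h12 h02 M b01 b02 (-b12) (by
    rw [← hu0, ← hu1, ← hu2]; linear_combination rb)
  rw [← hu0, ← hu1] at hst hst'
  choose Y hY using fun k => X_pow_dvd_of_mul (i := 0) (j := 1) h01 M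
    (Y0 k - s * V k - s' * MvPolynomial.X k) (Y1 k + t * V k + t' * MvPolynomial.X k) (by
    rw [← hu0, ← hu1]
    linear_combination k01 k + hst * V k + hst' * MvPolynomial.X k)
  refine ⟨Y, fun I => ?_⟩
  apply mul_left_cancel₀ hu0n
  rw [hY0, ← br_smul1]
  have : Y0 = u0 • Y + s • V + s' • MvPolynomial.X := by
    ext1 k
    simp only [Pi.add_apply, Pi.smul_apply, smul_eq_mul]
    rw [hu0, ← hY k]; ring
  rw [this, br_add1, br_add1, br_smul1 s, br_smul1 s', br_01, br_12]
  ring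

theorem homog_main {w : (Fin m → Fin (m + 3)) → SP} {V : Fin (m+3) → SP} (e dG : ℕ)
    (hw : ∀ I, (w I).IsHomogeneous e) (hne : ∃ I, w I ≠ 0) (hVh : ∀ k, (V k).IsHomogeneous dG)
    (Y : Fin (m+3) → SP) (h : ∀ I, w I = br V Y MvPolynomial.X (eI _ I)) :
    ∃ (j : ℕ) (Y' : Fin (m+3) → SP), (∀ k, (Y' k).IsHomogeneous j) ∧
      ∀ I, w I = br V Y' MvPolynomial.X (eI _ I) := by
  have key : ∀ I z, MvPolynomial.eval z (w I) = if dG + 1 ≤ e then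
      MvPolynomial.eval z (br V (fun k => MvPolynomial.homogeneousComponent (e - (dG+1)) (Y k)) MvPolynomial.X (eI _ I)) else 0 := by
    intro I z
    set v : Fin (m+3) → ℂ := fun k => MvPolynomial.eval z (V k) with hv
    let c : Fin (m+3) → ℂ := fun k => - br (Pi.single k 1) v z (eI ℂ I)
    have hc : ∀ A : Fin (m+3) → ℂ, br v A z (eI ℂ I) = ∑ k, A k * c k := by
      intro A
      rw [br_sw01, br_row0, ← Finset.sum_neg_distrib]
      exact Finset.sum_congr rfl (fun _ _ => by simp [c])
    have hp : Polynomial.C (MvPolynomial.eval z (w I)) * Polynomial.X ^ e =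
        (∑ k, radPoly (Y k) z * Polynomial.C (c k)) * Polynomial.X ^ (dG + 1) := by
      apply Polynomial.funext
      intro t
      have h1 := congrArg (MvPolynomial.eval (t • z)) (h I)
      rw [br_map_eI, eval_smul_hom _ e (hw I)] at h1
      have hVt : (fun i => MvPolynomial.eval (t • z) (V i)) = t ^ dG • v := by
        ext k; rw [eval_smul_hom _ dG (hVh k)]; rfl
      have hRt : (fun i => MvPolynomial.eval (t • z) (MvPolynomial.X i)) = t • z := by
        ext k; simp
      rw [hVt, hRt, br_smul0, br_smul2, hc] at h1
      simp only [Polynomial.eval_mul, Polynomial.eval_C, Polynomial.eval_pow, Polynomial.eval_X,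
        Polynomial.eval_finset_sum, radPoly_eval]
      rw [mul_comm, h1]; ring
    have h2 := congrArg (fun p => Polynomial.coeff p e) hp
    simp only [Polynomial.coeff_mul_X_pow', le_refl, if_true, Nat.sub_self, Polynomial.coeff_C_zero] at h2
    rw [h2]
    split_ifs with hle
    · rw [br_map_eI, Polynomial.finset_sum_coeff]
      have hR : (fun i => MvPolynomial.eval z (MvPolynomial.X i)) = z := by ext k; simp
      rw [hR, ← hv, hc]
      simp only [Polynomial.coeff_mul_C, radPoly_coeff]
    · rfl
  by_cases hle : dG + 1 ≤ e
  · refine ⟨_, _, fun k => MvPolynomial.homogeneousComponent_isHomogeneous (e - (dG+1)) (Y k), fun I => ?_⟩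
    apply MvPolynomial.funext
    intro z
    rw [key, if_pos hle]
  · exfalso
    obtain ⟨I, hI⟩ := hne
    apply hI
    apply MvPolynomial.funext
    intro z
    rw [key, if_neg hle, map_zero]

end core2

open Topology Filter Set

section evd
variable {ι : Type*} [Fintype ι]

noncomputable def evD (P : MvPolynomial ι ℂ) (q : ι → ℂ) : (ι → ℂ) →L[ℂ] ℂ :=
  ∑ i, (MvPolynomial.eval q (MvPolynomial.pderiv i P)) • ContinuousLinearMap.proj i

theorem evD_apply (P : MvPolynomial ι ℂ) (q u : ι → ℂ) :
    evD P q u = ∑ i, MvPolynomial.eval q (MvPolynomial.pderiv i P) * u i := by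
  simp [evD]

theorem evD_mul (P Q : MvPolynomial ι ℂ) (q : ι → ℂ) :
    evD (P * Q) q = MvPolynomial.eval q P • evD Q q + MvPolynomial.eval q Q • evD P q := by
  ext u
  simp only [ContinuousLinearMap.add_apply, ContinuousLinearMap.smul_apply, evD_apply, smul_eq_mul, Finset.mul_sum,
    ← Finset.sum_add_distrib]
  apply Finset.sum_congr rfl
  intro i _
  rw [Derivation.leibniz]
  simp; ring

theorem evD_add (P Q : MvPolynomial ι ℂ) (q : ι → ℂ) :
    evD (P + Q) q = evD P q + evD Q q := by
  ext u
  simp [evD_apply, add_mul, Finset.sum_add_distrib]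

theorem evD_X (i : ι) (q : ι → ℂ) : evD (MvPolynomial.X i) q = ContinuousLinearMap.proj i := by
  classical
  ext u
  simp [evD_apply, MvPolynomial.pderiv_X, Pi.single_apply]

theorem hasFDerivAt_eval (P : MvPolynomial ι ℂ) (q : ι → ℂ) :
    HasStrictFDerivAt (fun z => MvPolynomial.eval z P) (evD P q) q := by
  classical
  induction P using MvPolynomial.induction_on with
  | C a =>
    have : evD (MvPolynomial.C a) q = 0 := by ext u; simp [evD_apply]
    rw [this]
    simpa using hasStrictFDerivAt_const a q
  | add p r hp hr =>
    rw [evD_add]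
    have := hp.fun_add hr
    simpa only [map_add] using this
  | mul_X p i hp =>
    rw [evD_mul, evD_X]
    have h2 : HasStrictFDerivAt (fun z : ι → ℂ => z i) (ContinuousLinearMap.proj (R := ℂ) (φ := fun _ : ι => ℂ) i) q :=
      (ContinuousLinearMap.proj (R := ℂ) (φ := fun _ : ι => ℂ) i).hasStrictFDerivAt
    have := hp.fun_mul h2
    simpa only [map_mul, MvPolynomial.eval_X] using this

theorem analytic_eval (P : MvPolynomial ι ℂ) (s : Set (ι → ℂ)) : AnalyticOnNhd ℂ (fun z => MvPolynomial.eval z P) s := by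
  intro q _
  have hd : Differentiable ℂ (fun z => MvPolynomial.eval z P) := fun z => (hasFDerivAt_eval P z).hasFDerivAt.differentiableAt
  clear hd
  induction P using MvPolynomial.induction_on with
  | C a => simpa using analyticAt_const
  | add p r hp hr =>
    have := hp.fun_add hr
    simpa only [map_add] using this
  | mul_X p i hp =>
    have h2 : AnalyticAt ℂ (fun z : ι → ℂ => z i) q :=
      (ContinuousLinearMap.proj (R := ℂ) (φ := fun _ : ι => ℂ) i).analyticAt q
    have := hp.fun_mul h2
    simpa only [map_mul, MvPolynomial.eval_X] using this

noncomputable def evV (V : ι → MvPolynomial ι ℂ) (z : ι → ℂ) : ι → ℂ := fun i => MvPolynomial.eval z (V i)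

theorem fderiv_evV (V : ι → MvPolynomial ι ℂ) (q u : ι → ℂ) :
    fderiv ℂ (evV V) q u = fun k => evD (V k) q u := by
  have : HasFDerivAt (evV V) (ContinuousLinearMap.pi (fun k => evD (V k) q)) q :=
    hasFDerivAt_pi.mpr (fun k => (hasFDerivAt_eval (V k) q).hasFDerivAt)
  rw [this.fderiv]
  rfl
end evd

section sing
variable {m : ℕ}
local notation "SP" => MvPolynomial (Fin (m + 3)) ℂ

def SG (V : Fin (m+3) → MvPolynomial (Fin (m + 3)) ℂ) : Set (Fin (m+3) → ℂ) :=
  {z | z ≠ 0 ∧ ∃ c : ℂ, evV V z = c • z}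

def SD (w : (Fin m → Fin (m + 3)) → MvPolynomial (Fin (m + 3)) ℂ) : Set (Fin (m+3) → ℂ) :=
  {z | z ≠ 0 ∧ ∀ I, MvPolynomial.eval z (w I) = 0}

def RK2 (V : Fin (m+3) → MvPolynomial (Fin (m + 3)) ℂ) : Prop :=
  ∀ q ∈ SG V, ∃ ℓ : (Fin (m+3) → ℂ) →ₗ[ℂ] ℂ, ℓ q = 1 ∧
    2 ≤ Module.finrank ℂ (Submodule.map (projLin (evV V) q ℓ) (LinearMap.ker ℓ))

theorem dep_of_br (x y q : Fin (m+3) → ℂ) (hq : q ≠ 0) (h : ∀ I, br x y q (eI ℂ I) = 0) :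
    (∃ c : ℂ, x = c • q) ∨ (∃ s t : ℂ, y = s • x + t • q) := by
  by_cases hm : ∀ i j, x i * q j - x j * q i = 0
  · left
    obtain ⟨j, hj⟩ := Function.ne_iff.mp hq
    simp only [Pi.zero_apply] at hj
    refine ⟨x j / q j, ?_⟩
    ext i
    simp only [Pi.smul_apply, smul_eq_mul]
    field_simp
    linear_combination hm i j
  · right
    push Not at hm
    obtain ⟨i, j, hij⟩ := hm
    have hne : i ≠ j := by rintro rfl; exact hij (sub_self _)
    obtain ⟨σ, h0, h2⟩ := exists_perm02 i j hne
    obtain ⟨s, t, hst⟩ := br_Z_span x y q h (σ 1) (eσ ℂ σ)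
    set μ := br x (Pi.single (σ 1) 1) q (eI ℂ (eσ ℂ σ)) with hμ
    have hμ0 : μ ≠ 0 := by
      rw [hμ, br_minor]
      exact mul_ne_zero (by rw [h0, h2]; exact hij) (br_perm σ).ne_zero
    refine ⟨μ⁻¹ * s, μ⁻¹ * t, ?_⟩
    have := congrArg (fun x => μ⁻¹ • x) hst
    simpa only [smul_smul, inv_mul_cancel₀ hμ0, one_smul, smul_add] using this

theorem L6 {V X Y : Fin (m+3) → SP} {f a b c : SP} (hrk : RK2 V) (q : Fin (m+3) → ℂ) (hq : q ≠ 0)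
    (hf : MvPolynomial.eval q f ≠ 0)
    (hV : f • V = a • X + b • Y + c • MvPolynomial.X)
    (ha : MvPolynomial.eval q a = 0) (hb : MvPolynomial.eval q b = 0) :
    q ∈ SG V ∧ (∃ I, br (evV X q) (evV Y q) q (eI ℂ I) ≠ 0) ∧
      ∃ i j, MvPolynomial.eval q (MvPolynomial.pderiv i a) * MvPolynomial.eval q (MvPolynomial.pderiv j b)
        - MvPolynomial.eval q (MvPolynomial.pderiv j a) * MvPolynomial.eval q (MvPolynomial.pderiv i b) ≠ 0 := by
  have hk : ∀ k, f * V k = a * X k + b * Y k + c * MvPolynomial.X k := fun k => by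
    simpa using congrFun hV k
  have hVq : evV V q = (MvPolynomial.eval q c / MvPolynomial.eval q f) • q := by
    ext k
    have := congrArg (MvPolynomial.eval q) (hk k)
    simp only [map_mul, map_add, ha, hb, MvPolynomial.eval_X] at this
    simp only [evV, Pi.smul_apply, smul_eq_mul]
    field_simp
    linear_combination this
  have hSG : q ∈ SG V := ⟨hq, _, hVq⟩
  refine ⟨hSG, ?_⟩
  obtain ⟨ℓ, hℓ, hr⟩ := hrk q hSG
  set F := MvPolynomial.eval q f with hF
  set Cq := MvPolynomial.eval q c with hCq
  let p : (Fin (m+3) → ℂ) → (Fin (m+3) → ℂ) := fun x => x - ℓ x • q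
  let h : (Fin (m+3) → ℂ) →ₗ[ℂ] (Fin 2 → ℂ) :=
    LinearMap.pi ![(evD a q).toLinearMap, (evD b q).toLinearMap]
  let g : (Fin 2 → ℂ) →ₗ[ℂ] (Fin (m+3) → ℂ) :=
    (LinearMap.proj 0).smulRight (F⁻¹ • p (evV X q)) + (LinearMap.proj 1).smulRight (F⁻¹ • p (evV Y q))
  have hg : ∀ s, g s = s 0 • F⁻¹ • p (evV X q) + s 1 • F⁻¹ • p (evV Y q) := fun s => rfl
  have hh0 : ∀ u, h u 0 = evD a q u := fun u => rfl
  have hh1 : ∀ u, h u 1 = evD b q u := fun u => rfl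
  have hD : ∀ u, F • (fderiv ℂ (evV V) q u) + evD f q u • evV V q =
      evD a q u • evV X q + evD b q u • evV Y q + evD c q u • q + Cq • u := by
    intro u
    rw [fderiv_evV]
    ext k
    have := congrArg (fun P => evD P q u) (hk k)
    simp only [evD_add, evD_mul, evD_X, ContinuousLinearMap.add_apply, ContinuousLinearMap.smul_apply,
      smul_eq_mul, ha, hb, MvPolynomial.eval_X, ContinuousLinearMap.proj_apply] at this
    simp only [Pi.add_apply, Pi.smul_apply, smul_eq_mul, evV]
    linear_combination this
  have hproj : ∀ u, ℓ u = 0 → projLin (evV V) q ℓ u = g (h u) := by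
    intro u hu
    have h1 := hD u
    have hℓD := congrArg ℓ h1
    simp only [map_add, map_smul, smul_eq_mul, hℓ, hu, hVq] at hℓD
    have e1 : projLin (evV V) q ℓ u = fderiv ℂ (evV V) q u - ℓ (fderiv ℂ (evV V) q u) • q - ℓ (evV V q) • u := rfl
    rw [e1, hg, hh0, hh1]
    ext k
    have h1k := congrFun h1 k
    simp only [Pi.add_apply, Pi.smul_apply, smul_eq_mul, hVq] at h1k
    simp only [p, Pi.add_apply, Pi.sub_apply, Pi.smul_apply, smul_eq_mul, hVq, map_smul, hℓ]
    have hFF : F * F⁻¹ = 1 := mul_inv_cancel₀ hf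
    apply mul_left_cancel₀ hf
    rw [div_eq_mul_inv] at *
    linear_combination h1k - q k * hℓD + (evD a q u * (evV X q k - ℓ (evV X q) * q k) + evD b q u * (evV Y q k - ℓ (evV Y q) * q k)  + Cq * u k) * (-hFF)
  have hle : Submodule.map (projLin (evV V) q ℓ) (LinearMap.ker ℓ) ≤ Submodule.map g (LinearMap.range h) := by
    rintro _ ⟨u, hu, rfl⟩
    rw [hproj u hu]
    exact ⟨h u, ⟨u, rfl⟩, rfl⟩
  have hr1 : 2 ≤ Module.finrank ℂ (Submodule.map g (LinearMap.range h)) :=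
    hr.trans (Submodule.finrank_mono hle)
  have hr2 : 2 ≤ Module.finrank ℂ (LinearMap.range h) := hr1.trans (Submodule.finrank_map_le _ _)
  have hr3 : 2 ≤ Module.finrank ℂ (LinearMap.range g) :=
    hr1.trans (Submodule.finrank_mono LinearMap.map_le_range)
  have hsurj : LinearMap.range h = ⊤ := by
    apply Submodule.eq_top_of_finrank_eq
    apply le_antisymm (Submodule.finrank_le _)
    simpa using hr2
  have hinj : LinearMap.ker g = ⊥ := by
    have := LinearMap.finrank_range_add_finrank_ker g
    simp only [Module.finrank_fintype_fun_eq_card, Fintype.card_fin] at this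
    apply Submodule.finrank_eq_zero.mp
    omega
  have hinj' : ∀ s t : ℂ, s • p (evV X q) + t • p (evV Y q) = 0 → s = 0 ∧ t = 0 := by
    intro s t hst
    have : g ![s, t] = 0 := by
      rw [hg]
      have := congrArg (fun x => F⁻¹ • x) hst
      simp only [smul_add, smul_zero] at this
      show s • F⁻¹ • p (evV X q) + t • F⁻¹ • p (evV Y q) = 0
      rw [smul_comm s, smul_comm t]
      exact this
    have h2 : ![s, t] = 0 := by
      have : ![s, t] ∈ LinearMap.ker g := this
      rwa [hinj, Submodule.mem_bot] at this
    exact ⟨by simpa using congrFun h2 0, by simpa using congrFun h2 1⟩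
  have hpq : ∀ t : ℂ, p (t • q) = 0 := by intro t; simp [p, hℓ]
  constructor
  · by_contra hcon
    push Not at hcon
    rcases dep_of_br _ _ q hq hcon with ⟨t, ht⟩ | ⟨s, t, hst⟩
    · have := (hinj' 1 0 (by rw [ht, hpq]; simp)).1
      exact one_ne_zero this
    · have := (hinj' (-s) 1 (by
        rw [hst]
        simp only [p, map_add, map_smul, hℓ, smul_eq_mul]
        ext k
        simp only [Pi.add_apply, Pi.sub_apply, Pi.smul_apply, smul_eq_mul, Pi.zero_apply]
        ring)).2
      exact one_ne_zero this
  · by_contra hcon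
    push Not at hcon
    obtain ⟨u1, hu1⟩ := LinearMap.range_eq_top.mp hsurj ![1, 0]
    obtain ⟨u2, hu2⟩ := LinearMap.range_eq_top.mp hsurj ![0, 1]
    have a1 : evD a q u1 = 1 := by rw [← hh0, hu1]; rfl
    have b1 : evD b q u1 = 0 := by rw [← hh1, hu1]; rfl
    have a2 : evD a q u2 = 0 := by rw [← hh0, hu2]; rfl
    have b2 : evD b q u2 = 1 := by rw [← hh1, hu2]; rfl
    have : evD a q u1 * evD b q u2 = evD b q u1 * evD a q u2 := by
      rw [evD_apply, evD_apply, evD_apply, evD_apply, Finset.sum_mul_sum, Finset.sum_mul_sum]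
      refine Finset.sum_congr rfl (fun i _ => Finset.sum_congr rfl (fun j _ => ?_))
      linear_combination u1 i * u2 j * hcon i j
    rw [a1, b1, a2, b2] at this
    simp at this

variable {w : (Fin m → Fin (m + 3)) → MvPolynomial (Fin (m + 3)) ℂ} {V : Fin (m+3) → MvPolynomial (Fin (m + 3)) ℂ}

theorem ev_br (A B C : Fin (m+3) → SP) (q I) : MvPolynomial.eval q (br A B C (eI _ I)) =
    br (evV A q) (evV B q) (evV C q) (eI ℂ I) := br_map_eI _ _ _ _ _

theorem evV_X (q : Fin (m+3) → ℂ) : evV MvPolynomial.X q = q := by ext; simp [evV]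

/-- elements of the ideal vanish on `A`. -/
theorem Idl_van (q : Fin (m+3) → ℂ) (hG : q ∈ SG V) (hD : q ∉ SD w) (g) (hg : g ∈ Idl w V) :
    MvPolynomial.eval q g = 0 := by
  obtain ⟨Y, hY⟩ := hg
  obtain ⟨hq, c, hc⟩ := hG
  have : ∃ I, MvPolynomial.eval q (w I) ≠ 0 := by
    by_contra hcon; push Not at hcon; exact hD ⟨hq, hcon⟩
  obtain ⟨I, hI⟩ := this
  have h := congrArg (MvPolynomial.eval q) (hY I)
  rw [ev_br, evV_X, hc, br_smul0, br_02, mul_zero, map_mul] at h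
  exact (mul_eq_zero.mp h).resolve_right hI

theorem neg_mem_b {X : Fin (m+3) → SP} {b : SP}
    (hb : ∀ I, br X V MvPolynomial.X (eI _ I) = b * w I) : b ∈ Idl w V := by
  have : -b ∈ Idl w V := ⟨X, fun I => by rw [br_sw01 X V, hb]; ring⟩
  simpa using (Idl w V).neg_mem this

theorem A_of_van (hw : WD w) (hV : TanP w V) (hrk : RK2 V) (q : Fin (m+3) → ℂ) (hq : q ≠ 0)
    (h : ∀ g ∈ Idl w V, MvPolynomial.eval q g = 0) : q ∈ SG V \ SD w := by
  obtain ⟨X, Y, f, a, b, c, hf, hfw, haw, hbw, hfV⟩ := loc_data hw V hV q hq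
  obtain ⟨h1, ⟨I, hI⟩, h3⟩ := L6 hrk q hq hf hfV (h a ⟨Y, fun I => (haw I).symm⟩) (h b (neg_mem_b hbw))
  refine ⟨h1, fun hD => hI ?_⟩
  have := congrArg (MvPolynomial.eval q) (hfw I)
  rw [ev_br, evV_X, map_mul, hD.2 I, mul_zero] at this
  exact this

theorem A_chart (hw : WD w) (hV : TanP w V) (hrk : RK2 V) (q : Fin (m+3) → ℂ) (hA : q ∈ SG V \ SD w) :
    ∃ a b : SP, MvPolynomial.eval q a = 0 ∧ MvPolynomial.eval q b = 0 ∧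
      (∃ i j, MvPolynomial.eval q (MvPolynomial.pderiv i a) * MvPolynomial.eval q (MvPolynomial.pderiv j b)
        - MvPolynomial.eval q (MvPolynomial.pderiv j a) * MvPolynomial.eval q (MvPolynomial.pderiv i b) ≠ 0) ∧
      ∀ᶠ z in 𝓝 q, (z ∈ SG V ↔ MvPolynomial.eval z a = 0 ∧ MvPolynomial.eval z b = 0) ∧ z ∉ SD w := by
  have hq := hA.1.1
  obtain ⟨X, Y, f, a, b, c, hf, hfw, haw, hbw, hfV⟩ := loc_data hw V hV q hq
  have haI : a ∈ Idl w V := ⟨Y, fun I => (haw I).symm⟩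
  have hbI : b ∈ Idl w V := neg_mem_b hbw
  have ha := Idl_van q hA.1 hA.2 a haI
  have hb := Idl_van q hA.1 hA.2 b hbI
  obtain ⟨h1, _, h3⟩ := L6 hrk q hq hf hfV ha hb
  refine ⟨a, b, ha, hb, h3, ?_⟩
  have : ∃ I, MvPolynomial.eval q (w I) ≠ 0 := by
    by_contra hcon; push Not at hcon; exact hA.2 ⟨hq, hcon⟩
  obtain ⟨I, hI⟩ := this
  have e1 := (MvPolynomial.continuous_eval (w I)).continuousAt.eventually_ne hI
  have e2 := (MvPolynomial.continuous_eval f).continuousAt.eventually_ne hf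
  have e3 : ∀ᶠ z in 𝓝 q, z ≠ 0 := continuousAt_id.eventually_ne hq
  filter_upwards [e1, e2, e3] with z h1 h2 h3
  have hzD : z ∉ SD w := fun h => h1 (h.2 I)
  refine ⟨⟨fun hz => ⟨Idl_van z hz hzD a haI, Idl_van z hz hzD b hbI⟩, fun ⟨h4, h5⟩ => ?_⟩, hzD⟩
  exact (L6 hrk z h3 h2 hfV h4 h5).1

theorem exists_Y (hw : WD w) (hVT : TanP w V) (hV : VDat V) (hrk : RK2 V) (h : SG V ⊆ SD w) :
    ∃ Y, ∀ I, w I = br V Y MvPolynomial.X (eI _ I) := by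
  apply koszul_main hV
  intro q hq
  by_contra hcon
  push Not at hcon
  have := A_of_van hw hVT hrk q hq hcon
  exact this.2 (h this.1)

end sing

open Topology Filter Set

section chart
variable {ι : Type*} [Fintype ι] [DecidableEq ι]

def rs (T : Finset ι) (z : ι → ℂ) : T → ℂ := fun k => z k

theorem rs_lip (T : Finset ι) : LipschitzWith 1 (rs T) := by
  apply LipschitzWith.of_dist_le_mul
  intro x y
  simp only [NNReal.coe_one, one_mul]
  rw [dist_pi_le_iff dist_nonneg]
  intro k
  exact dist_le_pi_dist x y k

theorem rs_cont (T : Finset ι) : Continuous (rs T) := (rs_lip T).continuous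

theorem chart (T : Finset ι) (p : ι → MvPolynomial ι ℂ) (q : ι → ℂ)
    (hp : ∀ k ∉ T, MvPolynomial.eval q (p k) = 0)
    (hinj : ∀ u : ι → ℂ, (∀ k ∈ T, u k = 0) → (∀ k ∉ T, evD (p k) q u = 0) → u = 0) :
    ∃ g : (T → ℂ) → (ι → ℂ), AnalyticAt ℂ g (rs T q) ∧ g (rs T q) = q ∧
      (∀ᶠ z in 𝓝 q, (∀ k ∉ T, MvPolynomial.eval z (p k) = 0) → g (rs T z) = z) ∧
      ∀ᶠ t in 𝓝 (rs T q), (∀ k ∉ T, MvPolynomial.eval (g t) (p k) = 0) ∧ rs T (g t) = t := by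
  let P : ι → MvPolynomial ι ℂ := fun k => if k ∈ T then MvPolynomial.X k else p k
  let Φ : (ι → ℂ) → (ι → ℂ) := evV P
  let L : (ι → ℂ) →L[ℂ] (ι → ℂ) := ContinuousLinearMap.pi (fun k => evD (P k) q)
  have hL : HasStrictFDerivAt Φ L q := hasStrictFDerivAt_pi.mpr (fun k => hasFDerivAt_eval (P k) q)
  have hLinj : Function.Injective L := by
    rw [injective_iff_map_eq_zero]
    intro u hu
    apply hinj u
    · intro k hk
      have := congrFun hu k
      simpa [L, P, hk, evD_X] using this
    · intro k hk
      have := congrFun hu k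
      simpa [L, P, hk] using this
  let e : (ι → ℂ) ≃L[ℂ] (ι → ℂ) :=
    (LinearEquiv.ofInjectiveEndo L.toLinearMap hLinj).toContinuousLinearEquiv
  have he : (e : (ι → ℂ) →L[ℂ] (ι → ℂ)) = L := by ext; rfl
  rw [← he] at hL
  have hΦa : AnalyticAt ℂ Φ q := AnalyticAt.pi (fun k => analytic_eval (P k) univ q trivial)
  have hsym : AnalyticAt ℂ (hL.toOpenPartialHomeomorph Φ).symm (Φ q) :=
    (hL.toOpenPartialHomeomorph Φ).analyticAt_symm' (i := e) hL.mem_toOpenPartialHomeomorph_source hΦa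
      hL.hasFDerivAt.fderiv
  let E : (T → ℂ) → (ι → ℂ) := fun t k => if h : k ∈ T then t ⟨k, h⟩ else 0
  have hE : ∀ z, (∀ k ∉ T, MvPolynomial.eval z (p k) = 0) → E (rs T z) = Φ z := by
    intro z hz
    ext k
    by_cases hk : k ∈ T
    · simp [E, Φ, P, evV, hk, rs]
    · simp [E, Φ, P, evV, hk, hz k hk]
  have hEa : ∀ t, AnalyticAt ℂ E t := by
    intro t
    apply AnalyticAt.pi
    intro k
    by_cases hk : k ∈ T
    · simp only [E, hk, dif_pos]
      exact (ContinuousLinearMap.proj (R := ℂ) (φ := fun _ : T => ℂ) ⟨k, hk⟩).analyticAt t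
    · simp only [E, hk, dif_neg, not_false_eq_true]
      exact analyticAt_const
  have hEq := hE q hp
  refine ⟨fun t => hL.localInverse Φ e q (E t), ?_, ?_, ?_, ?_⟩
  · have : AnalyticAt ℂ (hL.toOpenPartialHomeomorph Φ).symm (E (rs T q)) := by rw [hEq]; exact hsym
    exact this.comp (hEa _)
  · show hL.localInverse Φ e q (E (rs T q)) = q
    rw [hEq]
    exact hL.localInverse_apply_image
  · filter_upwards [hL.eventually_left_inverse] with z hz h
    show hL.localInverse Φ e q (E (rs T z)) = z
    rw [hE z h, hz]
  · have h1 : ContinuousAt E (rs T q) := (hEa _).continuousAt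
    have h2 := hL.eventually_right_inverse
    rw [← hEq] at h2
    filter_upwards [h1.eventually h2] with t ht
    constructor
    · intro k hk
      have := congrFun ht k
      simpa [E, Φ, P, evV, hk] using this
    · ext ⟨k, hk⟩
      have := congrFun ht k
      simpa [E, Φ, P, evV, hk, rs] using this

theorem finrank_TC (T : Finset ι) : Module.finrank ℝ (T → ℂ) = 2 * T.card := by
  rw [Module.finrank_pi_fintype]
  simp [Complex.finrank_real_complex, mul_comm]

theorem chart_dim_le (T : Finset ι) (p : ι → MvPolynomial ι ℂ) (q : ι → ℂ)
    (hp : ∀ k ∉ T, MvPolynomial.eval q (p k) = 0)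
    (hinj : ∀ u : ι → ℂ, (∀ k ∈ T, u k = 0) → (∀ k ∉ T, evD (p k) q u = 0) → u = 0) :
    ∃ W ∈ 𝓝 q, dimH (W ∩ {z | ∀ k ∉ T, MvPolynomial.eval z (p k) = 0}) ≤ ((2 * T.card : ℕ) : ENNReal) := by
  obtain ⟨g, hg, hgq, h1, h2⟩ := chart T p q hp hinj
  obtain ⟨K, s, hs, hK⟩ := hg.hasStrictFDerivAt.exists_lipschitzOnWith
  refine ⟨_, Filter.inter_mem h1 ((rs_cont T).continuousAt.preimage_mem_nhds hs), ?_⟩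
  refine (dimH_mono (t := g '' s) ?_).trans (hK.dimH_image_le.trans ?_)
  · rintro z ⟨⟨hz1, hz2⟩, hz3⟩
    exact ⟨rs T z, hz2, hz1 hz3⟩
  · refine (dimH_mono (subset_univ _)).trans ?_
    rw [Real.dimH_univ_eq_finrank, finrank_TC]

theorem chart_proj (T : Finset ι) (p : ι → MvPolynomial ι ℂ) (q : ι → ℂ)
    (hp : ∀ k ∉ T, MvPolynomial.eval q (p k) = 0)
    (hinj : ∀ u : ι → ℂ, (∀ k ∈ T, u k = 0) → (∀ k ∉ T, evD (p k) q u = 0) → u = 0) (W) (hW : W ∈ 𝓝 q) :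
    rs T '' (W ∩ {z | ∀ k ∉ T, MvPolynomial.eval z (p k) = 0}) ∈ 𝓝 (rs T q) := by
  obtain ⟨g, hg, hgq, h1, h2⟩ := chart T p q hp hinj
  have h3 : ∀ᶠ t in 𝓝 (rs T q), g t ∈ W := hg.continuousAt.eventually (by rw [hgq]; exact hW)
  filter_upwards [h2, h3] with t h2 h3
  exact ⟨g t, ⟨h3, h2.1⟩, h2.2⟩

theorem dim_ge_of_proj (T : Finset ι) (S : Set (ι → ℂ)) (x) (h : rs T '' S ∈ 𝓝 x) :
    ((2 * T.card : ℕ) : ENNReal) ≤ dimH S := by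
  have h1 := Real.dimH_of_mem_nhds h
  rw [finrank_TC] at h1
  rw [← h1]
  exact (rs_lip T).dimH_image_le S

end chart

section deg
variable {ι : Type*} [Fintype ι] [DecidableEq ι]

theorem totalDegree_pderiv (p : MvPolynomial ι ℂ) (i : ι) (h : MvPolynomial.pderiv i p ≠ 0) :
    (MvPolynomial.pderiv i p).totalDegree < p.totalDegree := by
  obtain ⟨s, hs, hs2⟩ : ∃ s ∈ (MvPolynomial.pderiv i p).support, (MvPolynomial.pderiv i p).totalDegree = s.sum fun _ e => e := by
    have := Finset.exists_mem_eq_sup (MvPolynomial.pderiv i p).support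
      (MvPolynomial.support_nonempty.mpr h) (fun s => s.sum fun _ e => e)
    exact this
  rw [hs2]
  have h2 : s + Finsupp.single i 1 ∈ p.support := by
    rw [MvPolynomial.mem_support_iff] at hs ⊢
    intro h0
    apply hs
    rw [MvPolynomial.coeff_pderiv, h0]
    simp
  have h3 := MvPolynomial.le_totalDegree h2
  rw [Finsupp.sum_add_index' (by simp) (by simp)] at h3
  simp at h3
  simp
  omega

theorem exists_pderiv_ne (p : MvPolynomial ι ℂ) (h : ∀ c, p ≠ MvPolynomial.C c) :
    ∃ i, MvPolynomial.pderiv i p ≠ 0 := by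
  by_contra hcon
  push Not at hcon
  apply h (p.coeff 0)
  ext s
  rw [MvPolynomial.coeff_C]
  split_ifs with h0
  · rw [h0]
  · obtain ⟨i, hi⟩ := Finsupp.ne_iff.mp (Ne.symm h0)
    simp only [Finsupp.coe_zero, Pi.zero_apply] at hi
    have := congrArg (MvPolynomial.coeff (s - Finsupp.single i 1)) (hcon i)
    rw [MvPolynomial.coeff_pderiv, MvPolynomial.coeff_zero] at this
    have hss : s - Finsupp.single i 1 + Finsupp.single i 1 = s := by
      apply tsub_add_cancel_of_le
      simpa using Nat.one_le_iff_ne_zero.mpr hi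
    rw [hss] at this
    rcases mul_eq_zero.mp this with h | h
    · exact h
    · exfalso
      exact Nat.cast_add_one_ne_zero _ h

end deg

section hyp
variable {m : ℕ}
local notation "SP" => MvPolynomial (Fin (m + 3)) ℂ

/-- A hypersurface has big Hausdorff dimension. -/
theorem hyp_dim (p : SP) (hp : Irreducible p) :
    ((2 * (m + 2) : ℕ) : ENNReal) ≤ dimH {z : Fin (m+3) → ℂ | z ≠ 0 ∧ MvPolynomial.eval z p = 0} := by
  classical
  have hpr : Prime p := hp.prime
  obtain ⟨k, hk⟩ := exists_pderiv_ne p (by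
    rintro c rfl
    by_cases hc : c = 0
    · exact hpr.ne_zero (by simp [hc])
    · exact hp.not_isUnit ((IsUnit.mk0 c hc).map MvPolynomial.C))
  have hnd : ¬ p ∣ MvPolynomial.pderiv k p := by
    intro hd
    obtain ⟨r, hr⟩ := hd
    have hr0 : r ≠ 0 := by rintro rfl; exact hk (by rw [hr, mul_zero])
    have h1 := MvPolynomial.totalDegree_mul_of_isDomain hpr.ne_zero hr0
    have h2 := totalDegree_pderiv p k hk
    rw [hr, h1] at h2
    omega
  have hX : ∃ i : Fin (m+3), ¬ p ∣ MvPolynomial.X i := by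
    by_contra hcon
    push Not at hcon
    have h0 := hp.associated_of_dvd (MvPolynomial.X_prime (i := (0 : Fin (m+3)))).irreducible (hcon 0)
    have h1 := hp.associated_of_dvd (MvPolynomial.X_prime (i := (1 : Fin (m+3)))).irreducible (hcon 1)
    have h2 : (MvPolynomial.X 0 : SP) ∣ MvPolynomial.X 1 := (h0.symm.trans h1).dvd
    rw [MvPolynomial.X_dvd_X] at h2
    rcases h2 with h2 | h2
    all_goals simp at h2
  obtain ⟨i, hi⟩ := hX
  have hg : MvPolynomial.X i * MvPolynomial.pderiv k p ∉ Ideal.span {p} := by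
    rw [Ideal.mem_span_singleton]
    intro h
    rcases hpr.dvd_or_dvd h with h | h
    · exact hi h
    · exact hnd h
  have hprime : (Ideal.span {p}).IsPrime := (Ideal.span_singleton_prime hpr.ne_zero).mpr hpr
  rw [← hprime.radical, ← MvPolynomial.vanishingIdeal_zeroLocus_eq_radical (K := ℂ), MvPolynomial.mem_vanishingIdeal_iff] at hg
  push Not at hg
  obtain ⟨q, hq, hq2⟩ := hg
  have hqp : MvPolynomial.eval q p = 0 := by
    have := (MvPolynomial.mem_zeroLocus_iff.mp hq) p (Ideal.subset_span rfl)
    simpa using this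
  rw [map_mul, MvPolynomial.aeval_X] at hq2
  have hq0 : q ≠ 0 := by rintro rfl; simp at hq2
  have hpd : MvPolynomial.eval q (MvPolynomial.pderiv k p) ≠ 0 := by
    have := right_ne_zero_of_mul hq2
    rwa [MvPolynomial.aeval_eq_eval] at this
  have hpj := chart_proj (Finset.univ.erase k) (fun _ => p) q (fun _ _ => hqp) (by
    intro u h1 h2
    have h3 := h2 k (by simp)
    rw [evD_apply, Finset.sum_eq_single k] at h3
    · have huk : u k = 0 := (mul_eq_zero.mp h3).resolve_left hpd
      ext j
      by_cases hj : j = k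
      · rw [hj, huk]; rfl
      · exact h1 j (by simp [hj])
    · intro j _ hj
      rw [h1 j (by simp [hj]), mul_zero]
    · simp) {z | z ≠ 0} (isOpen_ne.mem_nhds hq0)
  have := dim_ge_of_proj _ _ _ hpj
  rw [Finset.card_erase_of_mem (Finset.mem_univ _), Finset.card_univ, Fintype.card_fin] at this
  refine le_trans (le_of_eq rfl) (this.trans (dimH_mono ?_))
  rintro z ⟨h1, h2⟩
  exact ⟨h1, h2 k (by simp)⟩
end hyp

open Topology Filter Set

section comp
variable {m : ℕ} {w : (Fin m → Fin (m + 3)) → MvPolynomial (Fin (m + 3)) ℂ} {V : Fin (m+3) → MvPolynomial (Fin (m + 3)) ℂ}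

theorem A_local (hw : WD w) (hV : TanP w V) (hrk : RK2 V) (q : Fin (m+3) → ℂ) (hA : q ∈ SG V \ SD w) :
    ∃ (T : Finset (Fin (m+3))) (p : Fin (m+3) → MvPolynomial (Fin (m + 3)) ℂ), T.card = m + 1 ∧
      (∀ k ∉ T, MvPolynomial.eval q (p k) = 0) ∧
      (∀ u : Fin (m+3) → ℂ, (∀ k ∈ T, u k = 0) → (∀ k ∉ T, evD (p k) q u = 0) → u = 0) ∧
      ∀ᶠ z in 𝓝 q, (z ∈ SG V ↔ ∀ k ∉ T, MvPolynomial.eval z (p k) = 0) ∧ z ∉ SD w := by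
  obtain ⟨a, b, ha, hb, ⟨i, j, hij⟩, hev⟩ := A_chart hw hV hrk q hA
  have hne : i ≠ j := by rintro rfl; exact hij (by ring)
  refine ⟨Finset.univ \ {i, j}, fun k => if k = i then a else b, ?_, ?_, ?_, ?_⟩
  · rw [Finset.card_sdiff_of_subset (Finset.subset_univ _), Finset.card_univ, Finset.card_pair hne, Fintype.card_fin]
    rfl
  · intro k _
    dsimp only
    split_ifs <;> assumption
  · intro u h1 h2
    have hs : ∀ P : MvPolynomial (Fin (m+3)) ℂ, evD P q u = MvPolynomial.eval q (MvPolynomial.pderiv i P) * u i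
        + MvPolynomial.eval q (MvPolynomial.pderiv j P) * u j := by
      intro P
      rw [evD_apply, ← Finset.sum_subset (Finset.subset_univ {i, j}), Finset.sum_pair hne]
      intro x _ hx
      rw [h1 x (by simpa using hx), mul_zero]
    have h3 := h2 i (by simp)
    have h4 := h2 j (by simp)
    dsimp only at h3 h4
    rw [if_pos rfl, hs] at h3
    rw [if_neg hne.symm, hs] at h4
    have hi : u i = 0 := by
      apply (mul_eq_zero.mp ?_).resolve_left hij
      linear_combination h3 * MvPolynomial.eval q (MvPolynomial.pderiv j b) - h4 * MvPolynomial.eval q (MvPolynomial.pderiv j a)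
    have hj : u j = 0 := by
      apply (mul_eq_zero.mp ?_).resolve_left hij
      linear_combination h4 * MvPolynomial.eval q (MvPolynomial.pderiv i a) - h3 * MvPolynomial.eval q (MvPolynomial.pderiv i b)
    ext k
    by_cases hki : k = i
    · rw [hki, hi]; rfl
    by_cases hkj : k = j
    · rw [hkj, hj]; rfl
    exact h1 k (by simp [hki, hkj])
  · filter_upwards [hev] with z hz
    refine ⟨hz.1.trans ⟨fun h k _ => ?_, fun h => ⟨?_, ?_⟩⟩, hz.2⟩
    · split_ifs
      · exact h.1
      · exact h.2
    · simpa using h i (by simp)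
    · simpa [hne.symm] using h j (by simp)

theorem A_param (hw : WD w) (hV : TanP w V) (hrk : RK2 V) (q : Fin (m+3) → ℂ) (hA : q ∈ SG V \ SD w)
    (W) (hW : W ∈ 𝓝 q) :
    ∃ (T : Finset (Fin (m+3))) (g : (T → ℂ) → (Fin (m+3) → ℂ)) (r : ℝ), T.card = m + 1 ∧ 0 < r ∧
      AnalyticOnNhd ℂ g (Metric.ball (rs T q) r) ∧ g (rs T q) = q ∧
      (∀ t ∈ Metric.ball (rs T q) r, g t ∈ W ∧ g t ∈ SG V \ SD w ∧ rs T (g t) = t) ∧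
      ∀ᶠ z in 𝓝 q, z ∈ SG V → z ∈ SG V \ SD w ∧ rs T z ∈ Metric.ball (rs T q) r ∧ g (rs T z) = z := by
  obtain ⟨T, p, hT, hp, hinj, hev⟩ := A_local hw hV hrk q hA
  obtain ⟨g, hg, hgq, h1, h2⟩ := chart T p q hp hinj
  have hW' : ∀ᶠ t in 𝓝 (rs T q), g t ∈ W := hg.continuousAt.eventually (by rw [hgq]; exact hW)
  have hev' : ∀ᶠ t in 𝓝 (rs T q), (g t ∈ SG V ↔ ∀ k ∉ T, MvPolynomial.eval (g t) (p k) = 0) ∧ g t ∉ SD w :=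
    hg.continuousAt.eventually (by rw [hgq]; exact hev)
  have hall := ((hg.eventually_analyticAt.and h2).and hW').and hev'
  obtain ⟨r, hr, hball⟩ := Metric.eventually_nhds_iff_ball.mp hall
  refine ⟨T, g, r, hT, hr, fun t ht => (hball t ht).1.1.1, hgq, ?_, ?_⟩
  · intro t ht
    obtain ⟨⟨⟨_, h3⟩, h4⟩, h5⟩ := hball t ht
    exact ⟨h4, ⟨h5.1.mpr h3.1, h5.2⟩, h3.2⟩
  · have h6 : ∀ᶠ z in 𝓝 q, rs T z ∈ Metric.ball (rs T q) r :=
      (rs_cont T).continuousAt.eventually (Metric.ball_mem_nhds _ hr)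
    filter_upwards [hev, h1, h6] with z h7 h8 h9 hz
    exact ⟨⟨hz, h7.2⟩, h9, h8 (h7.1.mp hz)⟩

theorem A_closed (hw : WD w) (hV : TanP w V) (hrk : RK2 V) (q : Fin (m+3) → ℂ) (hq : q ≠ 0)
    (hA : q ∉ SG V \ SD w) : ∀ᶠ z in 𝓝 q, z ∉ SG V \ SD w := by
  have : ∃ g ∈ Idl w V, MvPolynomial.eval q g ≠ 0 := by
    by_contra hcon
    push Not at hcon
    exact hA (A_of_van hw hV hrk q hq hcon)
  obtain ⟨g, hg, hgq⟩ := this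
  filter_upwards [(MvPolynomial.continuous_eval g).continuousAt.eventually_ne hgq] with z hz h
  exact hz (Idl_van z h.1 h.2 g hg)

theorem analytic_closed {N : ℕ} {U S : Set (Cn N)} (h : IsAnalyticIn U S) (hU : IsOpen U) (q) (hq : q ∈ U) (hqS : q ∉ S) :
    ∀ᶠ z in 𝓝 q, z ∉ S := by
  obtain ⟨hSU, h⟩ := h
  obtain ⟨W, hW, r, f, hf, hz⟩ := h q hq
  have h1 : ∃ i, f i q ≠ 0 := by
    by_contra hcon
    push Not at hcon
    exact hqS ((hz q ⟨mem_of_mem_nhds hW, hq⟩).mpr hcon)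
  obtain ⟨i, hi⟩ := h1
  filter_upwards [(hf i q (mem_of_mem_nhds hW)).continuousAt.eventually_ne hi, hW, hU.mem_nhds hq] with z h1 h2 h3 h4
  exact h1 ((hz z ⟨h2, h3⟩).mp h4 i)

theorem comp_exists (hw : WD w) (hV : TanP w V) (hrk : RK2 V) (q0 : Fin (m+3) → ℂ) (hq0 : q0 ∈ SG V \ SD w) :
    ∃ C, IsIrredComponentIn {z : Cn (m+3) | z ≠ 0} (SG V) C ∧ dimH C = ((2 * (m + 1) : ℕ) : ENNReal) ∧
      ∀ z ∈ C, z ∉ SD w := by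
  set A : Set (Fin (m+3) → ℂ) := SG V \ SD w with hAdef
  set C := connectedComponentIn A q0 with hC
  have hCA : C ⊆ A := connectedComponentIn_subset _ _
  have hq0C : q0 ∈ C := mem_connectedComponentIn hq0
  have hU : IsOpen {z : Cn (m+3) | z ≠ 0} := isOpen_ne
  have hCpre : IsPreconnected C := isPreconnected_connectedComponentIn
  -- a preconnected subset of A meeting C lies in C
  have hsub : ∀ P : Set (Fin (m+3) → ℂ), IsPreconnected P → P ⊆ A → ∀ x ∈ P, x ∈ C → P ⊆ C := by
    intro P hP hPA x hx hxC
    have := hP.subset_connectedComponentIn hx hPA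
    rwa [← connectedComponentIn_eq hxC] at this
  -- parametrization adapted to C
  have hpar : ∀ q ∈ C, ∀ W ∈ 𝓝 q, ∃ (T : Finset (Fin (m+3))) (g : (T → ℂ) → (Fin (m+3) → ℂ)) (r : ℝ), T.card = m + 1 ∧ 0 < r ∧
      AnalyticOnNhd ℂ g (Metric.ball (rs T q) r) ∧
      (∀ t ∈ Metric.ball (rs T q) r, g t ∈ W ∧ g t ∈ C ∧ rs T (g t) = t) ∧
      ∀ᶠ z in 𝓝 q, z ∈ SG V → z ∈ C ∧ rs T z ∈ Metric.ball (rs T q) r ∧ g (rs T z) = z := by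
    intro q hq W hW
    obtain ⟨T, g, r, hT, hr, hg, hgq, h1, h2⟩ := A_param hw hV hrk q (hCA hq) W hW
    have hin : g '' (Metric.ball (rs T q) r) ⊆ C := by
      apply hsub _ ((convex_ball _ _).isPreconnected.image g hg.continuousOn) _ q ⟨_, Metric.mem_ball_self hr, hgq⟩ hq
      rintro _ ⟨t, ht, rfl⟩
      exact (h1 t ht).2.1
    refine ⟨T, g, r, hT, hr, hg, fun t ht => ⟨(h1 t ht).1, hin ⟨t, ht, rfl⟩, (h1 t ht).2.2⟩, ?_⟩
    filter_upwards [h2] with z hz hzG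
    obtain ⟨h3, h4, h5⟩ := hz hzG
    exact ⟨h5 ▸ hin ⟨_, h4, rfl⟩, h4, h5⟩
  have hopen : ∀ q ∈ C, ∀ᶠ z in 𝓝 q, (z ∈ SG V → z ∈ C) := by
    intro q hq
    obtain ⟨T, g, r, _, _, _, _, h⟩ := hpar q hq univ univ_mem
    filter_upwards [h] with z hz h'
    exact (hz h').1
  have hclosed : ∀ q, q ≠ 0 → q ∉ C → ∀ᶠ z in 𝓝 q, z ∉ C := by
    intro q hq hqC
    by_cases hqA : q ∈ A
    · obtain ⟨T, g, r, hT, hr, hg, hgq, h1, h2⟩ := A_param hw hV hrk q hqA univ univ_mem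
      filter_upwards [h2] with z hz hzC
      obtain ⟨_, h4, h5⟩ := hz (hCA hzC).1
      apply hqC
      apply hsub (g '' (Metric.ball (rs T q) r)) ((convex_ball _ _).isPreconnected.image g hg.continuousOn) _ z ⟨_, h4, h5⟩ hzC
      · exact ⟨_, Metric.mem_ball_self hr, hgq⟩
      rintro _ ⟨t, ht, rfl⟩
      exact (h1 t ht).2.1
    · filter_upwards [A_closed hw hV hrk q hq hqA] with z hz h
      exact hz (hCA h)
  have hCU : C ⊆ {z : Cn (m+3) | z ≠ 0} := fun z hz => (hCA hz).1.1
  -- C is analytic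
  have hCan : IsAnalyticIn {z : Cn (m+3) | z ≠ 0} C := by
    refine ⟨hCU, fun q hq => ?_⟩
    by_cases hqC : q ∈ C
    · obtain ⟨a, b, ha, hb, _, hev⟩ := A_chart hw hV hrk q (hCA hqC)
      refine ⟨_, Filter.inter_mem hev (hopen q hqC), 2, ![fun z => MvPolynomial.eval z a, fun z => MvPolynomial.eval z b], ?_, ?_⟩
      · intro i
        fin_cases i
        · exact analytic_eval a _
        · exact analytic_eval b _
      · rintro z ⟨⟨h1, h2⟩, h3⟩
        have h4 : z ∈ C ↔ z ∈ SG V := ⟨fun h => (hCA h).1, h2⟩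
        rw [h4, h1.1]
        simp [Fin.forall_fin_two]
    · refine ⟨_, hclosed q hq hqC, 1, fun _ _ => 1, fun _ => analyticOnNhd_const, ?_⟩
      rintro z ⟨h1, h2⟩
      exact ⟨fun h => absurd h h1, fun h => absurd (h 0) one_ne_zero⟩
  have hCirr : IsIrredAnalyticIn {z : Cn (m+3) | z ≠ 0} C := by
    refine ⟨hCan, ⟨q0, hq0C⟩, ?_⟩
    intro V1 V2 hV1 hV2 hu
    have hV1C : V1 ⊆ C := hu ▸ subset_union_left
    have hV2C : V2 ⊆ C := hu ▸ subset_union_right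
    set u : Set (Fin (m+3) → ℂ) := {z | ∀ᶠ y in 𝓝 z, y ∈ C → y ∈ V1} with hudef
    by_cases hO : (C ∩ u).Nonempty
    · left
      have key : ∀ c ∈ C, (∀ᶠ z in 𝓝 c, z ∈ C → z ∈ u) ∨ (∀ᶠ z in 𝓝 c, z ∈ C → z ∉ u) := by
        intro c hc
        by_cases hfr : ∀ᶠ z in 𝓝 c, z ∈ C → z ∉ u
        · exact Or.inr hfr
        left
        obtain ⟨W, hW, k, f, hf, hfz⟩ := hV1.2 c (hCU hc)
        obtain ⟨T, g, r, hT, hr, hg, h1, h2⟩ := hpar c hc W hW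
        have hfr' : ∃ᶠ z in 𝓝 c, z ∈ C ∧ z ∈ u := by
          intro h
          apply hfr
          filter_upwards [h] with z hz h1 h2
          exact hz ⟨h1, h2⟩
        obtain ⟨z, ⟨hzC, hzu⟩, hz2⟩ := (hfr'.and_eventually h2).exists
        obtain ⟨_, hzB, hgz⟩ := hz2 (hCA hzC).1
        have hvan : ∀ i, EqOn (fun t => f i (g t)) 0 (Metric.ball (rs T c) r) := by
          intro i
          have han : AnalyticOnNhd ℂ (fun t => f i (g t)) (Metric.ball (rs T c) r) := by
            intro t ht
            exact AnalyticAt.comp (hf i (g t) (h1 t ht).1) (hg t ht)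
          apply han.eqOn_zero_of_preconnected_of_eventuallyEq_zero (convex_ball _ _).isPreconnected hzB
          have hzu' : ∀ᶠ t in 𝓝 (rs T z), g t ∈ C → g t ∈ V1 :=
            (hg _ hzB).continuousAt.eventually (by rw [hgz]; exact hzu)
          filter_upwards [hzu', Metric.isOpen_ball.mem_nhds hzB] with t ht htB
          have h3 := h1 t htB
          exact (hfz (g t) ⟨h3.1, hCU h3.2.1⟩).mp (ht h3.2.1) i
        have h4 : ∀ᶠ z in 𝓝 c, z ∈ C → z ∈ V1 := by
          filter_upwards [h2] with y hy hyC
          obtain ⟨_, h5, h6⟩ := hy (hCA hyC).1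
          rw [← h6]
          exact (hfz _ ⟨(h1 _ h5).1, hCU (h1 _ h5).2.1⟩).mpr (fun i => hvan i h5)
        filter_upwards [eventually_eventually_nhds.mpr h4] with y hy _
        exact hy
      have hCu : ∀ c ∈ C, ∀ᶠ z in 𝓝 c, z ∈ C → z ∈ u := by
        intro c hc
        rcases key c hc with h | h
        · exact h
        exfalso
        obtain ⟨c1, hc1, hc1u⟩ := hO
        have hc1' : ∀ᶠ z in 𝓝 c1, z ∈ C → z ∈ u := by
          filter_upwards [eventually_eventually_nhds.mpr hc1u] with y hy _
          exact hy
        obtain ⟨y, hy, hy1, hy2⟩ := hCpre {z | ∀ᶠ y in 𝓝 z, y ∈ C → y ∈ u} {z | ∀ᶠ y in 𝓝 z, y ∈ C → y ∉ u}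
          isOpen_setOf_eventually_nhds isOpen_setOf_eventually_nhds (fun x hx => key x hx) ⟨c1, hc1, hc1'⟩ ⟨c, hc, h⟩
        exact hy2.self_of_nhds hy (hy1.self_of_nhds hy)
      apply Subset.antisymm _ hV1C
      intro c hc
      have h1 : c ∈ u := (hCu c hc).self_of_nhds hc
      exact Eventually.self_of_nhds h1 hc
    · right
      apply Subset.antisymm _ hV2C
      intro c hc
      by_contra hc2
      apply hO
      refine ⟨c, hc, ?_⟩
      show ∀ᶠ y in 𝓝 c, y ∈ C → y ∈ V1
      filter_upwards [analytic_closed hV2 hU c (hCU hc) hc2] with y hy hyC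
      rw [hu] at hyC
      exact hyC.resolve_right hy
  refine ⟨C, ⟨hCirr, fun z hz => (hCA hz).1, ?_⟩, ?_, fun z hz => (hCA hz).2⟩
  · intro C' hC' hCC' hC'G
    have han : IsAnalyticIn {z : Cn (m+3) | z ≠ 0} (C' \ C) := by
      refine ⟨fun z hz => hC'.1.1 hz.1, fun q hq => ?_⟩
      by_cases hqC : q ∈ C
      · refine ⟨_, hopen q hqC, 1, fun _ _ => 1, fun _ => analyticOnNhd_const, ?_⟩
        rintro z ⟨h1, h2⟩
        exact ⟨fun h => absurd (h1 (hC'G h.1)) h.2, fun h => absurd (h 0) one_ne_zero⟩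
      · obtain ⟨W, hW, r, f, hf, hfz⟩ := hC'.1.2 q hq
        refine ⟨_, Filter.inter_mem hW (hclosed q hq hqC), r, f, fun i => (hf i).mono inter_subset_left, ?_⟩
        rintro z ⟨⟨h1, h2⟩, h3⟩
        rw [← hfz z ⟨h1, h3⟩]
        exact ⟨fun h => h.1, fun h => ⟨h, h2⟩⟩
    rcases hC'.2.2 C (C' \ C) hCan han (by rw [union_diff_self, union_eq_self_of_subset_left hCC']) with h | h
    · exact h
    · exfalso
      have := hCC' hq0C
      rw [h] at this
      exact this.2 hq0C
  · apply le_antisymm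
    · by_contra hcon
      push Not at hcon
      obtain ⟨x, hx, hx2⟩ := exists_mem_nhdsWithin_lt_dimH_of_lt_dimH hcon
      obtain ⟨T, p, hT, hp, hinj, hev⟩ := A_local hw hV hrk x (hCA hx)
      obtain ⟨W, hW, hd⟩ := chart_dim_le T p x hp hinj
      rw [hT] at hd
      refine absurd (hx2 (W ∩ {z | ∀ k ∉ T, MvPolynomial.eval z (p k) = 0}) ?_) (not_lt.mpr hd)
      rw [mem_nhdsWithin_iff_eventually]
      filter_upwards [hW, hev] with y hy1 hy2 hy3
      exact ⟨hy1, hy2.1.mp (hCA hy3).1⟩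
    · obtain ⟨T, g, r, hT, hr, hg, h1, h2⟩ := hpar q0 hq0C univ univ_mem
      rw [← hT]
      apply dim_ge_of_proj T C (rs T q0)
      filter_upwards [Metric.ball_mem_nhds (rs T q0) hr] with t ht
      exact ⟨g t, (h1 t ht).2.1, (h1 t ht).2.2⟩
end comp

open Topology Filter Set

section dim
variable {ι : Type*} [Fintype ι] [DecidableEq ι]

def VJ (J : Ideal (MvPolynomial ι ℂ)) : Set (ι → ℂ) := {z | ∀ f ∈ J, MvPolynomial.eval z f = 0}

theorem vars_pderiv (p : MvPolynomial ι ℂ) (i : ι) : (MvPolynomial.pderiv i p).vars ⊆ p.vars := by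
  intro j hj
  rw [MvPolynomial.mem_vars] at hj ⊢
  obtain ⟨s, hs, hjs⟩ := hj
  refine ⟨s + Finsupp.single i 1, ?_, ?_⟩
  · rw [MvPolynomial.mem_support_iff] at hs ⊢
    intro h0
    apply hs
    rw [MvPolynomial.coeff_pderiv, h0, zero_mul]
  · rw [Finsupp.mem_support_iff] at hjs ⊢
    simp only [Finsupp.coe_add, Pi.add_apply]
    omega

theorem notMem_vars_of_pderiv (p : MvPolynomial ι ℂ) (i : ι) (h : MvPolynomial.pderiv i p = 0) : i ∉ p.vars := by
  intro hi
  rw [MvPolynomial.mem_vars] at hi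
  obtain ⟨s, hs, his⟩ := hi
  rw [Finsupp.mem_support_iff] at his
  have := congrArg (MvPolynomial.coeff (s - Finsupp.single i 1)) h
  rw [MvPolynomial.coeff_pderiv, MvPolynomial.coeff_zero] at this
  have hss : s - Finsupp.single i 1 + Finsupp.single i 1 = s := by
    apply tsub_add_cancel_of_le
    simpa using Nat.one_le_iff_ne_zero.mpr his
  rw [hss] at this
  rw [MvPolynomial.mem_support_iff] at hs
  rcases mul_eq_zero.mp this with h | h
  · exact hs h
  · exact Nat.cast_add_one_ne_zero _ h

theorem VJ_sup (J : Ideal (MvPolynomial ι ℂ)) (f : MvPolynomial ι ℂ) (z) (hz : z ∈ VJ J) (hf : MvPolynomial.eval z f = 0) :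
    z ∈ VJ (J ⊔ Ideal.span {f}) := by
  intro g hg
  obtain ⟨a, ha, b, hb, rfl⟩ := Submodule.mem_sup.mp hg
  obtain ⟨c, rfl⟩ := Ideal.mem_span_singleton'.mp hb
  rw [map_add, map_mul, hf, hz a ha]
  simp

theorem lt_sup_span (J : Ideal (MvPolynomial ι ℂ)) (f : MvPolynomial ι ℂ) (hf : f ∉ J) : J < J ⊔ Ideal.span {f} := by
  refine lt_of_le_of_ne le_sup_left (fun h => hf ?_)
  rw [h]
  exact Ideal.mem_sup_right (Ideal.mem_span_singleton_self f)

theorem dim_lemma (s : ℕ) (J : Ideal (MvPolynomial ι ℂ))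
    (h : ∀ T : Finset ι, T.card = s + 1 → ∃ p ∈ J, p ≠ 0 ∧ p.vars ⊆ T) :
    dimH (VJ J) ≤ ((2 * s : ℕ) : ENNReal) := by
  induction J using WellFoundedGT.induction with
  | ind J ih =>
  have ih' : ∀ f ∉ J, dimH (VJ (J ⊔ Ideal.span {f})) ≤ ((2 * s : ℕ) : ENNReal) := by
    intro f hf
    apply ih _ (lt_sup_span J f hf)
    intro T hT
    obtain ⟨p, hp, hp2⟩ := h T hT
    exact ⟨p, Ideal.mem_sup_left hp, hp2⟩
  by_cases htop : J = ⊤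
  · have : VJ J = ∅ := by
      ext z
      simp only [mem_empty_iff_false, iff_false]
      intro hz
      have := hz 1 (by rw [htop]; trivial)
      simp at this
    rw [this, dimH_empty]
    exact zero_le
  by_cases hpr : J.IsPrime
  swap
  · have : ∃ f g, f ∉ J ∧ g ∉ J ∧ f * g ∈ J := by
      by_contra hcon
      push Not at hcon
      apply hpr
      refine ⟨htop, fun {x y} hxy => ?_⟩
      by_contra h2
      push Not at h2
      exact hcon x y h2.1 h2.2 hxy
    obtain ⟨f, g, hf, hg, hfg⟩ := this
    have hsub : VJ J ⊆ VJ (J ⊔ Ideal.span {f}) ∪ VJ (J ⊔ Ideal.span {g}) := by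
      intro z hz
      have := hz _ hfg
      rw [map_mul] at this
      rcases mul_eq_zero.mp this with h | h
      · exact Or.inl (VJ_sup J f z hz h)
      · exact Or.inr (VJ_sup J g z hz h)
    refine (dimH_mono hsub).trans ?_
    rw [dimH_union]
    exact max_le (ih' f hf) (ih' g hg)
  -- prime case
  let Ind : Finset ι → Prop := fun I => ∀ p ∈ J, p.vars ⊆ I → p = 0
  have hfin : (Set.univ : Set (Finset ι)).Finite := Set.finite_univ
  have hI0 : Ind ∅ := by
    intro p hp hv
    have h1 : p.vars = ∅ := Finset.subset_empty.mp hv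
    rw [MvPolynomial.vars_eq_empty_iff_eq_C] at h1
    by_contra hne
    apply htop
    apply Ideal.eq_top_of_isUnit_mem J hp
    rw [h1]
    apply IsUnit.map
    apply IsUnit.mk0
    intro h0
    rw [h0, map_zero] at h1
    exact hne h1
  obtain ⟨I, hI, hImax⟩ : ∃ I, Ind I ∧ ∀ I', Ind I' → I'.card ≤ I.card := by
    obtain ⟨I, hI1, hI2⟩ := Set.exists_max_image {I | Ind I} Finset.card (Set.toFinite _) ⟨∅, hI0⟩
    exact ⟨I, hI1, hI2⟩
  have hIcard : I.card ≤ s := by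
    by_contra hcon
    push Not at hcon
    obtain ⟨T, hT1, hT2⟩ := Finset.exists_subset_card_eq (show s + 1 ≤ I.card from hcon)
    obtain ⟨p, hp, hp0, hpv⟩ := h T hT2
    exact hp0 (hI p hp (hpv.trans hT1))
  have hex : ∀ j, j ∉ I → ∃ p ∈ J, p.vars ⊆ insert j I ∧ MvPolynomial.pderiv j p ∉ J := by
    intro j hj
    have hne : {p | p ∈ J ∧ p ≠ 0 ∧ p.vars ⊆ insert j I}.Nonempty := by
      by_contra hcon
      have : Ind (insert j I) := by
        intro p hp hv
        by_contra h0
        exact hcon ⟨p, hp, h0, hv⟩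
      have := hImax _ this
      rw [Finset.card_insert_of_notMem hj] at this
      omega
    obtain ⟨p, ⟨hp, hp0, hpv⟩, hpmin⟩ := exists_minimalFor_of_wellFoundedLT (fun p => p ∈ J ∧ p ≠ 0 ∧ p.vars ⊆ insert j I) MvPolynomial.totalDegree hne
    refine ⟨p, hp, hpv, fun hd => ?_⟩
    have hd0 : MvPolynomial.pderiv j p ≠ 0 := by
      intro h0
      have := notMem_vars_of_pderiv p j h0
      apply hp0
      apply hI p hp
      intro x hx
      rcases Finset.mem_insert.mp (hpv hx) with rfl | h
      · exact absurd hx this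
      · exact h
    have h1 := totalDegree_pderiv p j hd0
    have h2 := hpmin (j := MvPolynomial.pderiv j p) ⟨hd, hd0, (vars_pderiv p j).trans hpv⟩ h1.le
    omega
  choose! p hpJ hpv hpd using hex
  set g := ∏ j ∈ Iᶜ, MvPolynomial.pderiv j (p j) with hg
  have hgJ : g ∉ J := by
    intro hmem
    obtain ⟨j, hj, hj2⟩ := (hpr.prod_mem_iff).mp hmem
    exact hpd j (by simpa using hj) hj2
  have hsub : VJ J ⊆ VJ (J ⊔ Ideal.span {g}) ∪ {z ∈ VJ J | MvPolynomial.eval z g ≠ 0} := by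
    intro z hz
    by_cases h0 : MvPolynomial.eval z g = 0
    · exact Or.inl (VJ_sup J g z hz h0)
    · exact Or.inr ⟨hz, h0⟩
  refine (dimH_mono hsub).trans ?_
  rw [dimH_union]
  refine max_le (ih' g hgJ) ?_
  by_contra hcon
  push Not at hcon
  obtain ⟨q, ⟨hq, hqg⟩, hx2⟩ := exists_mem_nhdsWithin_lt_dimH_of_lt_dimH hcon
  have hqd : ∀ j ∉ I, MvPolynomial.eval q (MvPolynomial.pderiv j (p j)) ≠ 0 := by
    intro j hj h0
    apply hqg
    rw [hg, map_prod]
    exact Finset.prod_eq_zero (by simpa using hj) h0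
  obtain ⟨W, hW, hd⟩ := chart_dim_le I p q (fun k hk => hq _ (hpJ k hk)) (by
    intro u h1 h2
    ext k
    by_cases hk : k ∈ I
    · exact h1 k hk
    have h3 := h2 k hk
    rw [evD_apply, Finset.sum_eq_single k] at h3
    · exact (mul_eq_zero.mp h3).resolve_left (hqd k hk)
    · intro j _ hj
      by_cases hjI : j ∈ I
      · rw [h1 j hjI, mul_zero]
      · rw [MvPolynomial.pderiv_eq_zero_of_notMem_vars (fun hmem => ?_)]
        · simp
        · rcases Finset.mem_insert.mp (hpv k hk hmem) with h | h
          · exact hj h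
          · exact hjI h
    · simp)
  refine absurd (hx2 (W ∩ {z | ∀ k ∉ I, MvPolynomial.eval z (p k) = 0}) ?_) (not_lt.mpr (hd.trans ?_))
  · rw [mem_nhdsWithin_iff_eventually]
    filter_upwards [hW] with y hy1 hy2
    exact ⟨hy1, fun k hk => hy2.1 _ (hpJ k hk)⟩
  · exact_mod_cast Nat.mul_le_mul_left 2 hIcard
end dim

open Topology Filter Set

section inter1
variable {σ : Type} [Fintype σ]

theorem hc_mul_one (d : MvPolynomial σ ℂ) (hd : d.IsHomogeneous 1) (k : ℕ) (c : MvPolynomial σ ℂ) :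
    MvPolynomial.homogeneousComponent (k+1) (c * d) = MvPolynomial.homogeneousComponent k c * d := by
  induction c using MvPolynomial.induction_on' with
  | monomial s a =>
    have h1 : (MvPolynomial.monomial s a : MvPolynomial σ ℂ).IsHomogeneous s.degree :=
      MvPolynomial.isHomogeneous_monomial a rfl
    have h2 := h1.mul hd
    rw [MvPolynomial.homogeneousComponent_of_mem h1, MvPolynomial.homogeneousComponent_of_mem h2]
    by_cases h : k = s.degree
    · rw [if_pos (by omega), if_pos (by omega)]
    · rw [if_neg (by omega), if_neg (by omega), zero_mul]
  | add p q hp hq => rw [add_mul, map_add, map_add, hp, hq, add_mul]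

theorem span_csmul {B : Type} [CommRing B] [Algebra ℂ B] (A : Subalgebra ℂ B) (S : Set B) (c : ℂ) (x : B)
    (hx : x ∈ Submodule.span A S) : c • x ∈ Submodule.span A S := Submodule.smul_of_tower_mem _ c hx

theorem fin_lemma {κ : Type} [Fintype κ] (I p : Ideal (MvPolynomial σ ℂ))
    (hI : ∀ f ∈ I, ∀ k, MvPolynomial.homogeneousComponent k f ∈ I)
    (d : κ → MvPolynomial σ ℂ) (hd : ∀ i, (d i).IsHomogeneous 1) (M : ℕ)
    (hM : (MvPolynomial.idealOfVars σ ℂ) ^ (M+1) ≤ I ⊔ Ideal.span (Set.range d)) (hp : I ≤ p) :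
    ∀ k (P : MvPolynomial σ ℂ), P.IsHomogeneous k → Ideal.Quotient.mk p P ∈
      Submodule.span (Algebra.adjoin ℂ (Set.range (fun i => Ideal.Quotient.mk p (d i))))
        ((fun s : σ →₀ ℕ => Ideal.Quotient.mk p (MvPolynomial.monomial s 1)) '' {s | s.degree < M + 1}) := by
  intro k
  induction k with
  | zero =>
    intro P hP
    have : P = MvPolynomial.C (MvPolynomial.coeff 0 P) := by
      rw [← MvPolynomial.homogeneousComponent_zero, MvPolynomial.homogeneousComponent_eq_self hP]
    rw [this, ← mul_one (MvPolynomial.C _)]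
    rw [← MvPolynomial.smul_eq_C_mul]
    change Ideal.Quotient.mkₐ ℂ p _ ∈ _
    rw [map_smul]
    refine span_csmul _ _ _ _ (Submodule.subset_span ⟨0, ?_, rfl⟩)
    simp
  | succ k ih =>
    intro P hP
    by_cases hk : k < M
    · rw [P.as_sum, map_sum]
      refine Submodule.sum_mem _ fun s hs => ?_
      have hs' : s.degree = k + 1 := by
        have := hP (MvPolynomial.mem_support_iff.1 hs)
        rw [Finsupp.degree_eq_weight_one]; exact this
      have : MvPolynomial.monomial s (MvPolynomial.coeff s P) = (MvPolynomial.coeff s P) • (MvPolynomial.monomial s (1:ℂ)) := by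
        rw [MvPolynomial.smul_monomial]; simp
      rw [this]
      change Ideal.Quotient.mkₐ ℂ p _ ∈ _
      rw [map_smul]
      refine span_csmul _ _ _ _ (Submodule.subset_span ⟨s, ?_, rfl⟩)
      simp only [mem_setOf_eq]; omega
    · have hPm : P ∈ (MvPolynomial.idealOfVars σ ℂ) ^ (M+1) := by
        rw [MvPolynomial.mem_pow_idealOfVars_iff]
        intro s hs
        have := hP (MvPolynomial.mem_support_iff.1 hs)
        have h2 : s.degree = k + 1 := by
          rw [Finsupp.degree_eq_weight_one]; exact this
        omega
      obtain ⟨Q, hQ, Z, hZ, hPQ⟩ := Submodule.mem_sup.1 (hM hPm)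
      obtain ⟨c, hc⟩ := Ideal.mem_span_range_iff_exists_fun.1 hZ
      have : P = MvPolynomial.homogeneousComponent (k+1) Q
          + ∑ i, MvPolynomial.homogeneousComponent k (c i) * d i := by
        conv_lhs => rw [← MvPolynomial.homogeneousComponent_eq_self hP, ← hPQ, ← hc, map_add, map_sum]
        simp only [hc_mul_one _ (hd _)]
      rw [this, map_add, Ideal.Quotient.eq_zero_iff_mem.2 (hp (hI Q hQ _)), zero_add, map_sum]
      refine Submodule.sum_mem _ fun i _ => ?_
      rw [map_mul, mul_comm]
      exact Submodule.smul_mem _ (⟨_, Algebra.subset_adjoin ⟨i, rfl⟩⟩ : Algebra.adjoin ℂ (Set.range (fun i => Ideal.Quotient.mk p (d i)))) (ih _ (MvPolynomial.homogeneousComponent_isHomogeneous _ _))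

theorem trdeg_bound {κ : Type} [Fintype κ] (I p : Ideal (MvPolynomial σ ℂ)) [p.IsPrime]
    (hI : ∀ f ∈ I, ∀ k, MvPolynomial.homogeneousComponent k f ∈ I)
    (d : κ → MvPolynomial σ ℂ) (hd : ∀ i, (d i).IsHomogeneous 1) (M : ℕ)
    (hM : (MvPolynomial.idealOfVars σ ℂ) ^ (M+1) ≤ I ⊔ Ideal.span (Set.range d)) (hp : I ≤ p) :
    Algebra.trdeg ℂ (MvPolynomial σ ℂ ⧸ p) ≤ (Fintype.card κ : Cardinal) := by
  classical
  set s := Set.range (fun i => Ideal.Quotient.mk p (d i)) with hs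
  have hfin : {s : σ →₀ ℕ | s.degree < M + 1}.Finite := by
    have := Finsupp.finite_of_degree_le (σ := σ) M
    refine this.subset fun x hx => ?_
    simp only [mem_setOf_eq] at hx ⊢; omega
  have htop : Submodule.span (Algebra.adjoin ℂ s)
        ((fun s : σ →₀ ℕ => Ideal.Quotient.mk p (MvPolynomial.monomial s 1)) '' {s | s.degree < M + 1}) = ⊤ := by
    rw [eq_top_iff]
    rintro x -
    obtain ⟨P, rfl⟩ := Ideal.Quotient.mk_surjective x
    rw [← MvPolynomial.sum_homogeneousComponent P, map_sum]
    exact Submodule.sum_mem _ fun i _ => fin_lemma I p hI d hd M hM hp i _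
      (MvPolynomial.homogeneousComponent_isHomogeneous _ _)
  haveI : Module.Finite (Algebra.adjoin ℂ s) (MvPolynomial σ ℂ ⧸ p) := by
    refine ⟨?_⟩
    rw [← htop]
    exact Submodule.fg_span (hfin.image _)
  haveI : Algebra.IsIntegral (Algebra.adjoin ℂ s) (MvPolynomial σ ℂ ⧸ p) := inferInstance
  haveI : Algebra.IsAlgebraic (Algebra.adjoin ℂ s) (MvPolynomial σ ℂ ⧸ p) := inferInstance
  refine (Algebra.IsAlgebraic.trdeg_le_cardinalMk ℂ s).trans ?_
  refine Cardinal.mk_range_le.trans ?_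
  simp
end inter1

open Topology Filter Set

section inter2

theorem eval_sumAlg {A B : Type} (F : MvPolynomial (A ⊕ B) ℂ) (y : A → ℂ) (x : B → ℂ) :
    MvPolynomial.eval (Sum.elim y x) F
      = MvPolynomial.eval y (MvPolynomial.map (MvPolynomial.eval x) (MvPolynomial.sumAlgEquiv ℂ A B F)) := by
  induction F using MvPolynomial.induction_on with
  | C a =>
    have : MvPolynomial.sumAlgEquiv ℂ A B (MvPolynomial.C a) = MvPolynomial.C (MvPolynomial.C a) := by
      have := (MvPolynomial.sumAlgEquiv ℂ A B).commutes a
      exact this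
    rw [this, MvPolynomial.map_C, MvPolynomial.eval_C, MvPolynomial.eval_C, MvPolynomial.eval_C]
  | add p q hp hq => rw [map_add, map_add, map_add, map_add, hp, hq]
  | mul_X p i hp =>
    rw [map_mul, map_mul, map_mul, map_mul, hp]
    congr 1
    rcases i with i | i
    · rw [MvPolynomial.eval_X, MvPolynomial.sumAlgEquiv_X_inl]; simp
    · rw [MvPolynomial.eval_X, MvPolynomial.sumAlgEquiv_X_inr]; simp

variable {ι : Type} [Fintype ι] [DecidableEq ι]

theorem prod_indep (P K : Set (ι → ℂ)) (T T' : Finset ι)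
    (hP : ∀ F : MvPolynomial T ℂ, (∀ x ∈ P, MvPolynomial.eval (rs T x) F = 0) → F = 0)
    (hK : ∀ F : MvPolynomial T' ℂ, (∀ x ∈ K, MvPolynomial.eval (rs T' x) F = 0) → F = 0)
    (F : MvPolynomial (T' ⊕ T) ℂ)
    (h : ∀ x ∈ P, ∀ y ∈ K, MvPolynomial.eval (Sum.elim (rs T' y) (rs T x)) F = 0) : F = 0 := by
  have h1 : ∀ x ∈ P, MvPolynomial.map (MvPolynomial.eval (rs T x)) (MvPolynomial.sumAlgEquiv ℂ T' T F) = 0 := by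
    intro x hx
    apply hK
    intro y hy
    rw [← eval_sumAlg]; exact h x hx y hy
  have h2 : MvPolynomial.sumAlgEquiv ℂ T' T F = 0 := by
    apply MvPolynomial.ext
    intro s
    rw [MvPolynomial.coeff_zero]
    apply hP
    intro x hx
    have := congrArg (MvPolynomial.coeff s) (h1 x hx)
    rwa [MvPolynomial.coeff_map, MvPolynomial.coeff_zero] at this
  exact (map_eq_zero_iff _ (MvPolynomial.sumAlgEquiv ℂ T' T).injective).1 h2

theorem inter_contra (P K : Set (ι → ℂ)) (T T' : Finset ι)
    (hPc : ∀ (t : ℂ), ∀ z ∈ P, t • z ∈ P) (hKc : ∀ (t : ℂ), ∀ z ∈ K, t • z ∈ K)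
    (hcard : Fintype.card ι < T.card + T'.card)
    (hP : ∀ F : MvPolynomial T ℂ, (∀ x ∈ P, MvPolynomial.eval (rs T x) F = 0) → F = 0)
    (hK : ∀ F : MvPolynomial T' ℂ, (∀ x ∈ K, MvPolynomial.eval (rs T' x) F = 0) → F = 0)
    (hdiag : ∀ x : ι → ℂ, (∀ f : MvPolynomial ι ℂ, (∀ y ∈ P, MvPolynomial.eval y f = 0) → MvPolynomial.eval x f = 0) →
      (∀ f : MvPolynomial ι ℂ, (∀ y ∈ K, MvPolynomial.eval y f = 0) → MvPolynomial.eval x f = 0) → x = 0) : False := by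
  set W : Set (ι ⊕ ι → ℂ) := {z | (fun i => z (Sum.inl i)) ∈ P ∧ (fun i => z (Sum.inr i)) ∈ K} with hW
  set IW : Ideal (MvPolynomial (ι ⊕ ι) ℂ) := MvPolynomial.vanishingIdeal ℂ W with hIW
  set d : ι → MvPolynomial (ι ⊕ ι) ℂ := fun i => MvPolynomial.X (Sum.inl i) - MvPolynomial.X (Sum.inr i) with hd
  have memIW : ∀ f, f ∈ IW ↔ ∀ z ∈ W, MvPolynomial.eval z f = 0 := fun f => by
    rw [hIW, MvPolynomial.mem_vanishingIdeal_iff]; rfl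
  have hhom : ∀ f ∈ IW, ∀ k, MvPolynomial.homogeneousComponent k f ∈ IW := by
    intro f hf k
    rw [memIW] at hf ⊢
    intro z hz
    rw [← radPoly_coeff]
    have : radPoly f z = 0 := by
      apply Polynomial.funext
      intro t
      rw [radPoly_eval, Polynomial.eval_zero]
      exact hf _ ⟨hPc t _ hz.1, hKc t _ hz.2⟩
    rw [this, Polynomial.coeff_zero]
  have hzl : ∀ z ∈ MvPolynomial.zeroLocus ℂ (IW ⊔ Ideal.span (Set.range d)), z = 0 := by
    intro z hz
    rw [MvPolynomial.mem_zeroLocus_iff] at hz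
    have hz' : ∀ p ∈ IW ⊔ Ideal.span (Set.range d), MvPolynomial.eval z p = 0 := hz
    have heq : ∀ i, z (Sum.inl i) = z (Sum.inr i) := by
      intro i
      have := hz' (d i) (Ideal.mem_sup_right (Ideal.subset_span ⟨i, rfl⟩))
      rw [hd] at this
      simp only [map_sub, MvPolynomial.eval_X] at this
      exact sub_eq_zero.1 this
    have h0 : (fun i => z (Sum.inl i)) = 0 := by
      apply hdiag
      · intro f hf
        have := hz' (MvPolynomial.rename Sum.inl f) (Ideal.mem_sup_left ((memIW _).2 fun y hy => by
          rw [MvPolynomial.eval_rename]; exact hf _ hy.1))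
        rw [MvPolynomial.eval_rename] at this; exact this
      · intro f hf
        have := hz' (MvPolynomial.rename Sum.inr f) (Ideal.mem_sup_left ((memIW _).2 fun y hy => by
          rw [MvPolynomial.eval_rename]; exact hf _ hy.2))
        rw [MvPolynomial.eval_rename] at this
        have h3 : (fun i => z (Sum.inl i)) = z ∘ Sum.inr := funext heq
        rw [h3]; exact this
    funext j
    rcases j with j | j
    · exact congrFun h0 j
    · rw [← heq]; exact congrFun h0 j
  have hrad : MvPolynomial.idealOfVars (ι ⊕ ι) ℂ ≤ (IW ⊔ Ideal.span (Set.range d)).radical := by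
    rw [← MvPolynomial.vanishingIdeal_zeroLocus_eq_radical (K := ℂ)]
    unfold MvPolynomial.idealOfVars
    rw [Ideal.span_le]
    rintro _ ⟨j, rfl⟩
    rw [SetLike.mem_coe, MvPolynomial.mem_vanishingIdeal_iff]
    intro z hz
    rw [hzl z hz]; simp
  obtain ⟨M, hM⟩ := Ideal.exists_pow_le_of_le_radical_of_fg hrad (MvPolynomial.idealOfVars_fg _ _)
  have hM' := (Ideal.pow_le_pow_right (Nat.le_succ M)).trans hM
  -- prime
  set g : T' ⊕ T → ι ⊕ ι := Sum.elim (fun j => Sum.inr j.1) (fun j => Sum.inl j.1) with hg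
  have hkey : ∀ F : MvPolynomial (T' ⊕ T) ℂ, MvPolynomial.rename g F ∈ IW → F = 0 := by
    intro F hF
    apply prod_indep P K T T' hP hK
    intro x hx y hy
    have := (memIW _).1 hF (Sum.elim x y) ⟨hx, hy⟩
    rw [MvPolynomial.eval_rename] at this
    convert this using 3
    funext j
    rcases j with j | j <;> rfl
  let S : Submonoid (MvPolynomial (ι ⊕ ι) ℂ) :=
    (nonZeroDivisors (MvPolynomial (T' ⊕ T) ℂ)).map (MvPolynomial.rename (R := ℂ) g)
  have hdis : Disjoint (IW : Set (MvPolynomial (ι ⊕ ι) ℂ)) S := by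
    rw [Set.disjoint_left]
    rintro _ hI ⟨F, hF, rfl⟩
    exact nonZeroDivisors.ne_zero hF (hkey F hI)
  obtain ⟨p, hp, hIp, hpS⟩ := Ideal.exists_le_prime_disjoint _ S hdis
  have hind : AlgebraicIndependent ℂ (fun j : T' ⊕ T => Ideal.Quotient.mk p (MvPolynomial.X (g j))) := by
    rw [algebraicIndependent_iff]
    intro F hF
    by_contra hne
    have h1 : MvPolynomial.aeval (fun j : T' ⊕ T => Ideal.Quotient.mk p (MvPolynomial.X (g j))) F
        = Ideal.Quotient.mkₐ ℂ p (MvPolynomial.rename g F) := by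
      have : MvPolynomial.aeval (fun j : T' ⊕ T => Ideal.Quotient.mk p (MvPolynomial.X (g j)))
          = (Ideal.Quotient.mkₐ ℂ p).comp (MvPolynomial.rename (R := ℂ) g) := by
        apply MvPolynomial.algHom_ext
        intro j
        rw [MvPolynomial.aeval_X, AlgHom.comp_apply, MvPolynomial.rename_X]; rfl
      rw [this]; rfl
    rw [h1] at hF
    have h2 : MvPolynomial.rename g F ∈ p := Ideal.Quotient.eq_zero_iff_mem.1 hF
    exact Set.disjoint_left.1 hpS h2 ⟨F, mem_nonZeroDivisors_of_ne_zero hne, rfl⟩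
  have h1 := hind.cardinalMk_le_trdeg
  have hdh : ∀ i, (d i).IsHomogeneous 1 := fun i =>
    (MvPolynomial.isHomogeneous_X _ _).sub (MvPolynomial.isHomogeneous_X _ _)
  have h2 := trdeg_bound IW p hhom d hdh M hM' hIp
  have h3 := h1.trans h2
  rw [Cardinal.mk_fintype, Nat.cast_le, Fintype.card_sum, Fintype.card_coe, Fintype.card_coe] at h3
  omega
end inter2

open Topology Filter Set

section part2
variable {m : ℕ}
local notation "SP" => MvPolynomial (Fin (m + 3)) ℂ

theorem SG_sub_SD {w : (Fin m → Fin (m + 3)) → SP} {V : Fin (m+3) → SP} (e dG : ℕ)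
    (hwh : ∀ I, (w I).IsHomogeneous e) (hVh : ∀ k, (V k).IsHomogeneous dG)
    (hw : WD w) (hVT : TanP w V) (hrk : RK2 V) (h6 : (6 : ENNReal) ≤ dimH (SD w)) : SG V ⊆ SD w := by
  intro q0 hq0
  by_contra hq0D
  have hq0A : q0 ∈ SG V \ SD w := ⟨hq0, hq0D⟩
  set P : Set (Fin (m+3) → ℂ) := (SG V \ SD w) ∪ {0} with hPdef
  set K : Set (Fin (m+3) → ℂ) := SD w ∪ {0} with hKdef
  have hSDc : ∀ (t : ℂ), t ≠ 0 → ∀ z, (t • z ∈ SD w ↔ z ∈ SD w) := by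
    intro t ht z
    unfold SD
    simp only [mem_setOf_eq, eval_smul_hom _ _ (hwh _), mul_eq_zero, ne_eq, smul_eq_zero, ht, false_or]
    refine and_congr Iff.rfl (forall_congr' fun I => ?_)
    simp [ht]
  have hKc : ∀ (t : ℂ), ∀ z ∈ K, t • z ∈ K := by
    rintro t z (hz | hz)
    · by_cases ht : t = 0
      · right; simp [ht]
      · left; exact (hSDc t ht z).2 hz
    · right; rw [mem_singleton_iff] at hz ⊢; rw [hz, smul_zero]
  have hPc : ∀ (t : ℂ), ∀ z ∈ P, t • z ∈ P := by
    rintro t z (hz | hz)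
    · by_cases ht : t = 0
      · right; simp [ht]
      · left
        refine ⟨?_, fun h => hz.2 ((hSDc t ht z).1 h)⟩
        obtain ⟨⟨h0, c, hc⟩, -⟩ := hz
        refine ⟨smul_ne_zero ht h0, t ^ dG * c * t⁻¹, ?_⟩
        funext k
        have := congrFun hc k
        unfold evV at this ⊢
        rw [eval_smul_hom _ _ (hVh k), this]
        simp only [Pi.smul_apply, smul_eq_mul]
        field_simp
    · right; rw [mem_singleton_iff] at hz ⊢; rw [hz, smul_zero]
  obtain ⟨T, g, r, hT, hr, -, -, hg, -⟩ := A_param hw hVT hrk q0 hq0A univ univ_mem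
  have hP : ∀ F : MvPolynomial T ℂ, (∀ x ∈ P, MvPolynomial.eval (rs T x) F = 0) → F = 0 := by
    intro F hF
    refine MvPolynomial.funext_set (fun i => Metric.ball (rs T q0 i) r) ?_ ?_
    · intro i
      exact infinite_of_mem_nhds (rs T q0 i) (Metric.ball_mem_nhds _ hr)
    · intro t ht
      have htb : t ∈ Metric.ball (rs T q0) r := by
        rw [Metric.mem_ball, dist_pi_lt_iff hr]
        intro i; exact ht i (mem_univ _)
      have := hF (g t) (Or.inl (hg t htb).2.1)
      rw [(hg t htb).2.2] at this
      rw [this, map_zero]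
  -- K
  have hT' : ∃ T' : Finset (Fin (m+3)), T'.card = 3 ∧ ∀ p ∈ MvPolynomial.vanishingIdeal ℂ K, p ≠ 0 → ¬ p.vars ⊆ T' := by
    by_contra hcon
    push Not at hcon
    have h1 := dim_lemma 2 (MvPolynomial.vanishingIdeal ℂ K) (fun T hT => hcon T hT)
    have h2 : SD w ⊆ VJ (MvPolynomial.vanishingIdeal ℂ K) := by
      intro z hz f hf
      exact hf z (Or.inl hz)
    have h3 := h6.trans ((dimH_mono h2).trans h1)
    norm_num at h3
  obtain ⟨T', hT'c, hT'⟩ := hT'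
  have hK : ∀ F : MvPolynomial T' ℂ, (∀ x ∈ K, MvPolynomial.eval (rs T' x) F = 0) → F = 0 := by
    intro F hF
    by_contra hne
    refine hT' (MvPolynomial.rename Subtype.val F) ?_ ?_ ?_
    · rw [MvPolynomial.mem_vanishingIdeal_iff]
      intro x hx
      have : MvPolynomial.eval x (MvPolynomial.rename Subtype.val F) = 0 := by
        rw [MvPolynomial.eval_rename]; exact hF x hx
      exact this
    · intro h
      exact hne ((map_eq_zero_iff _ (MvPolynomial.rename_injective _ Subtype.val_injective)).1 h)
    · refine (MvPolynomial.vars_rename _ _).trans ?_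
      intro i hi
      obtain ⟨j, _, rfl⟩ := Finset.mem_image.1 hi
      exact j.2
  refine inter_contra P K T T' hPc hKc (by rw [hT, hT'c, Fintype.card_fin]; omega) hP hK ?_
  intro x h1 h2
  by_contra hx
  obtain ⟨i, hi⟩ : ∃ i, x i ≠ 0 := by
    by_contra hcon; push Not at hcon; exact hx (funext hcon)
  have hA : x ∈ SG V \ SD w := by
    refine A_of_van hw hVT hrk x hx fun g hg => ?_
    have := h1 (MvPolynomial.X i * g) (by
      rintro y (hy | hy)
      · rw [map_mul, Idl_van y hy.1 hy.2 g hg, mul_zero]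
      · rw [mem_singleton_iff] at hy; rw [hy, map_mul, MvPolynomial.eval_X]; simp)
    rw [map_mul, MvPolynomial.eval_X] at this
    exact (mul_eq_zero.1 this).resolve_left hi
  refine hA.2 ⟨hx, fun I => ?_⟩
  have := h2 (MvPolynomial.X i * w I) (by
      rintro y (hy | hy)
      · rw [map_mul, hy.2 I, mul_zero]
      · rw [mem_singleton_iff] at hy; rw [hy, map_mul, MvPolynomial.eval_X]; simp)
  rw [map_mul, MvPolynomial.eval_X] at this
  exact (mul_eq_zero.1 this).resolve_left hi
end part2

open Topology Filter Set
open scoped ENNReal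

section conv
variable {m : ℕ}
local notation "SP" => MvPolynomial (Fin (m + 3)) ℂ

theorem CodimGE_mono {n : ℕ} {A B : Set (Cn n)} {c : ℕ} (h : CodimGE n B c) (hAB : A ⊆ B) : CodimGE n A c := by
  rcases h with h | h
  · left; rw [h] at hAB; exact subset_empty_iff.1 hAB
  · right; exact (add_le_add_left (dimH_mono hAB) _).trans h

theorem codim_irr (S : Set (Cn (m+3))) (hS : CodimGE (m+3) S 2) (p : SP) (hp : Irreducible p) :
    ∃ z, z ≠ 0 ∧ MvPolynomial.eval z p = 0 ∧ z ∉ S := by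
  by_contra hcon
  push Not at hcon
  have hsub : {z : Fin (m+3) → ℂ | z ≠ 0 ∧ MvPolynomial.eval z p = 0} ⊆ S := fun z hz => hcon z hz.1 hz.2
  have h1 := hyp_dim p hp
  rcases hS with h | h
  · rw [h] at hsub
    rw [subset_empty_iff.1 hsub, dimH_empty] at h1
    have : ((2 * (m+2) : ℕ) : ENNReal) ≤ ((0:ℕ) : ENNReal) := by simpa using h1
    rw [Nat.cast_le] at this
    omega
  · have h2 := h1.trans (dimH_mono hsub)
    have h3 : ((2 * (m+2) : ℕ) : ENNReal) + 2 * ((2:ℕ) : ENNReal) ≤ 2 * ((m+3 : ℕ) : ENNReal) :=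
      (add_le_add_left h2 _).trans h
    have h4 : ((2 * (m+2) + 2 * 2 : ℕ) : ENNReal) ≤ ((2 * (m+3) : ℕ) : ENNReal) := by
      rw [Nat.cast_add, Nat.cast_mul 2 2, Nat.cast_mul 2 (m+3)]; exact h3
    rw [Nat.cast_le] at h4
    omega

theorem irrX0 : Irreducible (MvPolynomial.X 0 : SP) := MvPolynomial.X_prime.irreducible

theorem form_ext (f g : AlternatingMap ℂ (Cn (m+3)) ℂ (Fin m)) (h : ∀ I, f (eI ℂ I) = g (eI ℂ I)) : f = g := by
  refine Module.Basis.ext_alternating (Pi.basisFun ℂ (Fin (m+3))) fun I _ => ?_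
  have := h I
  unfold eI at this
  simpa [Pi.basisFun_apply] using this

theorem conv_w (ω : Form (m+3) m) (d : ℕ) (hol : HolFormOn Set.univ ω)
    (homog : ∀ (t : ℂ) (z : Cn (m+3)) (v : Fin m → Cn (m+3)), ω (t • z) v = t ^ (d + 1) * ω z v) :
    ∃ w : (Fin m → Fin (m+3)) → SP, (∀ I, (w I).IsHomogeneous (d+1)) ∧
      ∀ z I, ω z (eI ℂ I) = MvPolynomial.eval z (w I) := by
  have : ∀ I : Fin m → Fin (m+3), ∃ P : SP, P.IsHomogeneous (d+1) ∧ ∀ z, ω z (eI ℂ I) = MvPolynomial.eval z P := fun I =>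
    poly_of_homog (fun z => ω z (eI ℂ I)) (hol _ 0 (mem_univ _)) (d+1) (fun t z => homog t z _)
  choose w hw using this
  exact ⟨w, fun I => (hw I).1, fun z I => (hw I).2 z⟩

theorem sing_w (ω : Form (m+3) m) (w : (Fin m → Fin (m+3)) → SP)
    (hw : ∀ z I, ω z (eI ℂ I) = MvPolynomial.eval z (w I)) : {z | z ≠ 0 ∧ ω z = 0} = SD w := by
  ext z
  unfold SD
  simp only [mem_setOf_eq]
  refine and_congr Iff.rfl ⟨fun h I => by rw [← hw, h]; rfl, fun h => form_ext _ _ fun I => by rw [hw, h]; rfl⟩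

theorem conv_WD (ω : Form (m+3) m) (w : (Fin m → Fin (m+3)) → SP)
    (hw : ∀ z I, ω z (eI ℂ I) = MvPolynomial.eval z (w I))
    (hc : CodimGE (m+3) {z | z ≠ 0 ∧ ω z = 0} 2)
    (hlf : ∀ q : Cn (m+3), q ≠ 0 → ∃ (X Y : VF (m+3)) (Θ : Form (m+3) (m + 3)),
      AnalyticAt ℂ X q ∧ AnalyticAt ℂ Y q ∧ HolFormAt q Θ ∧
      ∀ᶠ z in 𝓝 q, ∀ v : Fin m → Cn (m+3),
      ω z v = Θ z (Fin.cons (X z) (Fin.cons (Y z) (Fin.cons z v)))) : WD w := by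
  have hirr : ∀ p, Irreducible p → ∃ I, ¬ p ∣ w I := by
    intro p hp
    obtain ⟨z, hz, hpz, hzS⟩ := codim_irr _ hc p hp
    by_contra hcon
    push Not at hcon
    rw [sing_w ω w hw] at hzS
    refine hzS ⟨hz, fun I => ?_⟩
    obtain ⟨c, hc⟩ := hcon I
    rw [hc, map_mul, hpz, zero_mul]
  refine ⟨hirr, ?_, ?_⟩
  · obtain ⟨I, hI⟩ := hirr _ irrX0
    exact ⟨I, fun h => hI (h ▸ dvd_zero _)⟩
  · intro q hq
    obtain ⟨X, Y, Θ, hX, hY, hΘ, hev⟩ := hlf q hq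
    refine ⟨fun z => Θ z (Pi.basisFun ℂ (Fin (m+3))) • X z, Y, ?_, ?_, ?_⟩
    · intro i
      have h1 : AnalyticAt ℂ (fun z => X z i) q := (analyticAt_pi_iff.1 hX) i
      exact (hΘ _).fun_mul h1
    · intro i
      exact (analyticAt_pi_iff.1 hY) i
    · filter_upwards [hev] with z hz I
      rw [← hw, hz, br_smul0]
      conv_lhs => rw [AlternatingMap.eq_smul_basis_det (Pi.basisFun ℂ (Fin (m+3))) (Θ z), Pi.basisFun_det]
      rfl

theorem conv_tan (ω : Form (m+3) m) (w : (Fin m → Fin (m+3)) → SP)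
    (hw : ∀ z I, ω z (eI ℂ I) = MvPolynomial.eval z (w I)) (V : Fin (m+3) → SP)
    (h : ∀ (z : Cn (m+3)) (v : Fin m → Cn (m+3)) (i : Fin m), v i = evV V z → ω z v = 0) : TanP w V := by
  intro I i
  apply MvPolynomial.funext
  intro z
  rw [map_sum, map_zero]
  have h1 := h z (Function.update (eI ℂ I) i (evV V z)) i (Function.update_self _ _ _)
  have h2 : evV V z = ∑ k, evV V z k • (Pi.single k 1 : Fin (m+3) → ℂ) := by
    exact pi_eq_sum_univ' (evV V z)
  rw [h2, AlternatingMap.map_update_sum] at h1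
  rw [← h1]
  refine Finset.sum_congr rfl fun k _ => ?_
  rw [map_mul, AlternatingMap.map_update_smul, ← hw, smul_eq_mul]
  congr 2
  funext a
  unfold eI
  by_cases ha : a = i
  · subst ha; simp
  · simp [Function.update_of_ne ha]

theorem conv_V (V : VF (m+3)) (d : ℕ) (hol : AnalyticOnNhd ℂ V Set.univ)
    (homog : ∀ (t : ℂ) (z : Cn (m+3)), V (t • z) = t ^ d • V z) :
    ∃ V' : Fin (m+3) → SP, (∀ k, (V' k).IsHomogeneous d) ∧ V = evV V' := by
  have : ∀ k, ∃ P : SP, P.IsHomogeneous d ∧ ∀ z, V z k = MvPolynomial.eval z P := fun k =>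
    poly_of_homog (fun z => V z k) ((analyticAt_pi_iff.1 (hol 0 (mem_univ _))) k) d (fun t z => by
      simpa using congrFun (homog t z) k)
  choose V' h using this
  exact ⟨V', fun k => (h k).1, funext fun z => funext fun k => (h k).2 z⟩

theorem sing_V (V : Fin (m+3) → SP) : {z : Cn (m+3) | z ≠ 0 ∧ evV V z ∈ Submodule.span ℂ {z}} = SG V := by
  ext z
  unfold SG
  simp only [mem_setOf_eq, Submodule.mem_span_singleton]
  refine and_congr Iff.rfl (exists_congr fun c => eq_comm)

theorem conv_VDat (V : Fin (m+3) → SP) (hc : CodimGE (m+3) (SG V) 2) : VDat V := by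
  have hirr : ∀ p, Irreducible p → ∃ i j, ¬ p ∣ V i * MvPolynomial.X j - V j * MvPolynomial.X i := by
    intro p hp
    obtain ⟨z, hz, hpz, hzS⟩ := codim_irr _ hc p hp
    by_contra hcon
    push Not at hcon
    apply hzS
    obtain ⟨j, hj⟩ : ∃ j, z j ≠ 0 := by
      by_contra hcon; push Not at hcon; exact hz (funext hcon)
    refine ⟨hz, evV V z j / z j, ?_⟩
    funext i
    obtain ⟨c, hc⟩ := hcon i j
    have := congrArg (MvPolynomial.eval z) hc
    rw [map_mul, hpz, zero_mul, map_sub, map_mul, map_mul, MvPolynomial.eval_X, MvPolynomial.eval_X] at this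
    simp only [Pi.smul_apply, smul_eq_mul]
    unfold evV
    field_simp
    linear_combination this
  refine ⟨hirr, ?_⟩
  obtain ⟨i, j, hI⟩ := hirr _ irrX0
  exact ⟨i, j, fun h => hI (h ▸ dvd_zero _)⟩

theorem append_eq (hn : m + 2 + 1 = 3 + (m + 2 - 2)) (A B C : Fin (m+3) → ℂ) (v : Fin m → Fin (m+3) → ℂ) :
    Matrix.det (Matrix.of fun (i j : Fin (m+3)) => Fin.append (n := m) ![A, B, C] v (Fin.cast hn i) j) = br A B C v := by
  unfold br brM
  congr 1
  funext i j
  simp only [Matrix.of_apply]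
  refine Fin.cases ?_ (fun i => ?_) i
  · rfl
  refine Fin.cases ?_ (fun i => ?_) i
  · rfl
  refine Fin.cases ?_ (fun i => ?_) i
  · rfl
  simp only [Fin.cons_succ]
  have : Fin.cast hn i.succ.succ.succ = Fin.natAdd 3 i := by
    ext; simp; omega
  rw [this, Fin.append_right]

theorem br_alt (ω : AlternatingMap ℂ (Cn (m+3)) ℂ (Fin m)) (A B C : Fin (m+3) → ℂ)
    (h : ∀ I, ω (eI ℂ I) = br A B C (eI ℂ I)) (v) : ω v = br A B C v := by
  let δ : AlternatingMap ℂ (Cn (m+3)) ℂ (Fin (m+3)) := Matrix.detRowAlternating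
  let f : AlternatingMap ℂ (Cn (m+3)) ℂ (Fin m) := ((δ.curryLeft A).curryLeft B).curryLeft C
  have : ω = f := form_ext _ _ fun I => h I
  rw [this]; rfl
end conv

open Topology Filter Set
open scoped ENNReal

section final
variable {m : ℕ}
local notation "SP" => MvPolynomial (Fin (m + 3)) ℂ

theorem main_data (D : ProjDist (m+2) 2) (G : ProjFol1 (m+2)) (hlf : PLocFree D) (hT : PTangent G D)
    (hrk : PLinRankGE G 2) :
    ∃ (w : (Fin m → Fin (m+3)) → SP) (V : Fin (m+3) → SP),
      (∀ I, (w I).IsHomogeneous (D.d+1)) ∧ (∀ k, (V k).IsHomogeneous G.d) ∧ WD w ∧ VDat V ∧ TanP w V ∧ RK2 V ∧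
      G.V = evV V ∧ G.coneSing = SG V ∧ D.coneSing = SD w ∧
      (∀ z I, D.ω z (eI ℂ I) = MvPolynomial.eval z (w I)) := by
  obtain ⟨w, hwh, hw⟩ := conv_w (m := m) D.ω D.d D.hol D.homog
  obtain ⟨V, hVh, hV⟩ := conv_V (m := m) G.V G.d G.hol G.homog
  have hG : G.coneSing = SG V := by
    unfold ProjFol1.coneSing; rw [hV]; exact sing_V V
  have hD : D.coneSing = SD w := sing_w (m := m) D.ω w hw
  refine ⟨w, V, hwh, hVh, conv_WD (m := m) D.ω w hw D.codim hlf, conv_VDat V ?_, conv_tan (m := m) D.ω w hw V ?_, ?_, hV, hG, hD, hw⟩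
  · rw [← hG]; exact G.codim
  · rw [← hV]; exact hT
  · intro q hq
    rw [← hG] at hq
    rw [← hV]; exact hrk q hq

theorem split_of_sub (hn : m + 2 + 1 = 3 + (m + 2 - 2)) (D : ProjDist (m+2) 2) (G : ProjFol1 (m+2)) (hlf : PLocFree D) (hT : PTangent G D)
    (hrk : PLinRankGE G 2) (h : G.coneSing ⊆ D.coneSing) : ∃ H : ProjFol1 (m+2), SplitPair hn G H D := by
  obtain ⟨w, V, hwh, hVh, hwd, hvd, htan, hrk2, hV, hG, hD, hw⟩ := main_data D G hlf hT hrk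
  rw [hG, hD] at h
  obtain ⟨Y, hY⟩ := exists_Y hwd htan hvd hrk2 h
  obtain ⟨j, Y', hY'h, hY'⟩ := homog_main (D.d+1) G.d hwh hwd.ne hVh Y hY
  have hform : ∀ z v, D.ω z v = br (G.V z) (evV Y' z) z v := by
    intro z v
    refine br_alt (m := m) (D.ω z) _ _ _ (fun I => ?_) v
    rw [hw, hY', ev_br, evV_X, hV]
  refine ⟨⟨j, evV Y', ?_, ?_, ?_⟩, 1, one_ne_zero, ?_⟩
  · intro z _
    exact analyticAt_pi_iff.2 fun i => analytic_eval (Y' i) univ z (mem_univ _)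
  · intro t z
    funext k
    exact eval_smul_hom (Y' k) j (hY'h k) t z
  · refine CodimGE_mono D.codim ?_
    rintro z ⟨hz, hz2⟩
    refine ⟨hz, ?_⟩
    obtain ⟨c, hc⟩ := Submodule.mem_span_singleton.1 hz2
    ext v
    rw [hform, ← hc, br_smul1, br_12, mul_zero]; rfl
  · intro z v
    rw [one_mul]
    exact (hform z v).trans (append_eq hn _ _ _ _).symm

theorem sub_of_split (hn : m + 2 + 1 = 3 + (m + 2 - 2)) (D : ProjDist (m+2) 2) (G H : ProjFol1 (m+2))
    (h : SplitPair hn G H D) : G.coneSing ⊆ D.coneSing := by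
  obtain ⟨c, hc, h⟩ := h
  rintro z ⟨hz, hz2⟩
  refine ⟨hz, ?_⟩
  obtain ⟨a, ha⟩ := Submodule.mem_span_singleton.1 hz2
  ext v
  have h1 := append_eq (m := m) hn (G.V z) (H.V z) z v
  have h2 : br (m := m) (G.V z) (H.V z) z v = 0 := by
    rw [← ha, br_smul0, br_02, mul_zero]
  refine (h z v).trans ?_
  refine (congrArg (c * ·) (h1.trans h2)).trans ?_
  exact mul_zero c

theorem sub_of_comp (D : ProjDist (m+2) 2) (G : ProjFol1 (m+2)) (hlf : PLocFree D) (hT : PTangent G D)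
    (hrk : PLinRankGE G 2)
    (h : ∀ C : Set (Cn (m + 2 + 1)), IsIrredComponentIn {z : Cn (m + 2 + 1) | z ≠ 0} G.coneSing C →
            dimH C = ((2 * (m + 2 - 1) : ℕ) : ℝ≥0∞) → (C ∩ D.coneSing).Nonempty) : G.coneSing ⊆ D.coneSing := by
  obtain ⟨w, V, hwh, hVh, hwd, hvd, htan, hrk2, hV, hG, hD, hw⟩ := main_data D G hlf hT hrk
  rw [hG, hD] at h ⊢
  intro q hq
  by_contra hqD
  obtain ⟨C, hC, hdim, hCD⟩ := comp_exists hwd htan hrk2 q ⟨hq, hqD⟩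
  obtain ⟨z, hz, hz2⟩ := h C hC hdim
  exact hCD z hz hz2

theorem part1 (hn : m + 2 + 1 = 3 + (m + 2 - 2)) (D : ProjDist (m+2) 2) (G : ProjFol1 (m+2)) (hlf : PLocFree D) (hT : PTangent G D)
    (hrk : PLinRankGE G 2) :
      (((∀ C : Set (Cn (m + 2 + 1)), IsIrredComponentIn {z : Cn (m + 2 + 1) | z ≠ 0} G.coneSing C →
            (C ∩ D.coneSing).Nonempty) ↔
          (∃ H : ProjFol1 (m + 2), SplitPair hn G H D)) ∧
       ((∀ C : Set (Cn (m + 2 + 1)), IsIrredComponentIn {z : Cn (m + 2 + 1) | z ≠ 0} G.coneSing C →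
            dimH C = ((2 * (m + 2 - 1) : ℕ) : ℝ≥0∞) → (C ∩ D.coneSing).Nonempty) ↔
          (∃ H : ProjFol1 (m + 2), SplitPair hn G H D)) ∧
       ((G.coneSing ⊆ D.coneSing) ↔
          (∃ H : ProjFol1 (m + 2), SplitPair hn G H D))) := by
  have h1 : G.coneSing ⊆ D.coneSing → ∃ H : ProjFol1 (m+2), SplitPair hn G H D :=
    split_of_sub hn D G hlf hT hrk
  have h2 : (∃ H : ProjFol1 (m+2), SplitPair hn G H D) → G.coneSing ⊆ D.coneSing :=
    fun ⟨H, hH⟩ => sub_of_split hn D G H hH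
  have h3 : G.coneSing ⊆ D.coneSing → ∀ C : Set (Cn (m + 2 + 1)),
      IsIrredComponentIn {z : Cn (m + 2 + 1) | z ≠ 0} G.coneSing C → (C ∩ D.coneSing).Nonempty := by
    intro hs C hC
    obtain ⟨z, hz⟩ := hC.1.2.1
    exact ⟨z, hz, hs (hC.2.1 hz)⟩
  refine ⟨⟨fun h => h1 (sub_of_comp D G hlf hT hrk fun C hC _ => h C hC), fun h => h3 (h2 h)⟩,
    ⟨fun h => h1 (sub_of_comp D G hlf hT hrk h), fun h C hC _ => h3 (h2 h) C hC⟩, ⟨h1, h2⟩⟩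

theorem part2 (hn : m + 2 + 1 = 3 + (m + 2 - 2)) (D : ProjDist (m+2) 2) (G : ProjFol1 (m+2)) (hlf : PLocFree D)
    (h6 : (6 : ℝ≥0∞) ≤ dimH D.coneSing) (hT : PTangent G D)
    (hrk : PLinRankGE G 2) : PSplits hn D := by
  obtain ⟨w, V, hwh, hVh, hwd, hvd, htan, hrk2, hV, hG, hD, hw⟩ := main_data D G hlf hT hrk
  obtain ⟨H, c, hc, h⟩ := split_of_sub hn D G hlf hT hrk (by
    rw [hG, hD]
    rw [hD] at h6
    exact SG_sub_SD _ _ hwh hVh hwd htan hrk2 h6)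
  exact ⟨G.V, H.V, G.d, H.d, c, hc, G.hol, H.hol, G.homog, H.homog, h⟩

end final

/-- Theorem B: For a two-dimensional distribution `D` on `ℙⁿ`, `n ≥ 3`,
with locally free tangent sheaf, tangent to a one-dimensional foliation `G` of linear
rank at least `2`, the following are equivalent: (1) every irreducible component of
`sing G` meets `sing D`; (2) every irreducible component of `sing G` of dimension `n-2`
meets `sing D`; (3) `sing G ⊆ sing D`; (4) there is a one-dimensional foliation `H`
with `T_D = T_G ⊕ T_H`. In particular, for `n ≥ 4`, if moreover `dim sing D ≥ 2`
then `T_D` splits. (Everything is expressed in homogeneous coordinates; singular sets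
are cones in `ℂⁿ⁺¹ \ {0}`, where dimensions are one more than in `ℙⁿ`.) -/
theorem statement_1 :
    (∀ (n : ℕ) (hn : 3 ≤ n) (D : ProjDist n 2) (G : ProjFol1 n),
      PLocFree D → PTangent G D → PLinRankGE G 2 →
      (((∀ C : Set (Cn (n + 1)), IsIrredComponentIn {z : Cn (n + 1) | z ≠ 0} G.coneSing C →
            (C ∩ D.coneSing).Nonempty) ↔
          (∃ H : ProjFol1 n, SplitPair (by omega) G H D)) ∧
       ((∀ C : Set (Cn (n + 1)), IsIrredComponentIn {z : Cn (n + 1) | z ≠ 0} G.coneSing C →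
            dimH C = ((2 * (n - 1) : ℕ) : ℝ≥0∞) → (C ∩ D.coneSing).Nonempty) ↔
          (∃ H : ProjFol1 n, SplitPair (by omega) G H D)) ∧
       ((G.coneSing ⊆ D.coneSing) ↔
          (∃ H : ProjFol1 n, SplitPair (by omega) G H D)))) ∧
    (∀ (n : ℕ) (hn : 4 ≤ n) (D : ProjDist n 2) (G : ProjFol1 n),
      PLocFree D → (6 : ℝ≥0∞) ≤ dimH D.coneSing → PTangent G D → PLinRankGE G 2 →
      PSplits (by omega) D) := by
  constructor
  · intro n hn D G h1 h2 h3
    obtain ⟨m, rfl⟩ : ∃ m, n = m + 2 := ⟨n - 2, by omega⟩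
    exact part1 (by omega) D G h1 h2 h3
  · intro n hn D G h1 h6 h2 h3
    obtain ⟨m, rfl⟩ : ∃ m, n = m + 2 := ⟨n - 2, by omega⟩
    exact part2 (by omega) D G h1 h6 h2 h3
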